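/- arXiv:1401.1555 — 2 statements merged into one kernel-verified Lean document; each statement's English description precedes it below -/
import Mathlib

section
/- Let ν_j(x) = #{m ≤ x : Ω(m) = j}. Fix τ ∈ (0,∞) with τ ≠ 2, let g(n) be integers with g(n)/log log n → τ as n → ∞, fix k ≥ 1, and let [a₁,b₁],…,[a_k,b_k] be pairwise disjoint closed subintervals of (0,1] with a := a₁+⋯+a_k and b := b₁+⋯+b_k < 1. Then: (i) if τ < 2, for every ε > 0 there exists n₀ such that for all n ≥ n₀ and all primes p_i ∈ [n^{a_i}, n^{b_i}] (i = 1,…,k), ν_{g(n)−k}(n/(p₁⋯p_k)) / ν_{g(n)}(n) ≥ (1−ε) · τ^k · (1−b)^τ / ((1−a) · p₁⋯p_k); (ii) if τ > 2, for every ε > 0 there exists n₀ such that for all n ≥ n₀ and all primes p_i ∈ [n^{a_i}, n^{b_i}] (i = 1,…,k), ν_{g(n)−k}(n/(p₁⋯p_k)) / ν_{g(n)}(n) ≥ (1−ε) · 2^k · (1−b) / (p₁⋯p_k). -/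
open Filter Set Topology

/-- `nuOmega j x` is the number of positive integers `m ≤ x` with exactly `j` prime
factors counted with multiplicity. -/
noncomputable def nuOmega (j : ℕ) (x : ℝ) : ℕ :=
  ((Finset.Icc 1 ⌊x⌋₊).filter (fun m => m.primeFactorsList.length = j)).card

open ArithmeticFunction (cardFactors cardFactors_mul cardFactors_apply_prime_pow)

/-- The normalised Chebyshev function `v ↦ ψ(e^v) e^{-v}`. -/
noncomputable def psiNormalized (v : ℝ) : ℝ := Chebyshev.psi (Real.exp v) * Real.exp (-v)

lemma psiNormalized_nonneg (v : ℝ) : 0 ≤ psiNormalized v :=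
  mul_nonneg (Chebyshev.psi_nonneg _) (Real.exp_pos _).le

lemma psiNormalized_le (v : ℝ) : psiNormalized v ≤ Real.log 4 + 4 := by
  have := Chebyshev.psi_le_const_mul_self (Real.exp_pos v).le
  calc psiNormalized v ≤ (Real.log 4 + 4) * Real.exp v * Real.exp (-v) :=
        mul_le_mul_of_nonneg_right this (Real.exp_pos _).le
    _ = Real.log 4 + 4 := by rw [mul_assoc, ← Real.exp_add]; simp

lemma measurable_psiNormalized : Measurable psiNormalized :=
  (Chebyshev.psi_mono.measurable.comp Real.measurable_exp).mul (by fun_prop)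

lemma psiNormalized_mul_exp_le {u v : ℝ} (h : u ≤ v) :
    psiNormalized u * Real.exp (u - v) ≤ psiNormalized v := by
  have h1 := Chebyshev.psi_mono (Real.exp_le_exp.2 h)
  have h2 : psiNormalized u * Real.exp (u - v) = Chebyshev.psi (Real.exp u) * Real.exp (-v) := by
    rw [psiNormalized, mul_assoc, ← Real.exp_add]; ring_nf
  rw [h2]
  exact mul_le_mul_of_nonneg_right h1 (Real.exp_pos _).le

lemma norm_psiNormalized_sub_one_le (v : ℝ) : ‖((psiNormalized v - 1 : ℝ) : ℂ)‖ ≤ 7 := by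
  have h1 := psiNormalized_nonneg v
  have h2 := psiNormalized_le v
  have h3 : Real.log 4 ≤ 2 := by
    have : Real.log 4 = 2 * Real.log 2 := by
      rw [show (4 : ℝ) = 2 ^ 2 by norm_num, Real.log_pow]; norm_num
    have := Real.log_two_lt_d9
    linarith
  rw [Complex.norm_real, Real.norm_eq_abs, abs_le]
  constructor <;> linarith

open ArithmeticFunction in
lemma laplace_psiNormalized_sub_one {δ : ℝ} (hδ : 0 < δ) (t : ℝ) :
    ∫ v in Ioi (0 : ℝ), ((psiNormalized v - 1 : ℝ) : ℂ) * Complex.exp (-(δ + t * Complex.I) * v) =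
      (vonMangoldt.LFunctionResidueClassAux (1 : ZMod 1) (1 + δ + t * Complex.I) - 1) /
        (1 + δ + t * Complex.I) := by
  set s : ℂ := 1 + δ + t * Complex.I with hs
  have hsre : s.re = 1 + δ := by simp [hs]
  have hs1 : 1 < s.re := by rw [hsre]; linarith
  have hs0 : s ≠ 0 := by intro h; rw [h] at hs1; simp at hs1; linarith
  have hs10 : s - 1 ≠ 0 := by
    intro h; rw [sub_eq_zero] at h; rw [h] at hs1; simp at hs1
  have hz : (δ + t * Complex.I : ℂ) = s - 1 := by rw [hs]; ring
  rw [hz]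
  have hre : (-(s - 1)).re < 0 := by simp [hsre]; linarith
  have h1 := vonMangoldt.eqOn_LFunctionResidueClassAux (q := 1) (a := 1) isUnit_one
    (show s ∈ {s : ℂ | 1 < s.re} from hs1)
  rw [h1]
  have h2 : (fun n : ℕ => (vonMangoldt.residueClass (1 : ZMod 1) n : ℂ)) =
      fun n : ℕ => ((Λ n : ℝ) : ℂ) := by
    ext n
    simp [vonMangoldt.residueClass, Set.indicator, Subsingleton.elim (n : ZMod 1) 1]
  have h3 : LSeries (fun n : ℕ => ((Λ n : ℝ) : ℂ)) s =
      s * ∫ x in Set.Ioi (1 : ℝ), (Chebyshev.psi x : ℂ) * (x : ℂ) ^ (-(s + 1)) := by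
    rw [LSeries_eq_mul_integral_of_nonneg (fun n => Λ n) zero_le_one hs1 _
      (fun n => vonMangoldt_nonneg)]
    · congr 1
      refine MeasureTheory.integral_congr_ae (.of_forall fun x => ?_)
      simp only [Chebyshev.psi]
      push_cast
      rfl
    · refine Asymptotics.IsBigO.of_bound (Real.log 4 + 4) (.of_forall fun n => ?_)
      have := Chebyshev.psi_le_const_mul_self (x := n) (by positivity)
      simp only [Chebyshev.psi, Nat.floor_natCast] at this
      rw [Real.norm_of_nonneg (Finset.sum_nonneg fun _ _ => vonMangoldt_nonneg)]
      have e : Finset.Icc 1 n = Finset.Ioc 0 n := by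
        ext; simp only [Finset.mem_Icc, Finset.mem_Ioc]; omega
      rw [e]
      simpa using this
  have h4 := MeasureTheory.integral_comp_exp_Ioi
    (fun x : ℝ => (Chebyshev.psi x : ℂ) * (x : ℂ) ^ (-(s + 1))) 0
  rw [Real.exp_zero] at h4
  have h5 : ∫ v in Ioi (0 : ℝ), (psiNormalized v : ℂ) * Complex.exp (-(s - 1) * v) =
      LSeries (fun n : ℕ => ((Λ n : ℝ) : ℂ)) s / s := by
    rw [h3, mul_div_cancel_left₀ _ hs0, ← h4]
    refine MeasureTheory.integral_congr_ae (.of_forall fun v => ?_)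
    simp only [psiNormalized, Complex.real_smul]
    have : ((Real.exp v : ℝ) : ℂ) ^ (-(s + 1)) = Complex.exp (-(s + 1) * v) := by
      rw [Complex.cpow_def_of_ne_zero (by simp), ← Complex.ofReal_log (Real.exp_pos v).le,
        Real.log_exp, mul_comm]
    rw [this]
    push_cast
    rw [mul_assoc, ← Complex.exp_add, mul_left_comm, ← Complex.exp_add]
    congr 2
    ring
  have hbd : MeasureTheory.IntegrableOn
      (fun v : ℝ => (psiNormalized v : ℂ) * Complex.exp (-(s - 1) * v)) (Ioi 0) := by
    refine (integrableOn_exp_mul_complex_Ioi hre 0).bdd_mul (c := Real.log 4 + 4) ?_ ?_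
    · exact (Complex.measurable_ofReal.comp measurable_psiNormalized).aestronglyMeasurable
    · refine .of_forall fun v => ?_
      rw [Complex.norm_real, Real.norm_of_nonneg (psiNormalized_nonneg v)]
      exact psiNormalized_le v
  have h6 : ∫ v in Ioi (0 : ℝ), ((psiNormalized v - 1 : ℝ) : ℂ) * Complex.exp (-(s - 1) * v) =
      (∫ v in Ioi (0 : ℝ), (psiNormalized v : ℂ) * Complex.exp (-(s - 1) * v)) -
      ∫ v in Ioi (0 : ℝ), Complex.exp (-(s - 1) * v) := by
    rw [← MeasureTheory.integral_sub hbd (integrableOn_exp_mul_complex_Ioi hre 0)]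
    refine MeasureTheory.integral_congr_ae (.of_forall fun v => ?_)
    push_cast
    ring
  rw [h6, h5, integral_exp_mul_complex_Ioi hre]
  simp only [h2]
  simp only [Nat.totient_one, Nat.cast_one, inv_one, Complex.ofReal_zero, mul_zero,
    Complex.exp_zero]
  have : -(s - 1) ≠ 0 := neg_ne_zero.2 hs10
  field_simp
  ring

/-- The Fejér-type kernel `(1 - cos x) / x ^ 2`, as a cosine transform. -/
noncomputable def fejerKernel (x : ℝ) : ℝ := ∫ s in (0 : ℝ)..1, (1 - s) * Real.cos (s * x)

lemma fejerKernel_eq {x : ℝ} (hx : x ≠ 0) : fejerKernel x = (1 - Real.cos x) / x ^ 2 := by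
  have hd : ∀ s ∈ uIcc (0 : ℝ) 1, HasDerivAt
      (fun s : ℝ => (1 - s) * Real.sin (s * x) / x - Real.cos (s * x) / x ^ 2)
      ((1 - s) * Real.cos (s * x)) s := by
    intro s _
    have h1 : HasDerivAt (fun s : ℝ => s * x) x s := by simpa using (hasDerivAt_id s).mul_const x
    have h2 := ((((hasDerivAt_id s).const_sub 1).mul h1.sin).div_const x).sub
      (h1.cos.div_const (x ^ 2))
    refine h2.congr_deriv ?_
    simp only [id]
    field_simp
    ring
  rw [fejerKernel, intervalIntegral.integral_eq_sub_of_hasDerivAt hd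
    (Continuous.intervalIntegrable (by fun_prop) _ _)]
  simp
  ring

lemma abs_fejerKernel_le_one (x : ℝ) : |fejerKernel x| ≤ 1 := by
  have := intervalIntegral.norm_integral_le_of_norm_le_const (a := 0) (b := 1) (C := 1)
    (f := fun s : ℝ => (1 - s) * Real.cos (s * x)) (fun s hs => by
      rw [uIoc_of_le zero_le_one] at hs
      rw [Real.norm_eq_abs, abs_mul, abs_of_nonneg (by linarith [hs.2])]
      have := Real.abs_cos_le_one (s * x)
      nlinarith [hs.1, hs.2, abs_nonneg (Real.cos (s * x))])
  simpa [fejerKernel] using this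

lemma fejerKernel_zero : fejerKernel 0 = 1 / 2 := by
  simp only [fejerKernel, mul_zero, Real.cos_zero, mul_one]
  rw [intervalIntegral.integral_sub (by simp) (by simp)]
  norm_num

lemma fejerKernel_nonneg (x : ℝ) : 0 ≤ fejerKernel x := by
  rcases eq_or_ne x 0 with rfl | hx
  · rw [fejerKernel_zero]; norm_num
  · rw [fejerKernel_eq hx]
    have := Real.cos_le_one x
    exact div_nonneg (by linarith) (sq_nonneg x)

lemma fejerKernel_le (x : ℝ) : fejerKernel x ≤ 3 * (1 + x ^ 2)⁻¹ := by
  rw [← div_eq_mul_inv, le_div_iff₀ (by positivity)]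
  have h1 := (abs_le.1 (abs_fejerKernel_le_one x)).2
  rcases eq_or_ne x 0 with rfl | hx
  · rw [fejerKernel_zero]; norm_num
  · have h2 : fejerKernel x * x ^ 2 = 1 - Real.cos x := by
      rw [fejerKernel_eq hx]; field_simp
    have := Real.neg_one_le_cos x
    linarith

lemma continuous_fejerKernel : Continuous fejerKernel :=
  intervalIntegral.continuous_parametric_intervalIntegral_of_continuous' (by fun_prop) _ _

lemma integrable_fejerKernel : MeasureTheory.Integrable fejerKernel := by
  refine (integrable_inv_one_add_sq.const_mul 3).mono'
    continuous_fejerKernel.aestronglyMeasurable (.of_forall fun x => ?_)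
  rw [Real.norm_of_nonneg (fejerKernel_nonneg x)]
  exact fejerKernel_le x

lemma integral_fejerKernel_pos : 0 < ∫ x, fejerKernel x :=
  MeasureTheory.integral_pos_of_integrable_nonneg_nonzero (x := 0) continuous_fejerKernel
    integrable_fejerKernel fejerKernel_nonneg (by rw [fejerKernel_zero]; norm_num)

open ArithmeticFunction in
/-- The Laplace transform of `ψ(e^v) e^{-v} - 1`, continued to the imaginary axis. -/
noncomputable def laplacePsi (δ t : ℝ) : ℂ :=
  (vonMangoldt.LFunctionResidueClassAux (1 : ZMod 1) (1 + δ + t * Complex.I) - 1) /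
    (1 + δ + t * Complex.I)

lemma continuousOn_laplacePsi :
    ContinuousOn (fun z : ℝ × ℝ => laplacePsi z.1 z.2) (Ici 0 ×ˢ univ) := by
  have h := ArithmeticFunction.vonMangoldt.continuousOn_LFunctionResidueClassAux
      (q := 1) (1 : ZMod 1)
  have hm : ContinuousOn (fun z : ℝ × ℝ => (1 + z.1 + z.2 * Complex.I : ℂ)) (Ici 0 ×ˢ univ) := by
    fun_prop
  refine ContinuousOn.div ((h.comp hm ?_).sub continuousOn_const) hm ?_
  · rintro ⟨d, t⟩ ⟨hd, _⟩
    simp only [mem_Ici] at hd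
    simp [hd]
  · rintro ⟨d, t⟩ ⟨hd, _⟩ h0
    simp only [mem_Ici] at hd
    have := congrArg Complex.re h0
    simp at this
    linarith

lemma re_integral_exp_eq_fejerKernel (x : ℝ) :
    (∫ s in Ioc (0 : ℝ) 1, ((1 - s : ℝ) : ℂ) * Complex.exp ((s * x : ℝ) * Complex.I)).re =
      fejerKernel x := by
  have hi : MeasureTheory.IntegrableOn
      (fun s : ℝ => ((1 - s : ℝ) : ℂ) * Complex.exp ((s * x : ℝ) * Complex.I)) (Ioc 0 1) :=
    (Continuous.integrableOn_Icc (by fun_prop)).mono_set Ioc_subset_Icc_self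
  have h := Complex.reCLM.integral_comp_comm hi
  simp only [Complex.reCLM_apply] at h
  rw [← h, fejerKernel, intervalIntegral.integral_of_le zero_le_one]
  refine MeasureTheory.integral_congr_ae (.of_forall fun s => ?_)
  simp only
  rw [Complex.re_ofReal_mul, Complex.exp_ofReal_mul_I_re]

lemma integral_laplacePsi_mul {R δ : ℝ} (hδ : 0 < δ) (u : ℝ) :
    (∫ s in Ioc (0 : ℝ) 1, ((1 - s : ℝ) : ℂ) * Complex.exp ((R * u * s : ℝ) * Complex.I) *
      laplacePsi δ (R * s)).re =
    ∫ v in Ioi (0 : ℝ), (psiNormalized v - 1) * Real.exp (-(δ * v)) *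
      fejerKernel (R * (u - v)) := by
  have h1 : ∀ s : ℝ, ((1 - s : ℝ) : ℂ) * Complex.exp ((R * u * s : ℝ) * Complex.I) *
      laplacePsi δ (R * s) = ∫ v in Ioi (0 : ℝ), ((1 - s : ℝ) : ℂ) *
        (((psiNormalized v - 1) * Real.exp (-(δ * v)) : ℝ) : ℂ) *
        Complex.exp ((s * (R * (u - v)) : ℝ) * Complex.I) := by
    intro s
    rw [laplacePsi]
    rw [← laplace_psiNormalized_sub_one hδ (R * s), ← MeasureTheory.integral_const_mul]
    refine MeasureTheory.integral_congr_ae (.of_forall fun v => ?_)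
    simp only
    rw [Complex.ofReal_mul (psiNormalized v - 1), Complex.ofReal_exp]
    rw [mul_assoc, mul_assoc, mul_assoc, mul_left_comm (Complex.exp _), ← Complex.exp_add,
      mul_assoc, ← Complex.exp_add]
    congr 3
    push_cast
    ring
  simp_rw [h1]
  have hinteg : MeasureTheory.Integrable (Function.uncurry fun s v : ℝ => ((1 - s : ℝ) : ℂ) *
        (((psiNormalized v - 1) * Real.exp (-(δ * v)) : ℝ) : ℂ) *
        Complex.exp ((s * (R * (u - v)) : ℝ) * Complex.I))
      ((MeasureTheory.volume.restrict (Ioc 0 1)).prod (MeasureTheory.volume.restrict (Ioi 0))) := by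
    refine MeasureTheory.Integrable.mono'
      (g := fun z : ℝ × ℝ => 1 * (7 * Real.exp (-δ * z.2))) ?_ ?_ ?_
    · exact MeasureTheory.Integrable.mul_prod (f := fun _ : ℝ => (1 : ℝ))
        (MeasureTheory.integrable_const _) ((integrableOn_exp_mul_Ioi (by linarith) 0).const_mul 7)
    · have := measurable_psiNormalized
      refine Measurable.aestronglyMeasurable ?_
      simp only [Function.uncurry_def]
      fun_prop
    · rw [MeasureTheory.Measure.prod_restrict]
      refine MeasureTheory.ae_restrict_of_forall_mem
        (measurableSet_Ioc.prod measurableSet_Ioi) ?_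
      rintro ⟨s, v⟩ ⟨hs, -⟩
      simp only [Function.uncurry_apply_pair]
      rw [norm_mul, norm_mul, Complex.norm_exp_ofReal_mul_I, mul_one, Complex.ofReal_mul, norm_mul,
        Complex.norm_real (Real.exp _), Real.norm_of_nonneg (Real.exp_pos _).le, neg_mul]
      refine mul_le_mul ?_ (mul_le_mul_of_nonneg_right (norm_psiNormalized_sub_one_le v)
        (Real.exp_pos _).le) (by positivity) zero_le_one
      rw [Complex.norm_real, Real.norm_eq_abs, abs_le]
      constructor <;> linarith [hs.1, hs.2]
  rw [MeasureTheory.integral_integral_swap hinteg]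
  have h := Complex.reCLM.integral_comp_comm hinteg.integral_prod_right
  simp only [Complex.reCLM_apply, Function.uncurry_apply_pair] at h
  rw [← h]
  refine MeasureTheory.integral_congr_ae (.of_forall fun v => ?_)
  simp only
  rw [← re_integral_exp_eq_fejerKernel, ← Complex.re_ofReal_mul,
    ← MeasureTheory.integral_const_mul]
  congr 1
  refine MeasureTheory.integral_congr_ae (.of_forall fun s => ?_)
  simp only
  ring

lemma integrable_fejerKernel_comp {R : ℝ} (hR : 0 < R) (u : ℝ) :
    MeasureTheory.Integrable fun v => fejerKernel (R * (u - v)) :=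
  (integrable_fejerKernel.comp_mul_left' hR.ne').comp_sub_left u

lemma integral_laplacePsi_zero_mul {R : ℝ} (hR : 0 < R) (u : ℝ) :
    (∫ s in Ioc (0 : ℝ) 1, ((1 - s : ℝ) : ℂ) * Complex.exp ((R * u * s : ℝ) * Complex.I) *
      laplacePsi 0 (R * s)).re =
    ∫ v in Ioi (0 : ℝ), (psiNormalized v - 1) * fejerKernel (R * (u - v)) := by
  have hmem : Ioi (0 : ℝ) ∈ 𝓝[>] (0 : ℝ) := self_mem_nhdsWithin
  obtain ⟨M, hM⟩ : ∃ M, ∀ z ∈ Icc (0 : ℝ) 1 ×ˢ Icc (0 : ℝ) R, ‖laplacePsi z.1 z.2‖ ≤ M :=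
    (isCompact_Icc.prod isCompact_Icc).exists_bound_of_continuousOn
      (continuousOn_laplacePsi.mono (prod_mono Icc_subset_Ici_self (subset_univ _)))
  have hl : Tendsto (fun δ : ℝ => ∫ s in Ioc (0 : ℝ) 1, ((1 - s : ℝ) : ℂ) *
      Complex.exp ((R * u * s : ℝ) * Complex.I) * laplacePsi δ (R * s)) (𝓝[>] 0)
      (𝓝 (∫ s in Ioc (0 : ℝ) 1, ((1 - s : ℝ) : ℂ) *
      Complex.exp ((R * u * s : ℝ) * Complex.I) * laplacePsi 0 (R * s))) := by
    refine MeasureTheory.tendsto_integral_filter_of_dominated_convergence (fun _ => M) ?_ ?_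
      (MeasureTheory.integrable_const _) ?_
    · filter_upwards [hmem] with δ hδ
      refine Continuous.aestronglyMeasurable ?_
      have : Continuous fun s : ℝ => laplacePsi δ (R * s) :=
        continuousOn_laplacePsi.comp_continuous (f := fun s : ℝ => (δ, R * s)) (by fun_prop)
          fun s => ⟨(mem_Ioi.1 hδ).le, mem_univ _⟩
      fun_prop
    · filter_upwards [hmem, mem_nhdsWithin_of_mem_nhds (Iic_mem_nhds (zero_lt_one' ℝ))]
        with δ hδ hδ1
      refine MeasureTheory.ae_restrict_of_forall_mem measurableSet_Ioc fun s hs => ?_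
      have h1 := hM (δ, R * s) ⟨⟨(mem_Ioi.1 hδ).le, hδ1⟩, by
        constructor <;> simp only <;> nlinarith [hs.1, hs.2]⟩
      rw [norm_mul, norm_mul, Complex.norm_exp_ofReal_mul_I, mul_one]
      refine (mul_le_of_le_one_left (norm_nonneg _) ?_).trans h1
      rw [Complex.norm_real, Real.norm_eq_abs, abs_le]
      constructor <;> linarith [hs.1, hs.2]
    · refine .of_forall fun s => ?_
      refine Tendsto.const_mul _ ?_
      have h1 := continuousOn_laplacePsi (0, R * s) ⟨mem_Ici.2 le_rfl, mem_univ _⟩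
      refine (h1.tendsto).comp (f := fun δ : ℝ => (δ, R * s)) ?_
      refine tendsto_nhdsWithin_iff.2 ⟨?_, ?_⟩
      · exact ((Continuous.tendsto (f := fun δ : ℝ => (δ, R * s)) (by fun_prop) 0)).mono_left
          nhdsWithin_le_nhds
      · filter_upwards [hmem] with δ hδ
        exact ⟨(mem_Ioi.1 hδ).le, mem_univ _⟩
  have hr : Tendsto (fun δ : ℝ => ∫ v in Ioi (0 : ℝ),
      (psiNormalized v - 1) * Real.exp (-(δ * v)) * fejerKernel (R * (u - v))) (𝓝[>] 0)
      (𝓝 (∫ v in Ioi (0 : ℝ), (psiNormalized v - 1) * fejerKernel (R * (u - v)))) := by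
    refine MeasureTheory.tendsto_integral_filter_of_dominated_convergence
      (fun v => 7 * fejerKernel (R * (u - v))) ?_ ?_
      ((integrable_fejerKernel_comp hR u).integrableOn.const_mul 7) ?_
    · refine .of_forall fun δ => Measurable.aestronglyMeasurable ?_
      have := measurable_psiNormalized
      have := continuous_fejerKernel.measurable
      fun_prop
    · filter_upwards [hmem] with δ hδ
      refine MeasureTheory.ae_restrict_of_forall_mem measurableSet_Ioi fun v hv => ?_
      rw [norm_mul, norm_mul, Real.norm_of_nonneg (fejerKernel_nonneg _),
        Real.norm_of_nonneg (Real.exp_pos _).le]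
      refine mul_le_mul_of_nonneg_right ?_ (fejerKernel_nonneg _)
      have h1 := norm_psiNormalized_sub_one_le v
      rw [Complex.norm_real] at h1
      refine (mul_le_of_le_one_right (norm_nonneg _) (Real.exp_le_one_iff.2 ?_)).trans h1
      have := mul_pos (mem_Ioi.1 hδ) (mem_Ioi.1 hv)
      linarith
    · refine .of_forall fun v => ?_
      have : Continuous fun δ : ℝ =>
          (psiNormalized v - 1) * Real.exp (-(δ * v)) * fejerKernel (R * (u - v)) := by fun_prop
      simpa using (this.tendsto 0).mono_left nhdsWithin_le_nhds
  have hl' := (Complex.continuous_re.tendsto _).comp hl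
  refine tendsto_nhds_unique hl' (hr.congr' ?_)
  filter_upwards [hmem] with δ hδ
  exact (integral_laplacePsi_mul hδ u).symm

lemma tendsto_integral_psiNormalized_sub_one {R : ℝ} (hR : 0 < R) :
    Tendsto (fun u => ∫ v in Ioi (0 : ℝ), (psiNormalized v - 1) * fejerKernel (R * (u - v)))
      atTop (𝓝 0) := by
  have h := Real.tendsto_integral_exp_smul_cocompact
    ((Ioc (0 : ℝ) 1).indicator fun s : ℝ => ((1 - s : ℝ) : ℂ) * laplacePsi 0 (R * s))
  have hw : Tendsto (fun u : ℝ => -(R / (2 * Real.pi)) * u) atTop (cocompact ℝ) := by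
    refine Tendsto.mono_right ?_ atBot_le_cocompact
    exact tendsto_id.const_mul_atTop_of_neg (by have := Real.pi_pos; simp; positivity)
  have h1 := (Complex.continuous_re.tendsto _).comp (h.comp hw)
  simp only [Complex.zero_re] at h1
  refine h1.congr fun u => ?_
  rw [← integral_laplacePsi_zero_mul hR]
  simp only [Function.comp_apply]
  congr 1
  rw [← MeasureTheory.integral_indicator measurableSet_Ioc]
  refine MeasureTheory.integral_congr_ae (.of_forall fun s => ?_)
  simp only
  by_cases hs : s ∈ Ioc (0 : ℝ) 1
  · rw [indicator_of_mem hs, indicator_of_mem hs, Circle.smul_def, Real.fourierChar_apply,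
      smul_eq_mul, mul_left_comm, ← mul_assoc]
    congr 4
    push_cast
    have := Real.pi_pos.ne'
    field_simp
  · rw [indicator_of_notMem hs, indicator_of_notMem hs, smul_zero]

lemma tendsto_psiNormalized : Tendsto psiNormalized atTop (𝓝 1) := by
  set I := ∫ x, fejerKernel x with hI
  have hIpos : 0 < I := integral_fejerKernel_pos
  set J : ℝ → ℝ := fun M => ∫ x in (-M)..M, fejerKernel x with hJ
  have hJI : Tendsto J atTop (𝓝 I) :=
    MeasureTheory.intervalIntegral_tendsto_integral integrable_fejerKernel
      tendsto_neg_atTop_atBot tendsto_id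
  have htotal : ∀ {R : ℝ}, 0 < R → ∀ u, ∫ v, fejerKernel (R * (u - v)) = I / R := by
    intro R hR u
    rw [MeasureTheory.integral_sub_left_eq_self (fun v => fejerKernel (R * v)),
      MeasureTheory.Measure.integral_comp_mul_left, abs_of_pos (inv_pos.2 hR), smul_eq_mul, hI]
    ring
  have hmid : ∀ {R η : ℝ}, 0 < R → 0 < η → ∀ u,
      ∫ v in Ioc (u - η) (u + η), fejerKernel (R * (u - v)) = J (R * η) / R := by
    intro R η hR hη u
    rw [← intervalIntegral.integral_of_le (by linarith),
      intervalIntegral.integral_comp_sub_left (fun v => fejerKernel (R * v)),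
      intervalIntegral.integral_comp_mul_left _ hR.ne', smul_eq_mul, hJ]
    simp only
    rw [inv_mul_eq_div]
    congr 2 <;> ring
  have hBint : ∀ {R : ℝ}, 0 < R → ∀ u,
      MeasureTheory.Integrable fun v => psiNormalized v * fejerKernel (R * (u - v)) := by
    intro R hR u
    refine (integrable_fejerKernel_comp hR u).bdd_mul (c := Real.log 4 + 4)
      measurable_psiNormalized.aestronglyMeasurable (.of_forall fun v => ?_)
    rw [Real.norm_of_nonneg (psiNormalized_nonneg v)]
    exact psiNormalized_le v
  set F : ℝ → ℝ → ℝ := fun R u =>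
    ∫ v in Ioi (0 : ℝ), (psiNormalized v - 1) * fejerKernel (R * (u - v)) with hF
  have hsplit : ∀ {R : ℝ}, 0 < R → ∀ u,
      ∫ v in Ioi (0 : ℝ), psiNormalized v * fejerKernel (R * (u - v)) =
        F R u + ∫ v in Ioi (0 : ℝ), fejerKernel (R * (u - v)) := by
    intro R hR u
    rw [hF]
    simp only [sub_mul, one_mul]
    rw [MeasureTheory.integral_sub (hBint hR u).integrableOn
      (integrable_fejerKernel_comp hR u).integrableOn]
    ring
  have hupper : ∀ {R η : ℝ}, 0 < R → 0 < η → ∀ u, η < u →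
      psiNormalized (u - η) * Real.exp (-(2 * η)) * J (R * η) ≤ R * F R u + I := by
    intro R η hR hη u hu
    have h1 : ∫ v in Ioc (u - η) (u + η), psiNormalized (u - η) * Real.exp (-(2 * η)) *
        fejerKernel (R * (u - v)) ≤
        ∫ v in Ioc (u - η) (u + η), psiNormalized v * fejerKernel (R * (u - v)) := by
      refine MeasureTheory.setIntegral_mono_on
        ((integrable_fejerKernel_comp hR u).integrableOn.const_mul _)
        (hBint hR u).integrableOn measurableSet_Ioc fun v hv => ?_
      refine mul_le_mul_of_nonneg_right ?_ (fejerKernel_nonneg _)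
      refine le_trans (mul_le_mul_of_nonneg_left (Real.exp_le_exp.2 ?_) (psiNormalized_nonneg _))
        (psiNormalized_mul_exp_le hv.1.le)
      linarith [hv.2]
    rw [MeasureTheory.integral_const_mul, hmid hR hη] at h1
    have h2 : ∫ v in Ioc (u - η) (u + η), psiNormalized v * fejerKernel (R * (u - v)) ≤
        ∫ v in Ioi (0 : ℝ), psiNormalized v * fejerKernel (R * (u - v)) := by
      refine MeasureTheory.setIntegral_mono_set (hBint hR u).integrableOn (.of_forall fun v =>
        mul_nonneg (psiNormalized_nonneg v) (fejerKernel_nonneg _)) ?_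
      exact (Ioc_subset_Ioi_self.trans (Ioi_subset_Ioi (by linarith))).eventuallyLE
    have h3 : ∫ v in Ioi (0 : ℝ), fejerKernel (R * (u - v)) ≤ I / R := by
      rw [← htotal hR u]
      exact MeasureTheory.setIntegral_le_integral (integrable_fejerKernel_comp hR u)
        (.of_forall fun v => fejerKernel_nonneg _)
    rw [hsplit hR] at h2
    have h4 := h1.trans (h2.trans (add_le_add_right h3 _))
    rw [← mul_div_assoc, div_le_iff₀ hR] at h4
    refine h4.trans (le_of_eq ?_)
    field_simp
  have hlower : ∀ {R η : ℝ}, 0 < R → 0 < η → ∀ u, η < u →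
      R * F R u + J (R * η) ≤
        psiNormalized (u + η) * Real.exp (2 * η) * J (R * η) + 6 * (I - J (R * η)) := by
    intro R η hR hη u hu
    have hsub : Ioc (u - η) (u + η) ⊆ Ioi 0 :=
      Ioc_subset_Ioi_self.trans (Ioi_subset_Ioi (by linarith))
    have h0 := hsplit hR u
    have h1 : J (R * η) / R ≤ ∫ v in Ioi (0 : ℝ), fejerKernel (R * (u - v)) := by
      rw [← hmid hR hη u]
      exact MeasureTheory.setIntegral_mono_set (integrable_fejerKernel_comp hR u).integrableOn
        (.of_forall fun v => fejerKernel_nonneg _) hsub.eventuallyLE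
    have hpt : ∀ v, psiNormalized v * fejerKernel (R * (u - v)) ≤
        (Ioc (u - η) (u + η)).indicator (fun v => psiNormalized (u + η) * Real.exp (2 * η) *
          fejerKernel (R * (u - v))) v +
        6 * (fejerKernel (R * (u - v)) -
          (Ioc (u - η) (u + η)).indicator (fun v => fejerKernel (R * (u - v))) v) := by
      intro v
      by_cases hv : v ∈ Ioc (u - η) (u + η)
      · rw [indicator_of_mem hv, indicator_of_mem hv, sub_self, mul_zero, add_zero]
        refine mul_le_mul_of_nonneg_right ?_ (fejerKernel_nonneg _)
        have := psiNormalized_mul_exp_le hv.2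
        rw [← le_div_iff₀ (Real.exp_pos _), div_eq_mul_inv, ← Real.exp_neg] at this
        refine this.trans (mul_le_mul_of_nonneg_left (Real.exp_le_exp.2 ?_)
          (psiNormalized_nonneg _))
        linarith [hv.1]
      · rw [indicator_of_notMem hv, indicator_of_notMem hv, zero_add, sub_zero]
        refine mul_le_mul_of_nonneg_right ?_ (fejerKernel_nonneg _)
        have h1 := psiNormalized_le v
        have h3 : Real.log 4 ≤ 2 := by
          have : Real.log 4 = 2 * Real.log 2 := by
            rw [show (4 : ℝ) = 2 ^ 2 by norm_num, Real.log_pow]; norm_num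
          have := Real.log_two_lt_d9
          linarith
        linarith
    have hk := integrable_fejerKernel_comp hR u
    have h2 : ∫ v in Ioi (0 : ℝ), psiNormalized v * fejerKernel (R * (u - v)) ≤
        ∫ v, psiNormalized v * fejerKernel (R * (u - v)) :=
      MeasureTheory.setIntegral_le_integral (hBint hR u) (.of_forall fun v =>
        mul_nonneg (psiNormalized_nonneg v) (fejerKernel_nonneg _))
    have h3 := MeasureTheory.integral_mono (hBint hR u)
      (((hk.const_mul (psiNormalized (u + η) * Real.exp (2 * η))).indicator
        (measurableSet_Ioc (a := u - η) (b := u + η))).add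
        ((hk.sub (hk.indicator (measurableSet_Ioc (a := u - η) (b := u + η)))).const_mul 6)) hpt
    have h4 : ∫ v, ((Ioc (u - η) (u + η)).indicator (fun v => psiNormalized (u + η) *
          Real.exp (2 * η) * fejerKernel (R * (u - v))) v +
        6 * (fejerKernel (R * (u - v)) -
          (Ioc (u - η) (u + η)).indicator (fun v => fejerKernel (R * (u - v))) v)) =
        psiNormalized (u + η) * Real.exp (2 * η) * (J (R * η) / R) +
          6 * (I / R - J (R * η) / R) := by
      rw [MeasureTheory.integral_add, MeasureTheory.integral_const_mul 6,
        MeasureTheory.integral_sub, MeasureTheory.integral_indicator measurableSet_Ioc,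
        MeasureTheory.integral_indicator measurableSet_Ioc, MeasureTheory.integral_const_mul,
        hmid hR hη, htotal hR]
      · exact hk
      · exact hk.indicator measurableSet_Ioc
      · exact (hk.const_mul _).indicator measurableSet_Ioc
      · exact (hk.sub (hk.indicator measurableSet_Ioc)).const_mul 6
    have h5 : F R u + J (R * η) / R ≤ psiNormalized (u + η) * Real.exp (2 * η) *
        (J (R * η) / R) + 6 * (I / R - J (R * η) / R) := by
      have h3' := h3.trans_eq h4
      linarith
    have h6 := mul_le_mul_of_nonneg_left h5 hR.le
    have e1 : R * (F R u + J (R * η) / R) = R * F R u + J (R * η) := by field_simp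
    have e2 : R * (psiNormalized (u + η) * Real.exp (2 * η) *
        (J (R * η) / R) + 6 * (I / R - J (R * η) / R)) =
        psiNormalized (u + η) * Real.exp (2 * η) * J (R * η) + 6 * (I - J (R * η)) := by
      field_simp
    rwa [e1, e2] at h6
  refine tendsto_order.2 ⟨fun α hα => ?_, fun α hα => ?_⟩
  · obtain ⟨η, hη1, hη⟩ : ∃ η, α * Real.exp (2 * η) < 1 ∧ 0 < η := by
      have : Continuous fun η : ℝ => α * Real.exp (2 * η) := by fun_prop
      have h := ((this.tendsto 0).mono_left (nhdsWithin_le_nhds (s := Ioi 0))).eventually_lt_const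
        (show α * Real.exp (2 * 0) < 1 by simpa)
      exact (h.and self_mem_nhdsWithin).exists
    obtain ⟨M, ⟨hM1, hJM⟩, hM⟩ :
        ∃ M, (α * Real.exp (2 * η) * J M < J M - 6 * (I - J M) ∧ 0 < J M) ∧ 0 < M := by
      have h1 : Tendsto (fun M => α * Real.exp (2 * η) * J M) atTop
        (𝓝 (α * Real.exp (2 * η) * I)) := hJI.const_mul _
      have h2 : Tendsto (fun M => J M - 6 * (I - J M)) atTop (𝓝 (I - 6 * (I - I))) :=
        hJI.sub ((hJI.const_sub I).const_mul 6)
      exact (((h1.eventually_lt h2 (by nlinarith)).and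
        (hJI.eventually (lt_mem_nhds hIpos))).and (eventually_gt_atTop 0)).exists
    have hR : 0 < M / η := div_pos hM hη
    have hRη : M / η * η = M := by field_simp
    have hFt : Tendsto (fun v => M / η * F (M / η) (v - η)) atTop (𝓝 (M / η * 0)) :=
      ((tendsto_integral_psiNormalized_sub_one hR).comp
        (tendsto_atTop_add_const_right _ (-η) tendsto_id)).const_mul _
    rw [mul_zero] at hFt
    filter_upwards [hFt.eventually (lt_mem_nhds (show α * Real.exp (2 * η) * J M -
      (J M - 6 * (I - J M)) < 0 by linarith)), eventually_gt_atTop (2 * η)] with v hv hv2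
    have h := hlower hR hη (v - η) (by linarith)
    rw [hRη, sub_add_cancel] at h
    have h2 : α * (Real.exp (2 * η) * J M) < psiNormalized v * (Real.exp (2 * η) * J M) := by
      nlinarith
    exact lt_of_mul_lt_mul_right h2 (by positivity)
  · obtain ⟨η, hη1, hη⟩ : ∃ η, 1 < α * Real.exp (-(2 * η)) ∧ 0 < η := by
      have : Continuous fun η : ℝ => α * Real.exp (-(2 * η)) := by fun_prop
      have h := ((this.tendsto 0).mono_left (nhdsWithin_le_nhds (s := Ioi 0))).eventually_const_lt
        (show 1 < α * Real.exp (-(2 * 0)) by simpa)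
      exact (h.and self_mem_nhdsWithin).exists
    obtain ⟨M, ⟨hM1, hJM⟩, hM⟩ :
        ∃ M, (I < α * Real.exp (-(2 * η)) * J M ∧ 0 < J M) ∧ 0 < M := by
      have h1 : Tendsto (fun M => α * Real.exp (-(2 * η)) * J M) atTop
        (𝓝 (α * Real.exp (-(2 * η)) * I)) := hJI.const_mul _
      exact (((h1.eventually_const_lt (by nlinarith)).and
        (hJI.eventually (lt_mem_nhds hIpos))).and (eventually_gt_atTop 0)).exists
    have hR : 0 < M / η := div_pos hM hη
    have hRη : M / η * η = M := by field_simp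
    have hFt : Tendsto (fun v => M / η * F (M / η) (v + η)) atTop (𝓝 (M / η * 0)) :=
      ((tendsto_integral_psiNormalized_sub_one hR).comp
        (tendsto_atTop_add_const_right _ η tendsto_id)).const_mul _
    rw [mul_zero] at hFt
    filter_upwards [hFt.eventually (gt_mem_nhds (show 0 < α * Real.exp (-(2 * η)) * J M - I by
      linarith)), eventually_gt_atTop 0] with v hv hv2
    have h := hupper hR hη (v + η) (by linarith)
    rw [hRη, add_sub_cancel_right] at h
    have h2 : psiNormalized v * (Real.exp (-(2 * η)) * J M) < α * (Real.exp (-(2 * η)) * J M) := by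
      nlinarith
    exact lt_of_mul_lt_mul_right h2 (by positivity)

lemma tendsto_theta_div : Tendsto (fun x => Chebyshev.theta x / x) atTop (𝓝 1) := by
  have h1 : Tendsto (fun x => Chebyshev.psi x / x) atTop (𝓝 1) := by
    refine (tendsto_psiNormalized.comp Real.tendsto_log_atTop).congr' ?_
    filter_upwards [eventually_gt_atTop 0] with x hx
    simp [psiNormalized, Real.exp_neg, Real.exp_log hx, div_eq_mul_inv]
  have h2 : Tendsto (fun x => (Chebyshev.psi x - Chebyshev.theta x) / x) atTop (𝓝 0) := by
    have h3 : Tendsto (fun x : ℝ => √x / x) atTop (𝓝 0) := by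
      refine (tendsto_inv_atTop_zero.comp Real.tendsto_sqrt_atTop).congr' ?_
      filter_upwards [eventually_gt_atTop 0] with x hx
      simp only [Function.comp_apply]
      rw [Real.sqrt_div_self', one_div]
    exact (Chebyshev.isBigO_psi_sub_theta_sqrt.mul
      (Asymptotics.isBigO_refl (fun x : ℝ => x⁻¹) atTop)).trans_tendsto
      (by simpa [div_eq_mul_inv] using h3)
  have := h1.sub h2
  simp only [sub_zero] at this
  refine this.congr fun x => ?_
  ring

/-- The sum of `log p / p` over primes `p ≤ x`. -/
noncomputable def sumLogDivPrimes (x : ℝ) : ℝ :=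
  ∑ p ∈ (Finset.Icc 0 ⌊x⌋₊).filter Nat.Prime, Real.log p / p

/-- The sum of `1 / p` over primes `p ≤ x`. -/
noncomputable def sumInvPrimes (x : ℝ) : ℝ :=
  ∑ p ∈ (Finset.Icc 0 ⌊x⌋₊).filter Nat.Prime, (p : ℝ)⁻¹

lemma sumLogDivPrimes_mono : Monotone sumLogDivPrimes := fun _ _ h =>
  Finset.sum_le_sum_of_subset_of_nonneg
    (Finset.filter_subset_filter _ (Finset.Icc_subset_Icc_right (Nat.floor_mono h)))
    fun p _ _ => div_nonneg (Real.log_natCast_nonneg p) (Nat.cast_nonneg p)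

lemma log_factorial_eq_sum (N : ℕ) : Real.log (N.factorial : ℝ) =
    ∑ p ∈ (Finset.Icc 0 N).filter Nat.Prime, (N.factorial.factorization p : ℝ) * Real.log p := by
  rw [Real.log_nat_eq_sum_factorization, Finsupp.sum]
  refine Finset.sum_subset ?_ ?_
  · intro p hp
    rw [Nat.support_factorization] at hp
    have h1 := Nat.prime_of_mem_primeFactors hp
    have h2 := (h1.dvd_factorial).1 (Nat.dvd_of_mem_primeFactors hp)
    simp [h1, h2]
  · intro p _ hp
    rw [Finsupp.notMem_support_iff.1 hp]
    simp

lemma log_le_two_mul_sqrt {x : ℝ} (hx : 0 < x) : Real.log x ≤ 2 * √x := by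
  have h := Real.log_le_sub_one_of_pos (Real.sqrt_pos.2 hx)
  rw [Real.log_sqrt hx.le] at h
  linarith

lemma summable_inv_mul_sqrt : Summable fun n : ℕ => ((n : ℝ) * √n)⁻¹ := by
  refine (Real.summable_nat_rpow_inv.2 (show (1 : ℝ) < 3 / 2 by norm_num)).congr fun n => ?_
  rcases Nat.eq_zero_or_pos n with rfl | hn
  · simp
  · have : (0 : ℝ) < n := by exact_mod_cast hn
    rw [Real.sqrt_eq_rpow, show (3 / 2 : ℝ) = 1 + 1 / 2 by norm_num, Real.rpow_add this,
      Real.rpow_one]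

lemma log_div_pred_le {p : ℕ} (hp : 2 ≤ p) :
    Real.log p / ((p : ℝ) - 1) ≤ Real.log p / p + 4 * ((p : ℝ) * √p)⁻¹ := by
  have h2 : (2 : ℝ) ≤ p := by exact_mod_cast hp
  have hp0 : (0 : ℝ) < p := by linarith
  have hs : 0 < √(p : ℝ) := Real.sqrt_pos.2 hp0
  have hss : √(p : ℝ) * √p = p := Real.mul_self_sqrt hp0.le
  have hl := log_le_two_mul_sqrt hp0
  have e : Real.log p / ((p : ℝ) - 1) - Real.log p / p = Real.log p / ((p - 1) * p) := by
    have : (p : ℝ) - 1 ≠ 0 := by linarith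
    field_simp
    ring
  have h3 : Real.log p / (((p : ℝ) - 1) * p) ≤ 4 * ((p : ℝ) * √p)⁻¹ := by
    rw [← div_eq_mul_inv, div_le_div_iff₀ (by nlinarith) (by positivity)]
    calc Real.log p * (p * √(p : ℝ)) ≤ 2 * √(p : ℝ) * (p * √(p : ℝ)) := by gcongr
      _ = 2 * p * p := by linear_combination 2 * (p : ℝ) * hss
      _ ≤ 4 * ((p - 1) * p) := by nlinarith
  linarith

lemma abs_sumLogDivPrimes_sub_log_le :
    ∃ K : ℝ, 0 ≤ K ∧ ∀ x, 1 ≤ x → |sumLogDivPrimes x - Real.log x| ≤ K := by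
  set T := ∑' n : ℕ, 4 * ((n : ℝ) * √n)⁻¹ with hT
  have hTs : Summable fun n : ℕ => 4 * ((n : ℝ) * √n)⁻¹ := summable_inv_mul_sqrt.mul_left 4
  have hT0 : 0 ≤ T := tsum_nonneg fun n => by positivity
  refine ⟨T + 4, by linarith, fun x hx => ?_⟩
  set N := ⌊x⌋₊ with hN
  have hN1 : 1 ≤ N := Nat.one_le_floor_iff _ |>.2 hx
  have hN0 : (0 : ℝ) < N := by exact_mod_cast hN1
  have hNx : (N : ℝ) ≤ x := Nat.floor_le (by linarith)
  have hxN : x ≤ 2 * N := by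
    have h1 := Nat.lt_floor_add_one x
    have : (1 : ℝ) ≤ N := by exact_mod_cast hN1
    linarith
  have hl2 := Real.log_two_lt_d9
  have hlog1 : Real.log N ≤ Real.log x := Real.log_le_log hN0 hNx
  have hlog2 : Real.log x ≤ Real.log N + 1 := by
    have := Real.log_le_log (by linarith) hxN
    rw [Real.log_mul (by norm_num) hN0.ne'] at this
    linarith
  have hfac := log_factorial_eq_sum N
  have hupper : N * sumLogDivPrimes x ≤ N * Real.log N + 2 * N := by
    have h1 : Real.log (N.factorial : ℝ) ≤ N * Real.log N := by
      rw [← Real.log_pow]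
      refine Real.log_le_log (by positivity) ?_
      exact_mod_cast Nat.factorial_le_pow N
    have h2 : Chebyshev.theta N ≤ 2 * N := by
      have := Chebyshev.theta_le_log4_mul_x hN0.le
      have h4 : Real.log 4 = 2 * Real.log 2 := by
        rw [show (4 : ℝ) = 2 ^ 2 by norm_num, Real.log_pow]; norm_num
      nlinarith
    have h3 : N * sumLogDivPrimes x ≤ Real.log (N.factorial : ℝ) + Chebyshev.theta N := by
      rw [hfac, Chebyshev.theta_eq_sum_Icc, Nat.floor_natCast, sumLogDivPrimes,
        Finset.mul_sum, ← Finset.sum_add_distrib]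
      refine Finset.sum_le_sum fun p hp => ?_
      simp only [Finset.mem_filter, Finset.mem_Icc, zero_le, true_and] at hp
      have hp0 : (0 : ℝ) < p := by exact_mod_cast hp.2.pos
      have hv : N / p ≤ N.factorial.factorization p := by
        rw [Nat.factorization_factorial hp.2 (Nat.lt_succ_self _)]
        have : 1 ∈ Finset.Ico 1 (Nat.log p N).succ := by
          exact Finset.mem_Ico.2 ⟨le_rfl, Nat.succ_lt_succ (Nat.log_pos hp.2.one_lt hp.1)⟩
        simpa using Finset.single_le_sum (f := fun i => N / p ^ i) (fun _ _ => Nat.zero_le _) this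
      have hv2 : (N : ℝ) / p ≤ N.factorial.factorization p + 1 := by
        have h5 : (N : ℝ) / p < (N / p : ℕ) + 1 := by
          rw [← Nat.floor_div_eq_div (K := ℝ)]; exact Nat.lt_floor_add_one _
        have : ((N / p : ℕ) : ℝ) ≤ N.factorial.factorization p := by exact_mod_cast hv
        linarith
      have := mul_le_mul_of_nonneg_right hv2 (Real.log_natCast_nonneg p)
      calc (N : ℝ) * (Real.log p / p) = N / p * Real.log p := by ring
        _ ≤ _ := this
        _ = _ := by ring
    linarith
  have hlower : N * Real.log N - N ≤ N * (sumLogDivPrimes x + T) := by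
    have h1 : N * Real.log N - N ≤ Real.log (N.factorial : ℝ) := by
      have := Stirling.le_log_factorial_stirling (n := N) (by omega)
      have h2 : 0 ≤ Real.log N := Real.log_natCast_nonneg N
      have h3 : 0 ≤ Real.log (2 * Real.pi) := Real.log_nonneg (by linarith [Real.pi_gt_three])
      linarith
    refine h1.trans ?_
    have h2 : sumLogDivPrimes x + T ≥ ∑ p ∈ (Finset.Icc 0 N).filter Nat.Prime,
        Real.log p / ((p : ℝ) - 1) := by
      have h3 := hTs.sum_le_tsum ((Finset.Icc 0 N).filter Nat.Prime) fun n _ => by positivity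
      have h4 : ∑ p ∈ (Finset.Icc 0 N).filter Nat.Prime, Real.log p / ((p : ℝ) - 1) ≤
          ∑ p ∈ (Finset.Icc 0 N).filter Nat.Prime,
            (Real.log p / p + 4 * ((p : ℝ) * √p)⁻¹) :=
        Finset.sum_le_sum fun p hp => log_div_pred_le (Finset.mem_filter.1 hp).2.two_le
      rw [Finset.sum_add_distrib] at h4
      rw [sumLogDivPrimes]
      linarith
    refine le_trans ?_ (mul_le_mul_of_nonneg_left h2 hN0.le)
    rw [hfac, Finset.mul_sum]
    refine Finset.sum_le_sum fun p hp => ?_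
    have hpp := (Finset.mem_filter.1 hp).2
    have hp2 : (2 : ℝ) ≤ p := by exact_mod_cast hpp.two_le
    have h5 := Nat.sub_one_mul_factorization_factorial (n := N) hpp
    have h6 : (p - 1) * N.factorial.factorization p ≤ N := by omega
    have h7 : ((p : ℝ) - 1) * N.factorial.factorization p ≤ N := by
      have := (Nat.cast_le (α := ℝ)).2 h6
      rwa [Nat.cast_mul, Nat.cast_sub hpp.one_le, Nat.cast_one] at this
    rw [← mul_div_assoc, le_div_iff₀ (by linarith)]
    nlinarith [Real.log_natCast_nonneg p]
  have hu : sumLogDivPrimes x ≤ Real.log N + 2 := by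
    refine le_of_mul_le_mul_left ?_ hN0
    linarith
  have hlo : Real.log N - 1 ≤ sumLogDivPrimes x + T := by
    refine le_of_mul_le_mul_left ?_ hN0
    linarith
  rw [abs_le]
  constructor <;> linarith

lemma sumInvPrimes_eq {x : ℝ} (hx : 2 ≤ x) : sumInvPrimes x =
    sumLogDivPrimes x / Real.log x +
      ∫ t in (2 : ℝ)..x, sumLogDivPrimes t * (t * Real.log t ^ 2)⁻¹ := by
  set a : ℕ → ℝ := fun n => if n.Prime then Real.log n / n else 0 with ha
  have hA : ∀ t : ℝ, ∑ n ∈ Finset.Icc 0 ⌊t⌋₊, a n = sumLogDivPrimes t := fun t => by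
    rw [sumLogDivPrimes, Finset.sum_filter]
  have h1 : sumInvPrimes x = ∑ n ∈ Finset.Icc 0 ⌊x⌋₊, (Real.log n)⁻¹ * a n := by
    rw [sumInvPrimes, Finset.sum_filter]
    refine Finset.sum_congr rfl fun n _ => ?_
    simp only [ha]
    split_ifs with h
    · have : Real.log n ≠ 0 :=
        Real.log_ne_zero_of_pos_of_ne_one (mod_cast h.pos) (mod_cast h.ne_one)
      field_simp
    · simp
  rw [h1, sum_mul_eq_sub_integral_mul₁ a (f := fun n => (Real.log n)⁻¹)
    (by simp [ha, Nat.not_prime_zero]) (by simp [ha, Nat.not_prime_one]),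
    ← intervalIntegral.integral_of_le hx]
  · simp_rw [hA]
    rw [sub_eq_add_neg, ← intervalIntegral.integral_neg]
    congr 1
    · ring
    · refine intervalIntegral.integral_congr fun u _ => ?_
      simp [field]
  · intro z ⟨_, _⟩
    have : z ≠ 0 := by linarith
    have : Real.log z ≠ 0 := by apply Real.log_ne_zero_of_pos_of_ne_one <;> linarith
    fun_prop
  · refine ContinuousOn.integrableOn_Icc fun z ⟨_, _⟩ => ContinuousWithinAt.congr ?_
      (fun _ _ => Real.deriv_inv_log_apply) Real.deriv_inv_log_apply
    have : z ≠ 0 := by linarith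
    have : Real.log z ^ 2 ≠ 0 := by
      refine pow_ne_zero 2 <| Real.log_ne_zero_of_pos_of_ne_one ?_ ?_ <;> linarith
    exact ContinuousAt.continuousWithinAt <| by fun_prop

lemma integral_log_add_mul {x : ℝ} (hx : 2 ≤ x) (K : ℝ) :
    IntervalIntegrable (fun t : ℝ => (Real.log t + K) * (t * Real.log t ^ 2)⁻¹)
      MeasureTheory.volume 2 x ∧
    ∫ t in (2 : ℝ)..x, (Real.log t + K) * (t * Real.log t ^ 2)⁻¹ =
      Real.log (Real.log x) - K / Real.log x - (Real.log (Real.log 2) - K / Real.log 2) := by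
  have hpos : ∀ t ∈ uIcc 2 x, 0 < t ∧ 0 < Real.log t := by
    intro t ht
    rw [uIcc_of_le hx] at ht
    exact ⟨by linarith [ht.1], Real.log_pos (by linarith [ht.1])⟩
  have hi : IntervalIntegrable (fun t : ℝ => (Real.log t + K) * (t * Real.log t ^ 2)⁻¹)
      MeasureTheory.volume 2 x := by
    refine ContinuousOn.intervalIntegrable fun t ht => ContinuousAt.continuousWithinAt ?_
    obtain ⟨h1, h2⟩ := hpos t ht
    have : t ≠ 0 := h1.ne'
    have : t * Real.log t ^ 2 ≠ 0 := by positivity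
    fun_prop (disch := assumption)
  refine ⟨hi, ?_⟩
  rw [intervalIntegral.integral_eq_sub_of_hasDerivAt
    (f := fun t => Real.log (Real.log t) - K / Real.log t) (fun t ht => ?_) hi]
  obtain ⟨h1, h2⟩ := hpos t ht
  have h3 := Real.hasDerivAt_log h1.ne'
  refine ((h3.log h2.ne').sub ((h3.inv h2.ne').const_mul K)).congr_deriv ?_
  field_simp
  ring

lemma abs_sumInvPrimes_sub_log_log_le :
    ∃ K : ℝ, 0 ≤ K ∧ ∀ x, 3 ≤ x → |sumInvPrimes x - Real.log (Real.log x)| ≤ K := by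
  obtain ⟨K, hK0, hK⟩ := abs_sumLogDivPrimes_sub_log_le
  have hl2 := Real.log_two_gt_d9
  have hl2' := Real.log_two_lt_d9
  refine ⟨1 + 3 * K + |Real.log (Real.log 2)|, by positivity, fun x hx3 => ?_⟩
  have hx : 2 ≤ x := by linarith
  have hL : 1 / 2 < Real.log x := by
    have := Real.log_le_log (by norm_num) hx
    linarith
  have hinteg : IntervalIntegrable (fun t : ℝ => sumLogDivPrimes t * (t * Real.log t ^ 2)⁻¹)
      MeasureTheory.volume 2 x := by
    refine (sumLogDivPrimes_mono.intervalIntegrable).mul_continuousOn fun t ht =>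
      ContinuousAt.continuousWithinAt ?_
    rw [uIcc_of_le hx] at ht
    have h1 : 0 < t := by linarith [ht.1]
    have h2 : 0 < Real.log t := Real.log_pos (by linarith [ht.1])
    have : t ≠ 0 := h1.ne'
    have : t * Real.log t ^ 2 ≠ 0 := by positivity
    fun_prop (disch := assumption)
  obtain ⟨hi1, he1⟩ := integral_log_add_mul hx K
  obtain ⟨hi2, he2⟩ := integral_log_add_mul hx (-K)
  have hpt : ∀ t ∈ Icc 2 x, 0 ≤ (t * Real.log t ^ 2)⁻¹ := fun t ht => by
    have : 0 < t := by linarith [ht.1]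
    positivity
  have hub := intervalIntegral.integral_mono_on hx hinteg hi1 fun t ht =>
    mul_le_mul_of_nonneg_right (show sumLogDivPrimes t ≤ Real.log t + K by
      have := (abs_le.1 (hK t (by linarith [ht.1]))).2
      linarith) (hpt t ht)
  have hlb := intervalIntegral.integral_mono_on hx hi2 hinteg fun t ht =>
    mul_le_mul_of_nonneg_right (show Real.log t + -K ≤ sumLogDivPrimes t by
      have := (abs_le.1 (hK t (by linarith [ht.1]))).1
      linarith) (hpt t ht)
  rw [he1] at hub
  rw [he2] at hlb
  rw [sumInvPrimes_eq hx]
  have hq := abs_le.1 (hK x (by linarith))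
  have hKL : K / Real.log x ≤ 2 * K := by
    rw [div_le_iff₀ (by linarith)]; nlinarith
  have hK2 : K / Real.log 2 ≤ 2 * K := by
    rw [div_le_iff₀ (by linarith)]; nlinarith
  have hKL0 : 0 ≤ K / Real.log x := div_nonneg hK0 (by linarith)
  have hK20 : 0 ≤ K / Real.log 2 := div_nonneg hK0 (by linarith)
  have hA1 : sumLogDivPrimes x / Real.log x ≤ 1 + K / Real.log x := by
    rw [← div_self (show Real.log x ≠ 0 by linarith), ← add_div]
    exact div_le_div_of_nonneg_right (by linarith) (by linarith)
  have hA2 : 1 - K / Real.log x ≤ sumLogDivPrimes x / Real.log x := by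
    rw [← div_self (show Real.log x ≠ 0 by linarith), ← sub_div]
    exact div_le_div_of_nonneg_right (by linarith) (by linarith)
  simp only [neg_div] at hlb
  have hll := abs_le.1 (le_refl |Real.log (Real.log 2)|)
  rw [abs_le]
  constructor <;> linarith

/-- The norm `m / c ^ Ω(m)`. -/
noncomputable def scaledNorm (c m : ℕ) : ℝ := m / (c : ℝ) ^ cardFactors m

/-- The positive integers coprime to `c` with `m / c ^ Ω(m) ≤ x`; the explicit bound on `m` is
implied by the other conditions when `c ≤ 2`. -/
noncomputable def normLE (c : ℕ) (x : ℝ) : Finset ℕ :=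
  (Finset.Icc 1 ⌊x * 2 ^ ⌊2 * x⌋₊⌋₊).filter fun m => c.Coprime m ∧ scaledNorm c m ≤ x

/-- The primes `p` not dividing `c` with `p / c ≤ x`. -/
noncomputable def primesNormLE (c : ℕ) (x : ℝ) : Finset ℕ :=
  (Finset.Icc 0 ⌊(c : ℝ) * x⌋₊).filter fun p => p.Prime ∧ c.Coprime p

lemma scaledNorm_pos {c m : ℕ} (hc : c = 1 ∨ c = 2) (hm : m ≠ 0) : 0 < scaledNorm c m := by
  have : (0 : ℝ) < m := by exact_mod_cast Nat.pos_of_ne_zero hm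
  rcases hc with rfl | rfl <;> simp only [scaledNorm] <;> positivity

lemma scaledNorm_mul (c : ℕ) {m n : ℕ} (hm : m ≠ 0) (hn : n ≠ 0) :
    scaledNorm c (m * n) = scaledNorm c m * scaledNorm c n := by
  simp only [scaledNorm, cardFactors_mul hm hn, pow_add, Nat.cast_mul]
  rw [mul_div_mul_comm]

lemma scaledNorm_prime_pow (c : ℕ) {p : ℕ} (hp : p.Prime) (a : ℕ) :
    scaledNorm c (p ^ a) = ((p : ℝ) / c) ^ a := by
  simp only [scaledNorm, cardFactors_apply_prime_pow hp, Nat.cast_pow, div_pow]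

lemma three_halves_le_prime_div {c p : ℕ} (hc : c = 1 ∨ c = 2) (hp : p.Prime)
    (hcp : c.Coprime p) : (3 / 2 : ℝ) ≤ p / c := by
  rcases hc with rfl | rfl
  · have : (2 : ℝ) ≤ p := by exact_mod_cast hp.two_le
    simp; linarith
  · have h3 : 3 ≤ p := by
      have h2 := hp.two_le
      rcases h2.eq_or_lt with h | h
      · subst h; simp at hcp
      · exact h
    have : (3 : ℝ) ≤ p := by exact_mod_cast h3
    push_cast; linarith

lemma three_halves_pow_le_scaledNorm {c : ℕ} (hc : c = 1 ∨ c = 2) (m : ℕ) :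
    m ≠ 0 → c.Coprime m → (3 / 2 : ℝ) ^ cardFactors m ≤ scaledNorm c m := by
  induction m using induction_on_primes with
  | zero => simp
  | one => simp [scaledNorm]
  | prime_mul p m hp ih =>
    intro h0 hcop
    have hm : m ≠ 0 := right_ne_zero_of_mul h0
    rw [Nat.coprime_mul_iff_right] at hcop
    rw [scaledNorm_mul c hp.ne_zero hm, cardFactors_mul hp.ne_zero hm, pow_add]
    have h1 := three_halves_le_prime_div hc hp hcop.1
    have h2 := scaledNorm_prime_pow c hp 1
    rw [pow_one, pow_one] at h2
    rw [h2, ArithmeticFunction.cardFactors_apply_prime hp, pow_one]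
    exact mul_le_mul h1 (ih hm hcop.2) (by positivity) (by linarith)

lemma one_le_scaledNorm {c m : ℕ} (hc : c = 1 ∨ c = 2) (hm : m ≠ 0) (hcm : c.Coprime m) :
    1 ≤ scaledNorm c m :=
  (one_le_pow₀ (by norm_num)).trans (three_halves_pow_le_scaledNorm hc m hm hcm)

lemma cardFactors_le_two_mul {c m : ℕ} (hc : c = 1 ∨ c = 2) (hm : m ≠ 0) (hcm : c.Coprime m) :
    (cardFactors m : ℝ) ≤ 2 * scaledNorm c m := by
  have h := three_halves_pow_le_scaledNorm hc m hm hcm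
  have h2 := one_add_mul_le_pow (a := (1 / 2 : ℝ)) (by norm_num) (cardFactors m)
  norm_num at h2
  linarith

lemma mem_normLE {c : ℕ} (hc : c = 1 ∨ c = 2) {x : ℝ} {m : ℕ} :
    m ∈ normLE c x ↔ m ≠ 0 ∧ c.Coprime m ∧ scaledNorm c m ≤ x := by
  simp only [normLE, Finset.mem_filter, Finset.mem_Icc]
  constructor
  · rintro ⟨⟨h1, -⟩, h2, h3⟩
    exact ⟨by omega, h2, h3⟩
  · rintro ⟨h1, h2, h3⟩
    refine ⟨⟨by omega, Nat.le_floor ?_⟩, h2, h3⟩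
    have h4 : cardFactors m ≤ ⌊2 * x⌋₊ :=
      Nat.le_floor ((cardFactors_le_two_mul hc h1 h2).trans (by linarith))
    have hc1 : (1 : ℝ) ≤ c := by rcases hc with rfl | rfl <;> norm_num
    have hc2 : (c : ℝ) ≤ 2 := by rcases hc with rfl | rfl <;> norm_num
    have h5 : (m : ℝ) = scaledNorm c m * (c : ℝ) ^ cardFactors m := by
      rw [scaledNorm, div_mul_cancel₀]; positivity
    have h0 : 0 ≤ scaledNorm c m := (scaledNorm_pos hc h1).le
    rw [h5]
    refine mul_le_mul h3 ?_ (by positivity) (h0.trans h3)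
    exact (pow_le_pow_left₀ (by linarith) hc2 _).trans (pow_le_pow_right₀ (by norm_num) h4)

lemma mem_primesNormLE {c : ℕ} (hc : c = 1 ∨ c = 2) {x : ℝ} (hx : 0 ≤ x) {p : ℕ} :
    p ∈ primesNormLE c x ↔ p.Prime ∧ c.Coprime p ∧ (p : ℝ) / c ≤ x := by
  have hc0 : (0 : ℝ) < c := by rcases hc with rfl | rfl <;> norm_num
  simp only [primesNormLE, Finset.mem_filter, Finset.mem_Icc, zero_le, true_and]
  rw [Nat.le_floor_iff (by positivity), div_le_iff₀ hc0, mul_comm x]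
  tauto

lemma normLE_mono {c : ℕ} (hc : c = 1 ∨ c = 2) {x y : ℝ} (h : x ≤ y) : normLE c x ⊆ normLE c y := by
  intro m
  rw [mem_normLE hc, mem_normLE hc]
  rintro ⟨h1, h2, h3⟩
  exact ⟨h1, h2, h3.trans h⟩

lemma log_scaledNorm {c m : ℕ} (hc : c = 1 ∨ c = 2) (hm : m ≠ 0) :
    Real.log (scaledNorm c m) =
      m.factorization.sum fun p v => (v : ℝ) * Real.log ((p : ℝ) / c) := by
  have hc0 : (0 : ℝ) < c := by rcases hc with rfl | rfl <;> norm_num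
  have hm0 : (m : ℝ) ≠ 0 := by exact_mod_cast hm
  rw [scaledNorm, Real.log_div hm0 (by positivity), Real.log_pow,
    Real.log_nat_eq_sum_factorization, ArithmeticFunction.cardFactors_eq_sum_factorization,
    Finsupp.sum, Finsupp.sum, Finsupp.sum]
  push_cast
  rw [Finset.sum_mul, ← Finset.sum_sub_distrib]
  refine Finset.sum_congr rfl fun p hp => ?_
  have : (p : ℝ) ≠ 0 := by
    exact_mod_cast (Nat.prime_of_mem_primeFactors (by simpa using hp)).ne_zero
  rw [Real.log_div this hc0.ne']
  ring

/-- Summing over the prime powers dividing `m`, and then over the complementary divisor. -/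
lemma sum_mul_factorization_sum {c : ℕ} (hc : c = 1 ∨ c = 2) (x : ℝ) (f φ : ℕ → ℝ) :
    ∑ m ∈ normLE c x, f m * (m.factorization.sum fun p v => (v : ℝ) * φ p) =
      ∑ a ∈ Finset.Icc 1 ⌊2 * x⌋₊, ∑ p ∈ primesNormLE c x,
        φ p * ∑ m ∈ normLE c (x / ((p : ℝ) / c) ^ a), f (p ^ a * m) := by
  have key : ∀ m ∈ normLE c x, f m * (m.factorization.sum fun p v => (v : ℝ) * φ p) =
      ∑ a ∈ Finset.Icc 1 ⌊2 * x⌋₊, ∑ p ∈ primesNormLE c x,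
        if p ^ a ∣ m then φ p * f m else 0 := by
    intro m hm
    rw [mem_normLE hc] at hm
    obtain ⟨hm0, hcop, hle⟩ := hm
    have hx0 : 0 ≤ x := (scaledNorm_pos hc hm0).le.trans hle
    have h1 : (m.factorization.sum fun p v => (v : ℝ) * φ p) =
        ∑ p ∈ primesNormLE c x, (m.factorization p : ℝ) * φ p := by
      rw [Finsupp.sum]
      refine Finset.sum_subset ?_ ?_
      · intro p hp
        have hp' := Nat.prime_of_mem_primeFactors (by simpa using hp)
        have hpm := Nat.dvd_of_mem_primeFactors (by simpa using hp)
        have hcp : c.Coprime p := Nat.Coprime.coprime_dvd_right hpm hcop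
        rw [mem_primesNormLE hc hx0]
        refine ⟨hp', hcp, ?_⟩
        obtain ⟨d, rfl⟩ := hpm
        have hd : d ≠ 0 := right_ne_zero_of_mul hm0
        have hcd := Nat.Coprime.coprime_dvd_right (Dvd.intro_left p rfl) hcop
        rw [scaledNorm_mul c hp'.ne_zero hd] at hle
        have h2 := scaledNorm_prime_pow c hp' 1
        rw [pow_one, pow_one] at h2
        rw [← h2]
        refine le_trans ?_ hle
        exact le_mul_of_one_le_right (scaledNorm_pos hc hp'.ne_zero).le
          (one_le_scaledNorm hc hd hcd)
      · intro p _ hp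
        rw [Finsupp.notMem_support_iff.1 hp]
        simp
    rw [h1, Finset.sum_comm, Finset.mul_sum]
    refine Finset.sum_congr rfl fun p hp => ?_
    have hp' := ((mem_primesNormLE hc hx0).1 hp).1
    rw [← Finset.sum_filter, Finset.sum_const, nsmul_eq_mul]
    have hcard : ((Finset.Icc 1 ⌊2 * x⌋₊).filter fun a => p ^ a ∣ m) =
        Finset.Icc 1 (m.factorization p) := by
      ext a
      simp only [Finset.mem_filter, Finset.mem_Icc]
      rw [hp'.pow_dvd_iff_le_factorization hm0]
      have h3 : m.factorization p ≤ cardFactors m := by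
        rw [ArithmeticFunction.cardFactors_eq_sum_factorization, Finsupp.sum]
        by_cases hps : p ∈ m.factorization.support
        · exact Finset.single_le_sum (f := fun p => m.factorization p)
            (fun _ _ => Nat.zero_le _) hps
        · rw [Finsupp.notMem_support_iff.1 hps]; exact Nat.zero_le _
      have h4 : cardFactors m ≤ ⌊2 * x⌋₊ :=
        Nat.le_floor ((cardFactors_le_two_mul hc hm0 hcop).trans (by linarith))
      omega
    rw [hcard, Nat.card_Icc, Nat.add_sub_cancel]
    ring
  rw [Finset.sum_congr rfl key, Finset.sum_comm]
  refine Finset.sum_congr rfl fun a ha => ?_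
  rw [Finset.sum_comm]
  refine Finset.sum_congr rfl fun p hp => ?_
  rw [← Finset.sum_filter, Finset.mul_sum]
  have hx0 : 0 ≤ x := by
    by_contra hx
    have : ⌊2 * x⌋₊ = 0 := Nat.floor_of_nonpos (by linarith)
    rw [this] at ha
    simp at ha
  obtain ⟨hp', hcp, -⟩ := (mem_primesNormLE hc hx0).1 hp
  have hpa : p ^ a ≠ 0 := pow_ne_zero _ hp'.ne_zero
  have hq : (0 : ℝ) < ((p : ℝ) / c) ^ a := by
    have := three_halves_le_prime_div hc hp' hcp
    positivity
  symm
  refine Finset.sum_bij (fun m _ => p ^ a * m) ?_ ?_ ?_ ?_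
  · intro m hm
    rw [mem_normLE hc, le_div_iff₀ hq] at hm
    rw [Finset.mem_filter, mem_normLE hc, scaledNorm_mul c hpa hm.1, scaledNorm_prime_pow c hp',
      mul_comm _ (scaledNorm c m), Nat.coprime_mul_iff_right]
    exact ⟨⟨mul_ne_zero hpa hm.1, ⟨hcp.pow_right a, hm.2.1⟩, hm.2.2⟩, Dvd.intro _ rfl⟩
  · intro m _ m' _ h
    exact Nat.eq_of_mul_eq_mul_left (Nat.pos_of_ne_zero hpa) h
  · intro m hm
    rw [Finset.mem_filter, mem_normLE hc] at hm
    obtain ⟨⟨h0, h1, h2⟩, d, rfl⟩ := hm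
    have hd : d ≠ 0 := right_ne_zero_of_mul h0
    refine ⟨d, ?_, rfl⟩
    rw [mem_normLE hc, le_div_iff₀ hq]
    rw [scaledNorm_mul c hpa hd, scaledNorm_prime_pow c hp', mul_comm] at h2
    exact ⟨hd, (Nat.coprime_mul_iff_right.1 h1).2, h2⟩
  · intro m _
    rfl

lemma sum_log_primesNormLE {c : ℕ} (hc : c = 1 ∨ c = 2) (u : ℝ) :
    ∑ p ∈ primesNormLE c u, Real.log ((p : ℝ) / c) =
      Chebyshev.theta (c * u) - Nat.primeCounting ⌊(c : ℝ) * u⌋₊ * Real.log c := by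
  have hc0 : (c : ℝ) ≠ 0 := by rcases hc with rfl | rfl <;> norm_num
  have h1 : ∑ p ∈ primesNormLE c u, Real.log ((p : ℝ) / c) =
      ∑ p ∈ (Finset.Icc 0 ⌊(c : ℝ) * u⌋₊).filter Nat.Prime, (Real.log p - Real.log c) := by
    rw [primesNormLE]
    have h2 : ∑ p ∈ (Finset.Icc 0 ⌊(c : ℝ) * u⌋₊).filter Nat.Prime, (Real.log p - Real.log c) =
        ∑ p ∈ (Finset.Icc 0 ⌊(c : ℝ) * u⌋₊).filter Nat.Prime, Real.log ((p : ℝ) / c) := by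
      refine Finset.sum_congr rfl fun p hp => ?_
      rw [Real.log_div (by exact_mod_cast (Finset.mem_filter.1 hp).2.ne_zero) hc0]
    rw [h2]
    refine Finset.sum_subset (fun p hp => ?_) fun p hp hp2 => ?_
    · simp only [Finset.mem_filter] at hp ⊢
      exact ⟨hp.1, hp.2.1⟩
    · simp only [Finset.mem_filter, not_and] at hp hp2
      have h3 := hp2 hp.1 hp.2
      rcases hc with rfl | rfl
      · simp at h3
      · have : p = 2 := by
          by_contra hne
          exact h3 ((Nat.coprime_primes Nat.prime_two hp.2).2 (Ne.symm hne))
        simp [this]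
  rw [h1, Finset.sum_sub_distrib, ← Chebyshev.theta_eq_sum_Icc, Finset.sum_const, nsmul_eq_mul,
    Nat.primeCounting, Nat.primeCounting', Nat.count_eq_card_filter_range,
    Nat.range_succ_eq_Icc_zero]

lemma log_nonneg_of_mem_primesNormLE {c : ℕ} (hc : c = 1 ∨ c = 2) {p : ℕ} (hp : p.Prime)
    (hcp : c.Coprime p) : 0 ≤ Real.log ((p : ℝ) / c) :=
  Real.log_nonneg (by linarith [three_halves_le_prime_div hc hp hcp])

lemma sum_log_primesNormLE_le {c : ℕ} (hc : c = 1 ∨ c = 2) {ε : ℝ} (hε : 0 < ε) :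
    ∃ K, 0 ≤ K ∧ ∀ u, 0 ≤ u →
      ∑ p ∈ primesNormLE c u, Real.log ((p : ℝ) / c) ≤ (c + ε) * u + K := by
  have hc1 : (1 : ℝ) ≤ c := by rcases hc with rfl | rfl <;> norm_num
  obtain ⟨Y, hY⟩ := ((tendsto_theta_div.eventually_lt_const (show 1 < 1 + ε / c by
    simp; positivity)).and (eventually_gt_atTop 0)).exists_forall_of_atTop
  refine ⟨Chebyshev.theta Y, Chebyshev.theta_nonneg Y, fun u hu => ?_⟩
  rw [sum_log_primesNormLE hc]
  have h1 : 0 ≤ (Nat.primeCounting ⌊(c : ℝ) * u⌋₊ : ℝ) * Real.log c :=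
    mul_nonneg (Nat.cast_nonneg _) (Real.log_nonneg hc1)
  have hY0 := Chebyshev.theta_nonneg Y
  rcases le_total Y (c * u) with h | h
  · obtain ⟨h2, h3⟩ := hY _ h
    rw [div_lt_iff₀ h3] at h2
    have : (1 + ε / c) * (c * u) = (c + ε) * u := by field_simp
    linarith
  · have := Chebyshev.theta_mono h
    have : 0 ≤ (c + ε) * u := by positivity
    linarith

lemma le_sum_log_primesNormLE {c : ℕ} (hc : c = 1 ∨ c = 2) {ε : ℝ} (hε : 0 < ε) :
    ∃ K, 1 ≤ K ∧ ∀ u, K ≤ u →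
      (c - ε) * u ≤ ∑ p ∈ primesNormLE c u, Real.log ((p : ℝ) / c) := by
  have hc1 : (1 : ℝ) ≤ c := by rcases hc with rfl | rfl <;> norm_num
  have hlc : 0 ≤ Real.log c := Real.log_nonneg hc1
  have hd : 0 < ε / (2 * c) := by positivity
  have h1 := tendsto_theta_div.eventually_const_lt (show 1 - ε / (2 * c) < 1 by linarith)
  have h2 := Chebyshev.eventually_primeCounting_le (zero_lt_one)
  have h3 : Tendsto (fun y : ℝ => (Real.log 4 + 1) * Real.log c / Real.log y) atTop (𝓝 0) :=
    Real.tendsto_log_atTop.const_div_atTop _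
  obtain ⟨Y, hY⟩ := (((h1.and h2).and (h3.eventually_lt_const hd)).and
    (eventually_gt_atTop 0)).exists_forall_of_atTop
  refine ⟨max 1 Y, le_max_left _ _, fun u hu => ?_⟩
  have hu1 : 1 ≤ u := (le_max_left _ _).trans hu
  have hYu : Y ≤ c * u := ((le_max_right _ _).trans hu).trans (by nlinarith)
  obtain ⟨⟨⟨h4, h5⟩, h6⟩, h7⟩ := hY _ hYu
  rw [sum_log_primesNormLE hc]
  rw [lt_div_iff₀ h7] at h4
  have h8 := mul_le_mul_of_nonneg_right h5 hlc
  have h9 : (Real.log 4 + 1) * (c * u) / Real.log (c * u) * Real.log c ≤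
      ε / (2 * c) * (c * u) := by
    refine le_trans (le_of_eq ?_) (mul_le_mul_of_nonneg_right h6.le h7.le)
    ring
  have h10 : ε / (2 * c) * (c * u) = ε / 2 * u := by field_simp
  have h11 : (1 - ε / (2 * c)) * (c * u) = c * u - ε / 2 * u := by rw [sub_mul, h10]; ring
  linarith

lemma sum_log_div_primesNormLE_le {c : ℕ} (hc : c = 1 ∨ c = 2) :
    ∃ K, 0 ≤ K ∧ ∀ y' y, 0 < y' → y' ≤ y →
      ∑ p ∈ (primesNormLE c y).filter (fun p : ℕ => y' < (p : ℝ) / c),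
        Real.log ((p : ℝ) / c) / ((p : ℝ) / c) ≤ c * Real.log (y / y') + K := by
  have hc1 : (1 : ℝ) ≤ c := by rcases hc with rfl | rfl <;> norm_num
  have hc0 : (0 : ℝ) < c := by linarith
  obtain ⟨K, hK0, hK⟩ := abs_sumLogDivPrimes_sub_log_le
  refine ⟨c * (2 * K), by positivity, fun y' y hy' hyy => ?_⟩
  have hy : 0 < y := by linarith
  have hlog : 0 ≤ Real.log (y / y') := Real.log_nonneg ((one_le_div hy').2 hyy)
  have hle : ∑ p ∈ (primesNormLE c y).filter (fun p : ℕ => y' < (p : ℝ) / c),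
        Real.log ((p : ℝ) / c) / ((p : ℝ) / c) ≤
      c * (sumLogDivPrimes (c * y) - sumLogDivPrimes (c * y')) := by
    have hsub : (Finset.Icc 0 ⌊(c : ℝ) * y'⌋₊).filter Nat.Prime ⊆
        (Finset.Icc 0 ⌊(c : ℝ) * y⌋₊).filter Nat.Prime :=
      Finset.filter_subset_filter _ (Finset.Icc_subset_Icc_right (Nat.floor_mono (by nlinarith)))
    have h1 : sumLogDivPrimes (c * y) - sumLogDivPrimes (c * y') =
        ∑ p ∈ (Finset.Icc 0 ⌊(c : ℝ) * y⌋₊).filter Nat.Prime \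
          (Finset.Icc 0 ⌊(c : ℝ) * y'⌋₊).filter Nat.Prime, Real.log p / p := by
      rw [sumLogDivPrimes, sumLogDivPrimes, sub_eq_iff_eq_add, Finset.sum_sdiff hsub]
    rw [h1, Finset.mul_sum]
    calc _ ≤ ∑ p ∈ (primesNormLE c y).filter (fun p : ℕ => y' < (p : ℝ) / c),
          (c : ℝ) * (Real.log p / p) := by
          refine Finset.sum_le_sum fun p hp => ?_
          rw [Finset.mem_filter, mem_primesNormLE hc hy.le] at hp
          have hp0 : (0 : ℝ) < p := by exact_mod_cast hp.1.1.pos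
          have h2 : Real.log ((p : ℝ) / c) ≤ Real.log p :=
            Real.log_le_log (by positivity) (div_le_self hp0.le hc1)
          rw [div_div_eq_mul_div, mul_comm, mul_div_assoc]
          gcongr
      _ ≤ _ := by
          refine Finset.sum_le_sum_of_subset_of_nonneg (fun p hp => ?_) fun p _ _ =>
            mul_nonneg hc0.le (div_nonneg (Real.log_natCast_nonneg p) (Nat.cast_nonneg p))
          rw [Finset.mem_filter, mem_primesNormLE hc hy.le, lt_div_iff₀ hc0,
            div_le_iff₀ hc0] at hp
          simp only [Finset.mem_sdiff, Finset.mem_filter, Finset.mem_Icc, zero_le, true_and,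
            not_and]
          refine ⟨⟨Nat.le_floor (by linarith [hp.1.2.2]), hp.1.1⟩, fun h => ?_⟩
          have := (Nat.le_floor_iff (by positivity)).1 h
          linarith [hp.2]
  refine hle.trans ?_
  rw [← mul_add]
  refine mul_le_mul_of_nonneg_left ?_ hc0.le
  rcases lt_or_ge (c * y) 1 with h | h
  · have h0 : ∀ t : ℝ, t < 1 → sumLogDivPrimes t = 0 := fun t ht => by
      rw [sumLogDivPrimes, (Nat.floor_eq_zero).2 ht]
      simp [Finset.sum_filter, Nat.not_prime_zero]
    rw [h0 _ h, h0 (c * y') (by nlinarith)]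
    linarith
  · have h2 := abs_le.1 (hK _ h)
    have e : Real.log (y / y') = Real.log (c * y) - Real.log (c * y') := by
      rw [Real.log_div hy.ne' hy'.ne', Real.log_mul hc0.ne' hy.ne', Real.log_mul hc0.ne' hy'.ne']
      ring
    rcases lt_or_ge (c * y') 1 with h' | h'
    · have h3 : 0 ≤ sumLogDivPrimes (c * y') :=
        Finset.sum_nonneg fun p _ => div_nonneg (Real.log_natCast_nonneg p) (Nat.cast_nonneg p)
      have h4 : Real.log (c * y') ≤ 0 := Real.log_nonpos (by positivity) h'.le
      linarith
    · have h3 := abs_le.1 (hK _ h')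
      linarith

lemma sum_inv_primesNormLE_le {c : ℕ} (hc : c = 1 ∨ c = 2) :
    ∃ K, 0 ≤ K ∧ ∀ x, 3 ≤ x →
      ∑ p ∈ primesNormLE c x, ((p : ℝ) / c)⁻¹ ≤ c * Real.log (Real.log x) + K := by
  have hc1 : (1 : ℝ) ≤ c := by rcases hc with rfl | rfl <;> norm_num
  have hc2 : (c : ℝ) ≤ 2 := by rcases hc with rfl | rfl <;> norm_num
  have hc0 : (0 : ℝ) < c := by linarith
  obtain ⟨K, hK0, hK⟩ := abs_sumInvPrimes_sub_log_log_le
  refine ⟨c * (K + 1), by positivity, fun x hx => ?_⟩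
  have h1 : ∑ p ∈ primesNormLE c x, ((p : ℝ) / c)⁻¹ ≤ c * sumInvPrimes (c * x) := by
    rw [sumInvPrimes, Finset.mul_sum]
    have h0 : ∀ p : ℕ, ((p : ℝ) / c)⁻¹ = c * (p : ℝ)⁻¹ := fun p => by
      rw [inv_div, div_eq_mul_inv]
    simp_rw [h0]
    refine Finset.sum_le_sum_of_subset_of_nonneg (fun p hp => ?_) fun p _ _ => by positivity
    simp only [primesNormLE, Finset.mem_filter] at hp ⊢
    exact ⟨hp.1, hp.2.1⟩
  refine h1.trans ?_
  rw [← mul_add]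
  refine mul_le_mul_of_nonneg_left ?_ hc0.le
  have h2 := (abs_le.1 (hK (c * x) (by nlinarith))).2
  have hlx : 0 < Real.log x := Real.log_pos (by linarith)
  have h3 : Real.log (Real.log (c * x)) ≤ Real.log (Real.log x) + 1 := by
    have h4 : Real.log (c * x) ≤ 2 * Real.log x := by
      rw [two_mul, ← Real.log_mul (by linarith) (by linarith)]
      exact Real.log_le_log (by positivity) (by nlinarith)
    have h5 := Real.log_le_log (Real.log_pos (by nlinarith)) h4
    rw [Real.log_mul (by norm_num) hlx.ne'] at h5
    linarith [Real.log_two_lt_d9]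
  linarith

lemma le_sum_inv_primesNormLE_one :
    ∃ K, 0 ≤ K ∧ ∀ x, 3 ≤ x →
      Real.log (Real.log x) - K ≤ ∑ p ∈ primesNormLE 1 x, (p : ℝ)⁻¹ := by
  obtain ⟨K, hK0, hK⟩ := abs_sumInvPrimes_sub_log_log_le
  refine ⟨K, hK0, fun x hx => ?_⟩
  have h1 : ∑ p ∈ primesNormLE 1 x, (p : ℝ)⁻¹ = sumInvPrimes x := by
    simp [primesNormLE, sumInvPrimes]
  rw [h1]
  linarith [(abs_le.1 (hK x hx)).1]

/-- `B` is smaller than the least norm of a prime not dividing `c`, with room to spare. -/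
def BelowPrimes (c : ℕ) (B : ℝ) : Prop :=
  0 < B ∧ ∃ ρ : ℝ, 0 < ρ ∧ ρ < 1 ∧ ∀ p : ℕ, p.Prime → c.Coprime p → B ≤ ρ * ((p : ℝ) / c)

/-- The weight `2 log p (B c / p) ^ a` of a proper prime power `p ^ a` coprime to `c`. -/
noncomputable def properPowerWeight (c : ℕ) (B : ℝ) (z : ℕ × ℕ) : ℝ :=
  if 2 ≤ z.1 ∧ z.2.Prime ∧ c.Coprime z.2 then
    2 * Real.log z.2 * (B / ((z.2 : ℝ) / c)) ^ z.1 else 0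

lemma properPowerWeight_nonneg {c : ℕ} {B : ℝ} (hB : 0 ≤ B) (z : ℕ × ℕ) :
    0 ≤ properPowerWeight c B z := by
  rw [properPowerWeight]
  split_ifs
  · have := Real.log_natCast_nonneg z.2
    positivity
  · exact le_rfl

lemma summable_properPowerWeight {c : ℕ} {B : ℝ} (hB : BelowPrimes c B) :
    Summable (properPowerWeight c B) := by
  obtain ⟨hB0, ρ, hρ0, hρ1, hρ⟩ := hB
  have h1 : Summable fun a : ℕ => ρ ^ a / ρ ^ 2 :=
    (summable_geometric_of_lt_one hρ0.le hρ1).div_const _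
  have h2 : Summable fun n : ℕ => 4 * (B * c) ^ 2 * ((n : ℝ) * √n)⁻¹ :=
    summable_inv_mul_sqrt.mul_left _
  refine (h1.mul_of_nonneg h2 (fun a => by positivity) fun n => by positivity).of_nonneg_of_le
    (properPowerWeight_nonneg hB0.le) ?_
  rintro ⟨a, p⟩
  rw [properPowerWeight]
  split_ifs with h
  · obtain ⟨ha, hp, hcp⟩ := h
    simp only at ha hp hcp ⊢
    have hp0 : (0 : ℝ) < p := by exact_mod_cast hp.pos
    have hs : 0 < √(p : ℝ) := Real.sqrt_pos.2 hp0
    have hss : √(p : ℝ) * √p = p := Real.mul_self_sqrt hp0.le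
    have hq0 : 0 < (p : ℝ) / c := by
      by_contra hneg
      have := hρ p hp hcp
      nlinarith
    have hr : B / ((p : ℝ) / c) ≤ ρ := by
      rw [div_le_iff₀ hq0]; exact hρ p hp hcp
    have hr0 : 0 ≤ B / ((p : ℝ) / c) := by positivity
    have hl := log_le_two_mul_sqrt hp0
    obtain ⟨d, rfl⟩ := Nat.exists_eq_add_of_le ha
    have e1 : ρ ^ (2 + d) / ρ ^ 2 = ρ ^ d := by rw [pow_add]; field_simp
    rw [e1, pow_add]
    have e2 : 2 * (2 * √(p : ℝ)) * (B / ((p : ℝ) / c)) ^ 2 =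
        4 * (B * c) ^ 2 * ((p : ℝ) * √p)⁻¹ := by
      rw [div_div_eq_mul_div, div_pow, ← div_eq_mul_inv, mul_div_assoc', div_eq_div_iff
        (by positivity) (by positivity)]
      linear_combination 4 * (B * c) ^ 2 * (p : ℝ) * hss
    calc 2 * Real.log p * ((B / ((p : ℝ) / c)) ^ 2 * (B / ((p : ℝ) / c)) ^ d)
        ≤ 2 * (2 * √(p : ℝ)) * ((B / ((p : ℝ) / c)) ^ 2 * ρ ^ d) := by gcongr
      _ = ρ ^ d * (2 * (2 * √(p : ℝ)) * (B / ((p : ℝ) / c)) ^ 2) := by ring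
      _ = _ := by rw [e2]
  · simp only
    positivity

/-- The weight `w` translated by `a`. -/
def shiftWeight (w : ℕ → ℝ) (a : ℕ) : ℕ → ℝ := fun i => w (i + a)

/-- The logarithmic sum of `w (Ω(m))` over `m` coprime to `c` with scaled norm at most `x`. -/
noncomputable def harmSum (c : ℕ) (w : ℕ → ℝ) (x : ℝ) : ℝ :=
  ∑ m ∈ normLE c x, w (cardFactors m) / scaledNorm c m

/-- The sum of `w (Ω(m))` over `m` coprime to `c` with scaled norm at most `x`. -/
noncomputable def cntSum (c : ℕ) (w : ℕ → ℝ) (x : ℝ) : ℝ :=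
  ∑ m ∈ normLE c x, w (cardFactors m)

/-- Each translation of the weight increases the logarithmic sum by a factor at most `B`. -/
def ShiftRatioLE (c : ℕ) (B : ℝ) (w : ℕ → ℝ) (x : ℝ) : Prop :=
  ∀ a, harmSum c (shiftWeight w (a + 1)) x ≤ B * harmSum c (shiftWeight w a) x

lemma shiftWeight_zero (w : ℕ → ℝ) : shiftWeight w 0 = w := rfl

lemma shiftWeight_shiftWeight (w : ℕ → ℝ) (a b : ℕ) :
    shiftWeight (shiftWeight w b) a = shiftWeight w (a + b) := by
  funext i
  simp [shiftWeight, add_assoc]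

lemma shiftWeight_nonneg {w : ℕ → ℝ} (hw : ∀ i, 0 ≤ w i) (a i : ℕ) : 0 ≤ shiftWeight w a i :=
  hw _

section

variable {c : ℕ} {w : ℕ → ℝ}

lemma harmSum_nonneg (hc : c = 1 ∨ c = 2) (hw : ∀ i, 0 ≤ w i) (x : ℝ) : 0 ≤ harmSum c w x :=
  Finset.sum_nonneg fun _ hm =>
    div_nonneg (hw _) (scaledNorm_pos hc ((mem_normLE hc).1 hm).1).le

lemma harmSum_mono (hc : c = 1 ∨ c = 2) (hw : ∀ i, 0 ≤ w i) {x y : ℝ} (h : x ≤ y) :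
    harmSum c w x ≤ harmSum c w y :=
  Finset.sum_le_sum_of_subset_of_nonneg (normLE_mono hc h) fun _ hm _ =>
    div_nonneg (hw _) (scaledNorm_pos hc ((mem_normLE hc).1 hm).1).le

lemma cntSum_nonneg (hw : ∀ i, 0 ≤ w i) (x : ℝ) : 0 ≤ cntSum c w x :=
  Finset.sum_nonneg fun _ _ => hw _

lemma cntSum_mono (hc : c = 1 ∨ c = 2) (hw : ∀ i, 0 ≤ w i) {x y : ℝ} (h : x ≤ y) :
    cntSum c w x ≤ cntSum c w y :=
  Finset.sum_le_sum_of_subset_of_nonneg (normLE_mono hc h) fun _ _ _ => hw _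

lemma cntSum_le_mul_harmSum (hc : c = 1 ∨ c = 2) (hw : ∀ i, 0 ≤ w i) (x : ℝ) :
    cntSum c w x ≤ x * harmSum c w x := by
  rw [cntSum, harmSum, Finset.mul_sum]
  refine Finset.sum_le_sum fun m hm => ?_
  obtain ⟨h1, -, h3⟩ := (mem_normLE hc).1 hm
  have h0 := scaledNorm_pos hc h1
  rw [mul_div_assoc', le_div_iff₀ h0, mul_comm]
  exact mul_le_mul_of_nonneg_right h3 (hw _)

lemma ShiftRatioLE.shift {B x : ℝ} (h : ShiftRatioLE c B w x) (b : ℕ) :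
    ShiftRatioLE c B (shiftWeight w b) x := fun a => by
  rw [shiftWeight_shiftWeight, shiftWeight_shiftWeight, add_right_comm]
  exact h _

lemma ShiftRatioLE.harmSum_le {B x : ℝ} (hB : 0 ≤ B) (h : ShiftRatioLE c B w x) (a : ℕ) :
    harmSum c (shiftWeight w a) x ≤ B ^ a * harmSum c w x := by
  induction a with
  | zero => simp [shiftWeight_zero]
  | succ a ih =>
    calc _ ≤ _ := h a
      _ ≤ B * (B ^ a * harmSum c w x) := by gcongr
      _ = _ := by ring

lemma normLE_facts (hc : c = 1 ∨ c = 2) {x : ℝ} {m : ℕ} (hm : m ∈ normLE c x) :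
    0 < scaledNorm c m ∧ 1 ≤ x / scaledNorm c m ∧ 0 < x := by
  obtain ⟨h1, h2, h3⟩ := (mem_normLE hc).1 hm
  have h0 := scaledNorm_pos hc h1
  exact ⟨h0, (one_le_div h0).2 h3, h0.trans_le h3⟩

lemma sum_weight_div_mul_factorization_sum (hc : c = 1 ∨ c = 2) (x : ℝ) (w φ : ℕ → ℝ) :
    ∑ m ∈ normLE c x, w (cardFactors m) / scaledNorm c m *
        (m.factorization.sum fun p v => (v : ℝ) * φ p) =
      ∑ a ∈ Finset.Icc 1 ⌊2 * x⌋₊, ∑ p ∈ primesNormLE c x,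
        φ p * ((((p : ℝ) / c) ^ a)⁻¹ *
          harmSum c (shiftWeight w a) (x / ((p : ℝ) / c) ^ a)) := by
  rw [sum_mul_factorization_sum hc x (fun m => w (cardFactors m) / scaledNorm c m) φ]
  refine Finset.sum_congr rfl fun a _ => Finset.sum_congr rfl fun p hp => ?_
  have hpp : p.Prime := (Finset.mem_filter.1 hp).2.1
  congr 1
  rw [harmSum, Finset.mul_sum]
  refine Finset.sum_congr rfl fun m hm => ?_
  have hm0 := ((mem_normLE hc).1 hm).1
  have hpa : p ^ a ≠ 0 := pow_ne_zero _ hpp.ne_zero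
  rw [cardFactors_mul hpa hm0, cardFactors_apply_prime_pow hpp, scaledNorm_mul c hpa hm0,
    scaledNorm_prime_pow c hpp, shiftWeight, add_comm a, div_eq_mul_inv, mul_inv, div_eq_mul_inv]
  ring

lemma sum_weight_mul_factorization_sum (hc : c = 1 ∨ c = 2) (x : ℝ) (w φ : ℕ → ℝ) :
    ∑ m ∈ normLE c x, w (cardFactors m) *
        (m.factorization.sum fun p v => (v : ℝ) * φ p) =
      ∑ a ∈ Finset.Icc 1 ⌊2 * x⌋₊, ∑ p ∈ primesNormLE c x,
        φ p * cntSum c (shiftWeight w a) (x / ((p : ℝ) / c) ^ a) := by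
  rw [sum_mul_factorization_sum hc x (fun m => w (cardFactors m)) φ]
  refine Finset.sum_congr rfl fun a _ => Finset.sum_congr rfl fun p hp => ?_
  have hpp : p.Prime := (Finset.mem_filter.1 hp).2.1
  rw [cntSum]
  congr 1
  refine Finset.sum_congr rfl fun m hm => ?_
  have hm0 := ((mem_normLE hc).1 hm).1
  have hpa : p ^ a ≠ 0 := pow_ne_zero _ hpp.ne_zero
  rw [cardFactors_mul hpa hm0, cardFactors_apply_prime_pow hpp, shiftWeight, add_comm a]

lemma sum_primesNormLE_sum_normLE_comm (hc : c = 1 ∨ c = 2) {x : ℝ} (hx : 0 ≤ x)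
    (G : ℕ → ℕ → ℝ) :
    ∑ p ∈ primesNormLE c x, ∑ m ∈ normLE c (x / ((p : ℝ) / c)), G p m =
      ∑ m ∈ normLE c x, ∑ p ∈ primesNormLE c (x / scaledNorm c m), G p m := by
  refine Finset.sum_comm' fun p m => ?_
  constructor
  · rintro ⟨hp, hm⟩
    rw [mem_primesNormLE hc hx] at hp
    rw [mem_normLE hc] at hm
    have hq := three_halves_le_prime_div hc hp.1 hp.2.1
    have hq0 : 0 < (p : ℝ) / c := by linarith
    have hN := scaledNorm_pos hc hm.1
    rw [mem_normLE hc, mem_primesNormLE hc (by positivity)]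
    have h1 := (le_div_iff₀ hq0).1 hm.2.2
    refine ⟨⟨hp.1, hp.2.1, ?_⟩, hm.1, hm.2.1, ?_⟩
    · rw [le_div_iff₀ hN]; linarith
    · nlinarith
  · rintro ⟨hp, hm⟩
    rw [mem_normLE hc] at hm
    have hN := scaledNorm_pos hc hm.1
    have hN1 := one_le_scaledNorm hc hm.1 hm.2.1
    rw [mem_primesNormLE hc (by positivity)] at hp
    have hq := three_halves_le_prime_div hc hp.1 hp.2.1
    have hq0 : 0 < (p : ℝ) / c := by linarith
    have h1 := (le_div_iff₀ hN).1 hp.2.2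
    rw [mem_normLE hc, mem_primesNormLE hc hx]
    refine ⟨⟨hp.1, hp.2.1, by nlinarith⟩, hm.1, hm.2.1, ?_⟩
    rw [le_div_iff₀ hq0]; linarith

lemma sum_Icc_one_le (f : ℕ → ℝ) (hf : ∀ a, 0 ≤ f a) (M : ℕ) :
    ∑ a ∈ Finset.Icc 1 M, f a ≤ f 1 + ∑ a ∈ Finset.Icc 2 M, f a := by
  rw [← Finset.sum_insert (by simp)]
  refine Finset.sum_le_sum_of_subset_of_nonneg (fun a ha => ?_) fun _ _ _ => hf _
  rw [Finset.mem_Icc] at ha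
  rw [Finset.mem_insert, Finset.mem_Icc]
  omega

lemma le_sum_Icc_one (f : ℕ → ℝ) (hf : ∀ a, 0 ≤ f a) {M : ℕ} (hM : 1 ≤ M) :
    f 1 ≤ ∑ a ∈ Finset.Icc 1 M, f a :=
  Finset.single_le_sum (fun a _ => hf a) (Finset.mem_Icc.2 ⟨le_rfl, hM⟩)

lemma log_prime_div_le (hc : c = 1 ∨ c = 2) {p : ℕ} (hp : p.Prime) :
    Real.log ((p : ℝ) / c) ≤ 2 * Real.log p := by
  have hc1 : (1 : ℝ) ≤ c := by rcases hc with rfl | rfl <;> norm_num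
  have hp0 : (0 : ℝ) < p := by exact_mod_cast hp.pos
  have := Real.log_natCast_nonneg p
  have := Real.log_le_log (show (0 : ℝ) < p / c by positivity) (div_le_self hp0.le hc1)
  linarith

lemma one_le_two_mul_log_prime {p : ℕ} (hp : p.Prime) : 1 ≤ 2 * Real.log p := by
  have := Real.log_le_log two_pos (show (2 : ℝ) ≤ p by exact_mod_cast hp.two_le)
  linarith [Real.log_two_gt_d9]

lemma mem_primesNormLE_prime {x : ℝ} {p : ℕ} (hp : p ∈ primesNormLE c x) :
    p.Prime ∧ c.Coprime p := (Finset.mem_filter.1 hp).2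

lemma sum_proper_le_tsum {B : ℝ} (hB : BelowPrimes c B) {φ : ℕ → ℝ}
    (hφ : ∀ p, p.Prime → c.Coprime p → φ p ≤ 2 * Real.log p) (x : ℝ) (M : ℕ) :
    ∑ a ∈ Finset.Icc 2 M, ∑ p ∈ primesNormLE c x, φ p * (B / ((p : ℝ) / c)) ^ a ≤
      ∑' z, properPowerWeight c B z := by
  have hB0 := hB.1
  rw [← Finset.sum_product']
  refine le_trans (Finset.sum_le_sum fun z hz => ?_)
    ((summable_properPowerWeight hB).sum_le_tsum _ fun z _ => properPowerWeight_nonneg hB.1.le z)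
  rw [Finset.mem_product, Finset.mem_Icc] at hz
  obtain ⟨hp, hcp⟩ := mem_primesNormLE_prime hz.2
  rw [properPowerWeight, if_pos ⟨hz.1.1, hp, hcp⟩]
  exact mul_le_mul_of_nonneg_right (hφ _ hp hcp) (by positivity)

lemma sum_proper_harmSum_le (hc : c = 1 ∨ c = 2) {B : ℝ} (hB : BelowPrimes c B) {φ : ℕ → ℝ}
    (hφ0 : ∀ p, p.Prime → c.Coprime p → 0 ≤ φ p)
    (hφ : ∀ p, p.Prime → c.Coprime p → φ p ≤ 2 * Real.log p) (hw : ∀ i, 0 ≤ w i) {x : ℝ}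
    (hx : 0 ≤ x) (h : ShiftRatioLE c B w x) (M : ℕ) :
    ∑ a ∈ Finset.Icc 2 M, ∑ p ∈ primesNormLE c x,
        φ p * ((((p : ℝ) / c) ^ a)⁻¹ * harmSum c (shiftWeight w a) (x / ((p : ℝ) / c) ^ a)) ≤
      (∑' z, properPowerWeight c B z) * harmSum c w x := by
  refine le_trans ?_ (mul_le_mul_of_nonneg_right (sum_proper_le_tsum hB hφ x M)
    (harmSum_nonneg hc hw x))
  rw [Finset.sum_mul]
  refine Finset.sum_le_sum fun a _ => ?_
  rw [Finset.sum_mul]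
  refine Finset.sum_le_sum fun p hp => ?_
  obtain ⟨hpp, hcp⟩ := mem_primesNormLE_prime hp
  have hq := three_halves_le_prime_div hc hpp hcp
  have hq0 : 0 < (p : ℝ) / c := by linarith
  rw [mul_assoc, div_pow B, div_eq_inv_mul (B ^ a), mul_assoc _ (B ^ a)]
  refine mul_le_mul_of_nonneg_left (mul_le_mul_of_nonneg_left ?_ (by positivity)) (hφ0 p hpp hcp)
  exact (harmSum_mono hc (shiftWeight_nonneg hw a)
    (div_le_self hx (one_le_pow₀ (by linarith)))).trans (h.harmSum_le hB.1.le a)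

end

section

variable {c : ℕ} {w : ℕ → ℝ}

lemma log_mul_harmSum_sub_le (hc : c = 1 ∨ c = 2) {B : ℝ} (hB : BelowPrimes c B) :
    ∃ K, 0 ≤ K ∧ ∀ w : ℕ → ℝ, (∀ i, 0 ≤ w i) → ∀ x' x : ℝ, 1 ≤ x' → x' ≤ x →
      ShiftRatioLE c B w x →
      Real.log x' * (harmSum c w x - harmSum c w x') ≤
        (c * B * Real.log (x / x') + K) * harmSum c w x := by
  obtain ⟨K, hK0, hK⟩ := sum_log_div_primesNormLE_le hc
  have hB0 := hB.1
  have hT : 0 ≤ ∑' z, properPowerWeight c B z :=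
    tsum_nonneg fun z => properPowerWeight_nonneg hB0.le z
  refine ⟨K * B + ∑' z, properPowerWeight c B z, by positivity, ?_⟩
  intro w hw x' x hx' hxx h
  have hx'0 : 0 < x' := by linarith
  have hx0 : 0 < x := by linarith
  have hlx' : 0 ≤ Real.log x' := Real.log_nonneg hx'
  set u : ℕ → ℝ := fun m => if x' < scaledNorm c m then w (cardFactors m) / scaledNorm c m else 0
    with hu
  have hwN : ∀ m, m ∈ normLE c x → 0 ≤ w (cardFactors m) / scaledNorm c m := fun m hm =>
    div_nonneg (hw _) (normLE_facts hc hm).1.le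
  have h1 : harmSum c w x - harmSum c w x' = ∑ m ∈ normLE c x, u m := by
    rw [harmSum, harmSum, ← Finset.sum_sdiff (normLE_mono hc hxx), add_sub_cancel_right,
      hu, ← Finset.sum_filter]
    refine Finset.sum_congr ?_ fun _ _ => rfl
    ext m
    simp only [Finset.mem_sdiff, Finset.mem_filter, mem_normLE hc, ← not_le]
    tauto
  have h2 : Real.log x' * ∑ m ∈ normLE c x, u m ≤ ∑ m ∈ normLE c x, u m *
      (m.factorization.sum fun p v => (v : ℝ) * Real.log ((p : ℝ) / c)) := by
    rw [Finset.mul_sum]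
    refine Finset.sum_le_sum fun m hm => ?_
    rw [← log_scaledNorm hc ((mem_normLE hc).1 hm).1, mul_comm]
    simp only [hu]
    split_ifs with h3
    · exact mul_le_mul_of_nonneg_left (Real.log_le_log hx'0 h3.le) (hwN m hm)
    · simp
  rw [h1]
  refine h2.trans ?_
  rw [sum_mul_factorization_sum hc x u]
  have hl0 : ∀ p, p.Prime → c.Coprime p → 0 ≤ Real.log ((p : ℝ) / c) := fun p hp hcp =>
    log_nonneg_of_mem_primesNormLE hc hp hcp
  have hu0 : ∀ p a : ℕ, ∀ m ∈ normLE c (x / ((p : ℝ) / c) ^ a), p.Prime → 0 ≤ u (p ^ a * m) := by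
    intro p a m hm hp
    simp only [hu]
    split_ifs
    · exact div_nonneg (hw _) (scaledNorm_pos hc (mul_ne_zero (pow_ne_zero _ hp.ne_zero)
        ((mem_normLE hc).1 hm).1)).le
    · exact le_rfl
  have husplit : ∀ p a : ℕ, ∀ m ∈ normLE c (x / ((p : ℝ) / c) ^ a), p.Prime →
      u (p ^ a * m) = if x' < ((p : ℝ) / c) ^ a * scaledNorm c m then
        (((p : ℝ) / c) ^ a)⁻¹ * (shiftWeight w a (cardFactors m) / scaledNorm c m) else 0 := by
    intro p a m hm hp
    have hm0 := ((mem_normLE hc).1 hm).1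
    have hpa : p ^ a ≠ 0 := pow_ne_zero _ hp.ne_zero
    simp only [hu]
    rw [cardFactors_mul hpa hm0, cardFactors_apply_prime_pow hp, scaledNorm_mul c hpa hm0,
      scaledNorm_prime_pow c hp, shiftWeight, add_comm a]
    congr 1
    rw [div_eq_mul_inv, mul_inv, div_eq_mul_inv]
    ring
  refine (sum_Icc_one_le _ (fun a => Finset.sum_nonneg fun p hp => ?_) _).trans ?_
  · obtain ⟨hpp, hcp⟩ := mem_primesNormLE_prime hp
    exact mul_nonneg (hl0 p hpp hcp) (Finset.sum_nonneg fun m hm => hu0 p a m hm hpp)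
  have hfirst : ∑ p ∈ primesNormLE c x, Real.log ((p : ℝ) / c) *
      ∑ m ∈ normLE c (x / ((p : ℝ) / c) ^ 1), u (p ^ 1 * m) ≤
      (c * Real.log (x / x') + K) * (B * harmSum c w x) := by
    have e1 : ∑ p ∈ primesNormLE c x, Real.log ((p : ℝ) / c) *
        ∑ m ∈ normLE c (x / ((p : ℝ) / c) ^ 1), u (p ^ 1 * m) =
        ∑ p ∈ primesNormLE c x, ∑ m ∈ normLE c (x / ((p : ℝ) / c)),
          if x' / scaledNorm c m < (p : ℝ) / c then Real.log ((p : ℝ) / c) / ((p : ℝ) / c) *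
            (shiftWeight w 1 (cardFactors m) / scaledNorm c m) else 0 := by
      refine Finset.sum_congr rfl fun p hp => ?_
      rw [Finset.mul_sum, pow_one ((p : ℝ) / c)]
      refine Finset.sum_congr rfl fun m hm => ?_
      have hN := (normLE_facts hc hm).1
      rw [husplit p 1 m (by rwa [pow_one]) (mem_primesNormLE_prime hp).1, pow_one]
      simp only [div_lt_iff₀ hN]
      split_ifs
      · ring
      · simp
    rw [e1, sum_primesNormLE_sum_normLE_comm hc hx0.le]
    have hV := h 0
    rw [shiftWeight_zero] at hV
    have hcl : 0 ≤ c * Real.log (x / x') + K := by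
      have := Real.log_nonneg ((one_le_div hx'0).2 hxx)
      positivity
    refine le_trans ?_ (mul_le_mul_of_nonneg_left hV hcl)
    rw [harmSum, Finset.mul_sum]
    refine Finset.sum_le_sum fun m hm => ?_
    have hN := (normLE_facts hc hm).1
    rw [← Finset.sum_filter, ← Finset.sum_mul]
    refine mul_le_mul_of_nonneg_right ?_ (div_nonneg (hw _) hN.le)
    refine (hK (x' / scaledNorm c m) (x / scaledNorm c m) (by positivity) (by gcongr)).trans ?_
    rw [div_div_div_cancel_right₀ hN.ne']
  have hrest : ∑ a ∈ Finset.Icc 2 ⌊2 * x⌋₊, ∑ p ∈ primesNormLE c x, Real.log ((p : ℝ) / c) *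
      ∑ m ∈ normLE c (x / ((p : ℝ) / c) ^ a), u (p ^ a * m) ≤
      (∑' z, properPowerWeight c B z) * harmSum c w x := by
    refine le_trans ?_ (sum_proper_harmSum_le hc hB hl0 (fun p hp _ => log_prime_div_le hc hp)
      hw hx0.le h ⌊2 * x⌋₊)
    refine Finset.sum_le_sum fun a _ => Finset.sum_le_sum fun p hp => ?_
    obtain ⟨hpp, hcp⟩ := mem_primesNormLE_prime hp
    refine mul_le_mul_of_nonneg_left ?_ (hl0 p hpp hcp)
    rw [harmSum, Finset.mul_sum]
    refine Finset.sum_le_sum fun m hm => ?_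
    have hN := (normLE_facts hc hm).1
    rw [husplit p a m hm hpp]
    split_ifs
    · exact le_rfl
    · exact mul_nonneg (by positivity) (div_nonneg (hw _) hN.le)
  nlinarith [hfirst, hrest]

lemma cardFactors_eq_factorization_sum (m : ℕ) :
    (cardFactors m : ℝ) = m.factorization.sum fun _ v => (v : ℝ) * 1 := by
  rw [ArithmeticFunction.cardFactors_eq_sum_factorization, Finsupp.sum, Finsupp.sum]
  push_cast
  simp

lemma sum_cardFactors_le (hc : c = 1 ∨ c = 2) {B : ℝ} (hB : BelowPrimes c B) :
    ∃ K, 0 ≤ K ∧ ∀ w : ℕ → ℝ, (∀ i, 0 ≤ w i) → ∀ x : ℝ, 3 ≤ x → ShiftRatioLE c B w x →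
      ∑ m ∈ normLE c x, w (cardFactors m) / scaledNorm c m * cardFactors m ≤
        (c * Real.log (Real.log x) + K) * harmSum c (shiftWeight w 1) x + K * harmSum c w x := by
  obtain ⟨K, hK0, hK⟩ := sum_inv_primesNormLE_le hc
  have hB0 := hB.1
  have hT : 0 ≤ ∑' z, properPowerWeight c B z :=
    tsum_nonneg fun z => properPowerWeight_nonneg hB0.le z
  refine ⟨K + ∑' z, properPowerWeight c B z, by positivity, ?_⟩
  intro w hw x hx h
  have hx0 : 0 ≤ x := by linarith
  simp_rw [cardFactors_eq_factorization_sum]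
  rw [sum_weight_div_mul_factorization_sum hc x w (fun _ => 1)]
  have hV := harmSum_nonneg hc hw x
  have hV1 := harmSum_nonneg hc (shiftWeight_nonneg hw 1) x
  refine (sum_Icc_one_le _ (fun a => Finset.sum_nonneg fun p hp => ?_) _).trans ?_
  · have := harmSum_nonneg hc (shiftWeight_nonneg hw a) (x / ((p : ℝ) / c) ^ a)
    positivity
  have hrest := sum_proper_harmSum_le hc hB (φ := fun _ => 1) (fun _ _ _ => zero_le_one)
    (fun p hp _ => one_le_two_mul_log_prime hp) hw hx0 h ⌊2 * x⌋₊
  have hfirst : ∑ p ∈ primesNormLE c x, 1 * ((((p : ℝ) / c) ^ 1)⁻¹ *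
      harmSum c (shiftWeight w 1) (x / ((p : ℝ) / c) ^ 1)) ≤
      (c * Real.log (Real.log x) + K) * harmSum c (shiftWeight w 1) x := by
    refine le_trans ?_ (mul_le_mul_of_nonneg_right (hK x hx) hV1)
    rw [Finset.sum_mul]
    refine Finset.sum_le_sum fun p hp => ?_
    obtain ⟨hpp, hcp⟩ := mem_primesNormLE_prime hp
    have hq := three_halves_le_prime_div hc hpp hcp
    rw [one_mul, pow_one]
    exact mul_le_mul_of_nonneg_left (harmSum_mono hc (shiftWeight_nonneg hw 1)
      (div_le_self hx0 (by linarith))) (by positivity)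
  nlinarith [hfirst, hrest, mul_nonneg hT hV1, mul_nonneg hK0 hV]

lemma le_sum_cardFactors (hc : c = 1 ∨ c = 2) (hw : ∀ i, 0 ≤ w i) {x y : ℝ} (hy : 0 < y)
    (hyx : y ≤ x) (hx : 1 ≤ x) :
    (∑ p ∈ primesNormLE c y, ((p : ℝ) / c)⁻¹) * harmSum c (shiftWeight w 1) (x / y) ≤
      ∑ m ∈ normLE c x, w (cardFactors m) / scaledNorm c m * cardFactors m := by
  simp_rw [cardFactors_eq_factorization_sum]
  rw [sum_weight_div_mul_factorization_sum hc x w (fun _ => 1)]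
  have hM : 1 ≤ ⌊2 * x⌋₊ := Nat.le_floor (by push_cast; linarith)
  have hterm : ∀ (a p : ℕ), 0 ≤ 1 * ((((p : ℝ) / c) ^ a)⁻¹ *
      harmSum c (shiftWeight w a) (x / ((p : ℝ) / c) ^ a)) := fun a p => by
    have := harmSum_nonneg hc (shiftWeight_nonneg hw a) (x / ((p : ℝ) / c) ^ a)
    positivity
  refine le_trans ?_ (le_sum_Icc_one _ (fun a => Finset.sum_nonneg fun p _ => hterm a p) hM)
  have hsub : primesNormLE c y ⊆ primesNormLE c x := fun p hp => by
    rw [mem_primesNormLE hc (by linarith)] at hp ⊢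
    exact ⟨hp.1, hp.2.1, hp.2.2.trans hyx⟩
  refine le_trans ?_ (Finset.sum_le_sum_of_subset_of_nonneg hsub fun p _ _ => hterm 1 p)
  rw [Finset.sum_mul]
  refine Finset.sum_le_sum fun p hp => ?_
  obtain ⟨hpp, hcp, hpy⟩ := (mem_primesNormLE hc hy.le).1 hp
  have hq := three_halves_le_prime_div hc hpp hcp
  rw [one_mul, pow_one]
  refine mul_le_mul_of_nonneg_left (harmSum_mono hc (shiftWeight_nonneg hw 1) ?_) (by positivity)
  exact div_le_div_of_nonneg_left (by linarith) (by linarith) hpy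

lemma le_log_mul_cntSum (hc : c = 1 ∨ c = 2) {ε : ℝ} (hε : 0 < ε) :
    ∃ K, 1 ≤ K ∧ ∀ w : ℕ → ℝ, (∀ i, 0 ≤ w i) → ∀ x : ℝ, 1 ≤ x →
      (c - ε) * x * harmSum c (shiftWeight w 1) (x / K) ≤ Real.log x * cntSum c w x := by
  obtain ⟨K, hK1, hK⟩ := le_sum_log_primesNormLE hc hε
  refine ⟨K, hK1, fun w hw x hx => ?_⟩
  have hx0 : 0 < x := by linarith
  have hM : 1 ≤ ⌊2 * x⌋₊ := Nat.le_floor (by push_cast; linarith)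
  have h1 : ∑ m ∈ normLE c x, w (cardFactors m) *
      (m.factorization.sum fun p v => (v : ℝ) * Real.log ((p : ℝ) / c)) ≤
      Real.log x * cntSum c w x := by
    rw [cntSum, Finset.mul_sum]
    refine Finset.sum_le_sum fun m hm => ?_
    obtain ⟨hm0, -, hmx⟩ := (mem_normLE hc).1 hm
    rw [← log_scaledNorm hc hm0, mul_comm]
    exact mul_le_mul_of_nonneg_right (Real.log_le_log (scaledNorm_pos hc hm0) hmx) (hw _)
  refine le_trans ?_ h1
  rw [sum_weight_mul_factorization_sum hc]
  refine le_trans ?_ (le_sum_Icc_one _ (fun a => Finset.sum_nonneg fun p hp => ?_) hM)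
  swap
  · obtain ⟨hpp, hcp⟩ := mem_primesNormLE_prime hp
    exact mul_nonneg (log_nonneg_of_mem_primesNormLE hc hpp hcp)
      (cntSum_nonneg (shiftWeight_nonneg hw a) _)
  simp only [pow_one, cntSum, Finset.mul_sum]
  rw [sum_primesNormLE_sum_normLE_comm hc hx0.le]
  have hxK : x / K ≤ x := div_le_self hx0.le hK1
  refine le_trans ?_ (Finset.sum_le_sum_of_subset_of_nonneg (normLE_mono hc hxK)
    fun m _ _ => Finset.sum_nonneg fun p hp => ?_)
  swap
  · obtain ⟨hpp, hcp⟩ := mem_primesNormLE_prime hp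
    exact mul_nonneg (log_nonneg_of_mem_primesNormLE hc hpp hcp) (shiftWeight_nonneg hw _ _)
  rw [harmSum, Finset.mul_sum]
  refine Finset.sum_le_sum fun m hm => ?_
  obtain ⟨hm0, -, hmx⟩ := (mem_normLE hc).1 hm
  have hN := scaledNorm_pos hc hm0
  rw [← Finset.sum_mul]
  have h2 : K ≤ x / scaledNorm c m := by
    rw [le_div_iff₀ hN, mul_comm]
    exact (le_div_iff₀ (by linarith)).1 hmx
  refine le_trans (le_of_eq ?_) (mul_le_mul_of_nonneg_right (hK _ h2)
    (shiftWeight_nonneg hw 1 (cardFactors m)))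
  ring

end

section

variable {c : ℕ} {w : ℕ → ℝ}

lemma cntSum_mul_log_eq (hc : c = 1 ∨ c = 2) {x : ℝ} (hx : 0 < x) (w : ℕ → ℝ) :
    cntSum c w x * Real.log x =
      ∑ m ∈ normLE c x, w (cardFactors m) * Real.log (x / scaledNorm c m) +
      ∑ a ∈ Finset.Icc 1 ⌊2 * x⌋₊, ∑ p ∈ primesNormLE c x,
        Real.log ((p : ℝ) / c) * cntSum c (shiftWeight w a) (x / ((p : ℝ) / c) ^ a) := by
  rw [← sum_weight_mul_factorization_sum hc, ← Finset.sum_add_distrib, cntSum, Finset.sum_mul]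
  refine Finset.sum_congr rfl fun m hm => ?_
  obtain ⟨hm0, -, -⟩ := (mem_normLE hc).1 hm
  rw [← log_scaledNorm hc hm0, Real.log_div hx.ne' (scaledNorm_pos hc hm0).ne']
  ring

lemma sum_log_mul_cntSum_le (hc : c = 1 ∨ c = 2) {ε : ℝ} (hε : 0 < ε) :
    ∃ K, 0 ≤ K ∧ ∀ w : ℕ → ℝ, (∀ i, 0 ≤ w i) → ∀ x : ℝ, 0 ≤ x →
      ∑ p ∈ primesNormLE c x, Real.log ((p : ℝ) / c) * cntSum c w (x / ((p : ℝ) / c) ^ 1) ≤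
        (c + ε) * x * harmSum c w x + K * cntSum c w x := by
  obtain ⟨K, hK0, hK⟩ := sum_log_primesNormLE_le hc hε
  refine ⟨K, hK0, fun w hw x hx => ?_⟩
  simp only [pow_one, cntSum, Finset.mul_sum]
  rw [sum_primesNormLE_sum_normLE_comm hc hx, harmSum, Finset.mul_sum, ← Finset.sum_add_distrib]
  refine Finset.sum_le_sum fun m hm => ?_
  have hN := (normLE_facts hc hm).1
  rw [← Finset.sum_mul]
  refine (mul_le_mul_of_nonneg_right (hK _ (div_nonneg hx hN.le))
    (hw (cardFactors m))).trans (le_of_eq ?_)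
  ring

lemma cntSum_mul_log_le (hc : c = 1 ∨ c = 2) {B : ℝ} (hB : BelowPrimes c B) :
    ∃ C, 0 ≤ C ∧ ∀ w : ℕ → ℝ, (∀ i, 0 ≤ w i) → ∀ x : ℝ, 1 ≤ x → ShiftRatioLE c B w x →
      cntSum c w x * Real.log x ≤ C * x * harmSum c w x := by
  obtain ⟨K, hK0, hK⟩ := sum_log_mul_cntSum_le hc (zero_lt_one)
  have hB0 := hB.1
  have hT : 0 ≤ ∑' z, properPowerWeight c B z :=
    tsum_nonneg fun z => properPowerWeight_nonneg hB0.le z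
  refine ⟨1 + (c + 1 + K) * B + ∑' z, properPowerWeight c B z, by positivity, ?_⟩
  intro w hw x hx h
  have hx0 : 0 < x := by linarith
  have hl0 : ∀ p, p.Prime → c.Coprime p → 0 ≤ Real.log ((p : ℝ) / c) := fun p hp hcp =>
    log_nonneg_of_mem_primesNormLE hc hp hcp
  rw [cntSum_mul_log_eq hc hx0]
  have h1 : ∑ m ∈ normLE c x, w (cardFactors m) * Real.log (x / scaledNorm c m) ≤
      x * harmSum c w x := by
    rw [harmSum, Finset.mul_sum]
    refine Finset.sum_le_sum fun m hm => ?_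
    have hN := (normLE_facts hc hm).1
    have h2 : Real.log (x / scaledNorm c m) ≤ x / scaledNorm c m := by
      have := Real.log_le_sub_one_of_pos (show 0 < x / scaledNorm c m by positivity)
      linarith
    refine (mul_le_mul_of_nonneg_left h2 (hw _)).trans (le_of_eq ?_)
    ring
  have h2 := sum_Icc_one_le (fun a => ∑ p ∈ primesNormLE c x,
    Real.log ((p : ℝ) / c) * cntSum c (shiftWeight w a) (x / ((p : ℝ) / c) ^ a))
    (fun a => Finset.sum_nonneg fun p hp => mul_nonneg
      (hl0 p (mem_primesNormLE_prime hp).1 (mem_primesNormLE_prime hp).2)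
      (cntSum_nonneg (shiftWeight_nonneg hw a) _)) ⌊2 * x⌋₊
  have h3 := hK _ (shiftWeight_nonneg hw 1) x hx0.le
  have h4 := cntSum_le_mul_harmSum hc (shiftWeight_nonneg hw 1) x
  have h5 := h 0
  rw [shiftWeight_zero, zero_add] at h5
  have h6 := sum_proper_harmSum_le hc hB hl0 (fun p hp _ => log_prime_div_le hc hp)
      hw hx0.le h ⌊2 * x⌋₊
  have h7 : ∑ a ∈ Finset.Icc 2 ⌊2 * x⌋₊, ∑ p ∈ primesNormLE c x,
      Real.log ((p : ℝ) / c) * cntSum c (shiftWeight w a) (x / ((p : ℝ) / c) ^ a) ≤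
      x * ((∑' z, properPowerWeight c B z) * harmSum c w x) := by
    refine le_trans ?_ (mul_le_mul_of_nonneg_left h6 hx0.le)
    rw [Finset.mul_sum]
    refine Finset.sum_le_sum fun a _ => ?_
    rw [Finset.mul_sum]
    refine Finset.sum_le_sum fun p hp => ?_
    refine (mul_le_mul_of_nonneg_left (cntSum_le_mul_harmSum hc (shiftWeight_nonneg hw a) _)
      (hl0 p (mem_primesNormLE_prime hp).1 (mem_primesNormLE_prime hp).2)).trans (le_of_eq ?_)
    rw [div_eq_mul_inv x]
    ring
  have hcK : 0 ≤ ((c : ℝ) + 1 + K) * x := by positivity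
  have h8 := mul_le_mul_of_nonneg_left h5 hcK
  have h9 := mul_le_mul_of_nonneg_left h4 hK0
  nlinarith [h1, h2, h3, h7, h8, h9]

lemma exists_log_le_mul_add {ε : ℝ} (hε : 0 < ε) :
    ∃ C, 0 ≤ C ∧ ∀ t : ℝ, 0 < t → Real.log t ≤ ε * t + C := by
  refine ⟨|Real.log ε|, abs_nonneg _, fun t ht => ?_⟩
  have h1 := Real.log_le_sub_one_of_pos (mul_pos hε ht)
  rw [Real.log_mul hε.ne' ht.ne'] at h1
  linarith [neg_abs_le (Real.log ε)]

lemma cntSum_mul_log_le_add (hc : c = 1 ∨ c = 2) {B : ℝ} (hB : BelowPrimes c B) {A ε : ℝ}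
    (hA : 0 ≤ A) (hε : 0 < ε) :
    ∃ M, 0 ≤ M ∧ ∀ w : ℕ → ℝ, (∀ i, 0 ≤ w i) → ∀ x : ℝ, 2 ≤ x → ShiftRatioLE c B w x →
      harmSum c w x ≤ A * harmSum c (shiftWeight w 1) x →
      cntSum c w x * Real.log x ≤
        (c + ε + 2 * ε * A + M / Real.log x) * (x * harmSum c (shiftWeight w 1) x) := by
  obtain ⟨K, hK0, hK⟩ := sum_log_mul_cntSum_le hc hε
  obtain ⟨C, hC0, hC⟩ := cntSum_mul_log_le hc hB
  obtain ⟨E, hE0, hE⟩ := exists_log_le_mul_add hε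
  have hB0 := hB.1
  obtain ⟨s, hs⟩ := (summable_iff_vanishing_norm.1 (summable_properPowerWeight hB)) ε hε
  set S : ℝ := ∑ z ∈ s, properPowerWeight c B z * max 1 (|(z.2 : ℝ) / c| ^ z.1) with hS
  have hS0 : 0 ≤ S := Finset.sum_nonneg fun z _ =>
    mul_nonneg (properPowerWeight_nonneg hB0.le z) (by positivity)
  refine ⟨E * C * A + K * C + S * C * A, by positivity, ?_⟩
  intro w hw x hx h hVA
  have hx0 : 0 < x := by linarith
  have hlx : 0 < Real.log x := Real.log_pos (by linarith)
  have hl0 : ∀ p, p.Prime → c.Coprime p → 0 ≤ Real.log ((p : ℝ) / c) := fun p hp hcp =>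
    log_nonneg_of_mem_primesNormLE hc hp hcp
  set W := harmSum c (shiftWeight w 1) x with hW
  have hW0 : 0 ≤ W := harmSum_nonneg hc (shiftWeight_nonneg hw 1) x
  have hV0 : 0 ≤ harmSum c w x := harmSum_nonneg hc hw x
  have hcnt : ∀ a, cntSum c (shiftWeight w a) x ≤
      C * x * (B ^ a * harmSum c w x) / Real.log x := fun a => by
    rw [le_div_iff₀ hlx]
    exact (hC _ (shiftWeight_nonneg hw a) x (by linarith) (h.shift a)).trans
      (mul_le_mul_of_nonneg_left (h.harmSum_le hB0.le a) (by positivity))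
  rw [cntSum_mul_log_eq hc hx0]
  have h1 : ∑ m ∈ normLE c x, w (cardFactors m) * Real.log (x / scaledNorm c m) ≤
      ε * (x * harmSum c w x) + E * cntSum c w x := by
    rw [harmSum, Finset.mul_sum, Finset.mul_sum, cntSum, Finset.mul_sum, ← Finset.sum_add_distrib]
    refine Finset.sum_le_sum fun m hm => ?_
    have hN := (normLE_facts hc hm).1
    refine (mul_le_mul_of_nonneg_left (hE (x / scaledNorm c m) (by positivity))
      (hw _)).trans (le_of_eq ?_)
    ring
  have h2 := sum_Icc_one_le (fun a => ∑ p ∈ primesNormLE c x,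
    Real.log ((p : ℝ) / c) * cntSum c (shiftWeight w a) (x / ((p : ℝ) / c) ^ a))
    (fun a => Finset.sum_nonneg fun p hp => mul_nonneg
      (hl0 p (mem_primesNormLE_prime hp).1 (mem_primesNormLE_prime hp).2)
      (cntSum_nonneg (shiftWeight_nonneg hw a) _)) ⌊2 * x⌋₊
  have h3 := hK _ (shiftWeight_nonneg hw 1) x hx0.le
  have h4 : cntSum c (shiftWeight w 1) x ≤ C * x * W / Real.log x := by
    rw [le_div_iff₀ hlx]
    exact hC _ (shiftWeight_nonneg hw 1) x (by linarith) (h.shift 1)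
  have h5 : cntSum c w x ≤ C * x * (A * W) / Real.log x := by
    have := hcnt 0
    rw [shiftWeight_zero, pow_zero, one_mul] at this
    refine this.trans ?_
    gcongr
  have h7 : ∑ a ∈ Finset.Icc 2 ⌊2 * x⌋₊, ∑ p ∈ primesNormLE c x,
      Real.log ((p : ℝ) / c) * cntSum c (shiftWeight w a) (x / ((p : ℝ) / c) ^ a) ≤
      ε * (x * harmSum c w x) + S * (C * x * harmSum c w x / Real.log x) := by
    rw [← Finset.sum_product']
    set P := Finset.Icc 2 ⌊2 * x⌋₊ ×ˢ primesNormLE c x with hP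
    have hfacts : ∀ z ∈ P, 0 < (z.2 : ℝ) / c ∧ 1 ≤ ((z.2 : ℝ) / c) ^ z.1 ∧
        properPowerWeight c B z = 2 * Real.log z.2 * (B / ((z.2 : ℝ) / c)) ^ z.1 ∧
        0 ≤ Real.log ((z.2 : ℝ) / c) ∧ Real.log ((z.2 : ℝ) / c) ≤ 2 * Real.log z.2 := by
      intro z hz
      rw [hP, Finset.mem_product, Finset.mem_Icc] at hz
      obtain ⟨hp, hcp⟩ := mem_primesNormLE_prime hz.2
      have hq := three_halves_le_prime_div hc hp hcp
      refine ⟨by linarith, one_le_pow₀ (by linarith), ?_, hl0 _ hp hcp, log_prime_div_le hc hp⟩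
      rw [properPowerWeight, if_pos ⟨hz.1.1, hp, hcp⟩]
    rw [← Finset.sum_filter_add_sum_filter_not P (fun z => z ∉ s)]
    refine add_le_add ?_ ?_
    · have h8 : ∑ z ∈ P with z ∉ s, properPowerWeight c B z ≤ ε := by
        have := hs (P.filter fun z => z ∉ s) (Finset.disjoint_left.2 fun z hz =>
          (Finset.mem_filter.1 hz).2)
        exact (le_abs_self _).trans this.le
      refine le_trans ?_ (mul_le_mul_of_nonneg_right h8 (by positivity))
      rw [Finset.sum_mul]
      refine Finset.sum_le_sum fun z hz => ?_
      obtain ⟨hq0, hq1, he, hl, hl2⟩ := hfacts z (Finset.mem_filter.1 hz).1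
      have h9 : cntSum c (shiftWeight w z.1) (x / ((z.2 : ℝ) / c) ^ z.1) ≤
          (B / ((z.2 : ℝ) / c)) ^ z.1 * (x * harmSum c w x) := by
        refine (cntSum_le_mul_harmSum hc (shiftWeight_nonneg hw _) _).trans ?_
        refine (mul_le_mul_of_nonneg_left ((harmSum_mono hc (shiftWeight_nonneg hw z.1)
          (div_le_self hx0.le hq1)).trans (h.harmSum_le hB0.le z.1)) (by positivity)).trans
          (le_of_eq ?_)
        rw [div_pow B]
        ring
      rw [he, mul_assoc]
      exact mul_le_mul hl2 h9 (cntSum_nonneg (shiftWeight_nonneg hw _) _) (by linarith)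
    · have hR : 0 ≤ C * x * harmSum c w x / Real.log x := by positivity
      calc _ ≤ ∑ z ∈ P.filter (fun z => ¬ z ∉ s),
          properPowerWeight c B z * max 1 (|(z.2 : ℝ) / c| ^ z.1) *
            (C * x * harmSum c w x / Real.log x) := by
            refine Finset.sum_le_sum fun z hz => ?_
            obtain ⟨hq0, hq1, he, hl, hl2⟩ := hfacts z (Finset.mem_filter.1 hz).1
            rw [he, abs_of_pos hq0, max_eq_right hq1]
            have h9 : cntSum c (shiftWeight w z.1) (x / ((z.2 : ℝ) / c) ^ z.1) ≤
                B ^ z.1 * (C * x * harmSum c w x / Real.log x) :=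
              (cntSum_mono hc (shiftWeight_nonneg hw _) (div_le_self hx0.le hq1)).trans
                ((hcnt z.1).trans (le_of_eq (by ring)))
            have e : 2 * Real.log (z.2 : ℝ) * (B / ((z.2 : ℝ) / c)) ^ z.1 *
                ((z.2 : ℝ) / c) ^ z.1 * (C * x * harmSum c w x / Real.log x) =
                2 * Real.log (z.2 : ℝ) * (B ^ z.1 * (C * x * harmSum c w x / Real.log x)) := by
              rw [mul_assoc (2 * Real.log (z.2 : ℝ)), ← mul_pow, div_mul_cancel₀ _ hq0.ne']
              ring
            rw [e]
            exact mul_le_mul hl2 h9 (cntSum_nonneg (shiftWeight_nonneg hw _) _) (by linarith)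
        _ ≤ _ := by
            rw [← Finset.sum_mul]
            refine mul_le_mul_of_nonneg_right ?_ hR
            refine Finset.sum_le_sum_of_subset_of_nonneg (fun z hz => ?_) fun z _ _ =>
              mul_nonneg (properPowerWeight_nonneg hB0.le z) (by positivity)
            exact not_not.1 (Finset.mem_filter.1 hz).2
  have hxV : x * harmSum c w x ≤ A * (x * W) := by nlinarith
  have e1 : ε * (x * harmSum c w x) ≤ ε * (A * (x * W)) := mul_le_mul_of_nonneg_left hxV hε.le
  have e2 : E * cntSum c w x ≤ E * (C * x * (A * W) / Real.log x) :=
    mul_le_mul_of_nonneg_left h5 hE0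
  have e3 : K * cntSum c (shiftWeight w 1) x ≤ K * (C * x * W / Real.log x) :=
    mul_le_mul_of_nonneg_left h4 hK0
  have e4 : S * (C * x * harmSum c w x / Real.log x) ≤ S * (C * (A * (x * W)) / Real.log x) := by
    rw [mul_assoc C]
    gcongr
  have e5 : (c + ε + 2 * ε * A + (E * C * A + K * C + S * C * A) / Real.log x) * (x * W) =
      (c + ε) * x * W + ε * (A * (x * W)) + ε * (A * (x * W)) +
      E * (C * x * (A * W) / Real.log x) + K * (C * x * W / Real.log x) +
      S * (C * (A * (x * W)) / Real.log x) := by ring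
  rw [e5]
  linarith

lemma cntSum_mul_log_le_of_shiftRatioLE (hc : c = 1 ∨ c = 2) {B : ℝ} (hB : BelowPrimes c B)
    {A ε : ℝ} (hA : 0 ≤ A) (hε : 0 < ε) :
    ∃ x₀, 2 ≤ x₀ ∧ ∀ w : ℕ → ℝ, (∀ i, 0 ≤ w i) → ∀ x : ℝ, x₀ ≤ x → ShiftRatioLE c B w x →
      harmSum c w x ≤ A * harmSum c (shiftWeight w 1) x →
      cntSum c w x * Real.log x ≤ (c + ε) * (x * harmSum c (shiftWeight w 1) x) := by
  have hδ : 0 < ε / (2 * (1 + 2 * A)) := by positivity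
  obtain ⟨M, hM0, hM⟩ := cntSum_mul_log_le_add hc hB hA hδ
  have h1 : Tendsto (fun y : ℝ => M / Real.log y) atTop (𝓝 0) :=
    Real.tendsto_log_atTop.const_div_atTop _
  obtain ⟨Y, hY⟩ := (h1.eventually_lt_const (half_pos hε)).exists_forall_of_atTop
  refine ⟨max 2 Y, le_max_left _ _, fun w hw x hx h hVA => ?_⟩
  have h2 : 2 ≤ x := (le_max_left _ _).trans hx
  refine (hM w hw x h2 h hVA).trans (mul_le_mul_of_nonneg_right ?_
    (mul_nonneg (by linarith) (harmSum_nonneg hc (shiftWeight_nonneg hw 1) x)))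
  have h3 := hY x ((le_max_right _ _).trans hx)
  have h4 : ε / (2 * (1 + 2 * A)) + 2 * (ε / (2 * (1 + 2 * A))) * A = ε / 2 := by
    field_simp
  linarith

end

lemma exists_div_rpow_mul_le {κ κ' K : ℝ} (hκ : 0 ≤ κ) (hκκ : κ < κ') (hK : 0 ≤ K) :
    ∃ D U : ℝ, 0 < D ∧ 0 < U ∧ ∀ V : ℝ → ℝ, (∀ u, 0 ≤ V u) → Monotone V →
      ∀ lo hi : ℝ, U ≤ lo →
        (∀ u' u, lo ≤ u' → u' ≤ u → u ≤ hi → u' * (V u - V u') ≤ (κ * (u - u') + K) * V u) →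
        ∀ u, lo + D ≤ u → u ≤ hi → ((u - D) / hi) ^ κ' * V hi ≤ V u := by
  have hd : 0 < κ' - κ := by linarith
  have hκ'0 : 0 < κ' := by linarith
  set D : ℝ := K / (κ' - κ) + 1 with hD
  have hD0 : 0 < D := by positivity
  have hDK : κ' * D - κ * D - K = κ' - κ := by rw [hD]; field_simp; ring
  set U : ℝ := (κ' * D * D + (κ * D + K) * (κ' * D)) / (κ' - κ) + 1 with hU
  have hU0 : 0 < U := by positivity
  refine ⟨D, U, hD0, hU0, fun V hV0 hVm lo hi hlo h u hu huhi => ?_⟩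
  have hstep : ∀ t, lo + D ≤ t → t ≤ hi → ((t - D) / t) ^ κ' * V t ≤ V (t - D) := by
    intro t ht hthi
    have h1 := h (t - D) t (by linarith) (by linarith) hthi
    have htD : 0 < t - D := by linarith
    have ht0 : 0 < t := by linarith
    have h2 : ((t - D) / t) ^ κ' ≤ 1 / (1 + κ' * D / t) := by
      have h3 : (t - D) / t ≤ Real.exp (-(D / t)) := by
        have := Real.one_sub_le_exp_neg (D / t)
        rwa [sub_div, div_self ht0.ne']
      calc ((t - D) / t) ^ κ' ≤ (Real.exp (-(D / t))) ^ κ' :=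
            Real.rpow_le_rpow (by positivity) h3 hκ'0.le
        _ = Real.exp (-(κ' * D / t)) := by rw [← Real.exp_mul]; congr 1; ring
        _ ≤ _ := by
            rw [Real.exp_neg, ← one_div]
            refine one_div_le_one_div_of_le (by positivity) ?_
            have := Real.add_one_le_exp (κ' * D / t)
            linarith
    have hUt : U ≤ t - D := by linarith
    have hUe : (κ' - κ) * U = κ' * D * D + (κ * D + K) * (κ' * D) + (κ' - κ) := by
      rw [hU]; field_simp
    have h4 : 1 / (1 + κ' * D / t) * (t - D) ≤ (t - D) - (κ * D + K) := by
      have e : 1 / (1 + κ' * D / t) = t / (t + κ' * D) := by field_simp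
      rw [e, div_mul_eq_mul_div, div_le_iff₀ (by positivity)]
      nlinarith [mul_le_mul_of_nonneg_left hUt hd.le, mul_pos hd hD0]
    have h5 : (t - D) * (((t - D) / t) ^ κ' * V t) ≤ (t - D) * V (t - D) := by
      calc (t - D) * (((t - D) / t) ^ κ' * V t) = ((t - D) / t) ^ κ' * (t - D) * V t := by ring
        _ ≤ 1 / (1 + κ' * D / t) * (t - D) * V t :=
          mul_le_mul_of_nonneg_right (mul_le_mul_of_nonneg_right h2 htD.le) (hV0 t)
        _ ≤ ((t - D) - (κ * D + K)) * V t := mul_le_mul_of_nonneg_right h4 (hV0 t)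
        _ ≤ _ := by rw [sub_sub_cancel] at h1; linarith
    exact le_of_mul_le_mul_left h5 htD
  set N := ⌈(hi - u) / D⌉₊ with hN
  have hhi : 0 < hi := by linarith
  have hN1 : hi - N * D ≤ u := by
    have := Nat.le_ceil ((hi - u) / D)
    rw [div_le_iff₀ hD0] at this
    linarith
  have hN2 : u - D ≤ hi - N * D := by
    have := Nat.ceil_lt_add_one (show 0 ≤ (hi - u) / D from div_nonneg (by linarith) hD0.le)
    have h2 : (N : ℝ) * D ≤ ((hi - u) / D + 1) * D := mul_le_mul_of_nonneg_right this.le hD0.le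
    rw [add_mul, div_mul_cancel₀ _ hD0.ne'] at h2
    linarith
  have hind : ∀ j : ℕ, j ≤ N → 0 < hi - j * D ∧
      ((hi - j * D) / hi) ^ κ' * V hi ≤ V (hi - j * D) := by
    intro j
    induction j with
    | zero => intro _; simp [hhi, hhi.ne']
    | succ j ih =>
      intro hj
      obtain ⟨h0, h1⟩ := ih (by omega)
      have h2 : (j : ℝ) < (hi - u) / D := Nat.lt_ceil.1 (by omega)
      rw [lt_div_iff₀ hD0] at h2
      have hjD : 0 ≤ (j : ℝ) * D := by positivity
      have h3 := hstep (hi - j * D) (by linarith) (by linarith)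
      have e : hi - ((j + 1 : ℕ) : ℝ) * D = hi - j * D - D := by push_cast; ring
      have hpos : 0 < hi - j * D - D := by linarith
      rw [e]
      refine ⟨hpos, le_trans ?_ h3⟩
      refine le_trans (le_of_eq ?_) (mul_le_mul_of_nonneg_left h1 (by positivity))
      rw [← mul_assoc, ← Real.mul_rpow (by positivity) (by positivity), div_mul_div_cancel₀ h0.ne']
  refine le_trans ?_ ((hind N le_rfl).2.trans (hVm hN1))
  refine mul_le_mul_of_nonneg_right (Real.rpow_le_rpow (div_nonneg (by linarith) hhi.le) ?_
    hκ'0.le) (hV0 _)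
  gcongr

lemma exists_div_rpow_mul_harmSum_le {c : ℕ} (hc : c = 1 ∨ c = 2) {B κ' : ℝ}
    (hB : BelowPrimes c B) (hκ' : c * B < κ') :
    ∃ D U : ℝ, 0 < D ∧ 0 < U ∧ ∀ w : ℕ → ℝ, (∀ i, 0 ≤ w i) → ∀ lo X : ℝ, U ≤ lo → 0 < X →
      (∀ y, Real.exp lo ≤ y → y ≤ X → ShiftRatioLE c B w y) →
      ∀ x, 0 < x → lo + D ≤ Real.log x → x ≤ X →
        ((Real.log x - D) / Real.log X) ^ κ' * harmSum c w X ≤ harmSum c w x := by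
  obtain ⟨K, hK0, hK⟩ := log_mul_harmSum_sub_le hc hB
  have hB0 := hB.1
  obtain ⟨D, U, hD, hU, hDU⟩ := exists_div_rpow_mul_le (by positivity) hκ' hK0
  refine ⟨D, U, hD, hU, fun w hw lo X hlo hX h x hx hlx hxX => ?_⟩
  have h1 := hDU (fun u => harmSum c w (Real.exp u)) (fun u => harmSum_nonneg hc hw _)
    (fun u v huv => harmSum_mono hc hw (Real.exp_le_exp.2 huv)) lo (Real.log X) hlo ?_
    (Real.log x) hlx (Real.log_le_log hx hxX)
  · simpa only [Real.exp_log hX, Real.exp_log hx] using h1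
  · intro u' u hu' huu hu
    have h2 := hK w hw (Real.exp u') (Real.exp u) (Real.one_le_exp (by linarith))
      (Real.exp_le_exp.2 huu) (h _ (Real.exp_le_exp.2 (hu'.trans huu)) ?_)
    · rwa [Real.log_exp, ← Real.exp_sub, Real.log_exp] at h2
    · rw [← Real.exp_log hX]
      exact Real.exp_le_exp.2 hu

/-- The indicator of `j` as a weight. -/
def deltaWeight (j : ℕ) : ℕ → ℝ := fun i => if i = j then 1 else 0

lemma deltaWeight_nonneg (j i : ℕ) : 0 ≤ deltaWeight j i := by
  unfold deltaWeight; split_ifs <;> norm_num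

lemma shiftWeight_deltaWeight (a j : ℕ) :
    shiftWeight (deltaWeight (j + a)) a = deltaWeight j := by
  funext i
  simp [shiftWeight, deltaWeight]

lemma belowPrimes_one {B : ℝ} (hB : 0 < B) (hB2 : B < 2) : BelowPrimes 1 B := by
  refine ⟨hB, B / 2, by positivity, by linarith, fun p hp _ => ?_⟩
  have : (2 : ℝ) ≤ p := by exact_mod_cast hp.two_le
  rw [Nat.cast_one, div_one]
  nlinarith

lemma shiftRatioLE_deltaWeight {c : ℕ} (hc : c = 1 ∨ c = 2) {B x : ℝ} (hB : 0 ≤ B) {j : ℕ}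
    (h : ∀ i < j, harmSum c (deltaWeight i) x ≤ B * harmSum c (deltaWeight (i + 1)) x) :
    ShiftRatioLE c B (deltaWeight j) x := by
  intro a
  rcases lt_or_ge a j with haj | haj
  · obtain ⟨d, rfl⟩ := Nat.exists_eq_add_of_lt haj
    have e1 := shiftWeight_deltaWeight (a + 1) d
    have e2 := shiftWeight_deltaWeight a (d + 1)
    rw [show d + (a + 1) = a + d + 1 by ring] at e1
    rw [show d + 1 + a = a + d + 1 by ring] at e2
    rw [e1, e2]
    exact h d (by omega)
  · have h0 : harmSum c (shiftWeight (deltaWeight j) (a + 1)) x = 0 := by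
      refine Finset.sum_eq_zero fun m _ => ?_
      have : cardFactors m + (a + 1) ≠ j := by omega
      simp [shiftWeight, deltaWeight, this]
    rw [h0]
    exact mul_nonneg hB (harmSum_nonneg hc (shiftWeight_nonneg (deltaWeight_nonneg j) a) x)

lemma sum_deltaWeight_mul_cardFactors (c j : ℕ) (x : ℝ) :
    ∑ m ∈ normLE c x, deltaWeight j (cardFactors m) / scaledNorm c m * cardFactors m =
      j * harmSum c (deltaWeight j) x := by
  rw [harmSum, Finset.mul_sum]
  refine Finset.sum_congr rfl fun m _ => ?_
  unfold deltaWeight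
  split_ifs with h
  · rw [h]; ring
  · simp

lemma exists_harmSum_deltaWeight_le {κ B : ℝ} (hκ : 0 < κ) (hκB : κ < B) (hB2 : B < 2) :
    ∃ x₀, 3 ≤ x₀ ∧ ∀ x, x₀ ≤ x → ∀ j : ℕ, (j : ℝ) ≤ κ * Real.log (Real.log x) →
      ∀ i < j, harmSum 1 (deltaWeight i) x ≤ B * harmSum 1 (deltaWeight (i + 1)) x := by
  have hc : (1 : ℕ) = 1 ∨ (1 : ℕ) = 2 := Or.inl rfl
  have hB0 : 0 < B := hκ.trans hκB
  have hBP := belowPrimes_one hB0 hB2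
  obtain ⟨K, hK0, hK⟩ := log_mul_harmSum_sub_le hc hBP
  obtain ⟨K', hK'0, hK'⟩ := le_sum_inv_primesNormLE_one
  have hr : κ / B < 1 := (div_lt_one hB0).2 hκB
  have hr0 : 0 < κ / B := by positivity
  set η : ℝ := (1 - κ / B) / 8 with hη
  have hη0 : 0 < η := by rw [hη]; linarith
  have hη1 : η < 1 / 8 := by rw [hη]; linarith
  have hlim1 : Tendsto (fun x : ℝ => 2 * K / Real.log x) atTop (𝓝 0) :=
    Real.tendsto_log_atTop.const_div_atTop _
  have hLL : Tendsto (fun x : ℝ => Real.log (Real.log x)) atTop atTop :=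
    Real.tendsto_log_atTop.comp Real.tendsto_log_atTop
  have hlim2 : Tendsto (fun x : ℝ => (Real.log η - K') / Real.log (Real.log x)) atTop (𝓝 0) :=
    hLL.const_div_atTop _
  have hlim : Tendsto (fun x : ℝ => (1 - 4 * η - 2 * K / Real.log x) *
      (1 + (Real.log η - K') / Real.log (Real.log x))) atTop (𝓝 ((1 - 4 * η - 0) * (1 + 0))) :=
    (tendsto_const_nhds.sub hlim1).mul (tendsto_const_nhds.add hlim2)
  have hlt : κ / B < (1 - 4 * η - 0) * (1 + 0) := by rw [hη]; linarith
  have hη3 : Tendsto (fun x : ℝ => x ^ η) atTop atTop := tendsto_rpow_atTop hη0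
  obtain ⟨x₀, hx₀⟩ := ((((hlim.eventually_const_lt hlt).and
    (hη3.eventually_ge_atTop 3)).and (hLL.eventually_gt_atTop 0)).and
    ((tendsto_const_nhds.add hlim2).eventually_const_lt
      (show (0 : ℝ) < 1 + 0 by norm_num))).exists_forall_of_atTop
  refine ⟨max 3 x₀, le_max_left _ _, fun x hx j hj i => ?_⟩
  obtain ⟨⟨⟨h1, h2⟩, h3⟩, h4⟩ := hx₀ x ((le_max_right _ _).trans hx)
  have hx3 : 3 ≤ x := (le_max_left _ _).trans hx
  have hx0 : 0 < x := by linarith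
  have hl : 0 < Real.log x := Real.log_pos (by linarith)
  induction i using Nat.strong_induction_on with
  | _ i ih =>
    intro hij
    have hch : ShiftRatioLE 1 B (deltaWeight i) x :=
      shiftRatioLE_deltaWeight hc hB0.le fun i' hi' => ih i' hi' (hi'.trans hij)
    set v := harmSum 1 (deltaWeight i) x
    set v' := harmSum 1 (deltaWeight i) (x ^ (1 - η))
    set v₁ := harmSum 1 (deltaWeight (i + 1)) x
    have hv0 : 0 ≤ v := harmSum_nonneg hc (deltaWeight_nonneg i) x
    have hv1 : 0 ≤ v₁ := harmSum_nonneg hc (deltaWeight_nonneg (i + 1)) x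
    have hx'1 : 1 ≤ x ^ (1 - η) := Real.one_le_rpow (by linarith) (by linarith)
    have hx'x : x ^ (1 - η) ≤ x := by
      conv_rhs => rw [← Real.rpow_one x]
      exact Real.rpow_le_rpow_of_exponent_le (by linarith) (by linarith)
    have hyx : x ^ η ≤ x := by
      conv_rhs => rw [← Real.rpow_one x]
      exact Real.rpow_le_rpow_of_exponent_le (by linarith) (by linarith)
    have hxy : x / x ^ (1 - η) = x ^ η := by
      rw [Real.rpow_sub hx0, Real.rpow_one, div_div_cancel₀ hx0.ne']
    have hxy' : x / x ^ η = x ^ (1 - η) := by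
      rw [Real.rpow_sub hx0, Real.rpow_one]
    have hD := hK _ (deltaWeight_nonneg i) _ x hx'1 hx'x hch
    rw [hxy, Real.log_rpow hx0, Real.log_rpow hx0, Nat.cast_one, one_mul] at hD
    have hv' : (1 - 4 * η - 2 * K / Real.log x) * v ≤ v' := by
      have e1 : 2 * K / Real.log x * Real.log x = 2 * K := div_mul_cancel₀ _ hl.ne'
      have e2 : (1 - η) * Real.log x * (v - v') ≤ (B * (η * Real.log x) + K) * v := hD
      have e3 : (1 - η) * Real.log x * ((4 * η + 2 * K / Real.log x) * v) ≥
          (B * (η * Real.log x) + K) * v := by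
        have : (1 - η) * Real.log x * (4 * η + 2 * K / Real.log x) =
          (1 - η) * (4 * (η * Real.log x)) + (1 - η) * (2 * K) := by
          linear_combination (1 - η) * e1
        rw [← mul_assoc, this]
        refine mul_le_mul_of_nonneg_right ?_ hv0
        have : 0 < η * Real.log x := by positivity
        nlinarith
      have e4 : v - v' ≤ (4 * η + 2 * K / Real.log x) * v :=
        le_of_mul_le_mul_left (e2.trans e3) (mul_pos (by linarith) hl)
      linarith
    have hO := le_sum_cardFactors hc (deltaWeight_nonneg (i + 1)) (show 0 < x ^ η by positivity)
      hyx (by linarith)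
    rw [sum_deltaWeight_mul_cardFactors, hxy', shiftWeight_deltaWeight] at hO
    have hS := hK' _ h2
    simp only [Nat.cast_one, div_one] at hO
    rw [Real.log_rpow hx0, Real.log_mul hη0.ne' hl.ne'] at hS
    set L := Real.log (Real.log x)
    have hv'0 : 0 ≤ v' := harmSum_nonneg hc (deltaWeight_nonneg i) _
    have e5 : (1 + (Real.log η - K') / L) * L * v' ≤ κ * L * v₁ := by
      have : (1 + (Real.log η - K') / L) * L = Real.log η + L - K' := by field_simp; ring
      rw [this]
      refine (mul_le_mul_of_nonneg_right hS hv'0).trans (hO.trans ?_)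
      refine mul_le_mul_of_nonneg_right (le_trans ?_ hj) hv1
      exact_mod_cast hij
    have e6 : κ / B * L * v ≤ κ * L * v₁ := by
      refine le_trans ?_ e5
      calc κ / B * L * v ≤ ((1 - 4 * η - 2 * K / Real.log x) *
            (1 + (Real.log η - K') / L)) * L * v := by gcongr
        _ = (1 + (Real.log η - K') / L) * L * ((1 - 4 * η - 2 * K / Real.log x) * v) := by ring
        _ ≤ _ := by gcongr
    have e7 : κ * L * v ≤ κ * L * (B * v₁) := by
      have := mul_le_mul_of_nonneg_left e6 hB0.le
      have e : B * (κ / B * L * v) = κ * L * v := by field_simp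
      linarith
    exact le_of_mul_le_mul_left e7 (by positivity)

lemma exists_mul_harmSum_deltaWeight_le {B κ τ₁ τ₂ : ℝ} (hκ : 0 < κ) (hκB : κ < B) (hB2 : B < 2)
    (hττ : τ₁ < τ₂) :
    ∃ x₀, 3 ≤ x₀ ∧ ∀ x, x₀ ≤ x → ∀ j : ℕ, τ₂ * Real.log (Real.log x) ≤ (j + 1 : ℕ) →
      (j + 1 : ℕ) ≤ κ * Real.log (Real.log x) →
      τ₁ * harmSum 1 (deltaWeight (j + 1)) x ≤ harmSum 1 (deltaWeight j) x := by
  have hc : (1 : ℕ) = 1 ∨ (1 : ℕ) = 2 := Or.inl rfl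
  have hB0 : 0 < B := hκ.trans hκB
  have hBP := belowPrimes_one hB0 hB2
  obtain ⟨x₀, hx₀3, hx₀⟩ := exists_harmSum_deltaWeight_le hκ hκB hB2
  obtain ⟨K, hK0, hK⟩ := sum_cardFactors_le hc hBP
  have hLL : Tendsto (fun x : ℝ => Real.log (Real.log x)) atTop atTop :=
    Real.tendsto_log_atTop.comp Real.tendsto_log_atTop
  obtain ⟨x₁, hx₁⟩ := (hLL.eventually_ge_atTop
    ((τ₁ * K + K) / (τ₂ - τ₁))).exists_forall_of_atTop
  refine ⟨max x₀ x₁, hx₀3.trans (le_max_left _ _), fun x hx j hj1 hj2 => ?_⟩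
  have h1 := hx₀ x ((le_max_left _ _).trans hx) (j + 1) hj2
  have h2 := hx₁ x ((le_max_right _ _).trans hx)
  have hx3 : 3 ≤ x := hx₀3.trans ((le_max_left _ _).trans hx)
  have hch := shiftRatioLE_deltaWeight hc hB0.le h1
  have h3 := hK _ (deltaWeight_nonneg (j + 1)) x hx3 hch
  rw [sum_deltaWeight_mul_cardFactors, shiftWeight_deltaWeight, Nat.cast_one, one_mul] at h3
  rw [div_le_iff₀ (by linarith)] at h2
  set L := Real.log (Real.log x)
  set v := harmSum 1 (deltaWeight j) x
  set v₁ := harmSum 1 (deltaWeight (j + 1)) x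
  have hv1 : 0 ≤ v₁ := harmSum_nonneg hc (deltaWeight_nonneg (j + 1)) x
  have hL0 : 0 ≤ L := by
    by_contra hneg
    have : κ * L < 0 := mul_neg_of_pos_of_neg hκ (not_le.1 hneg)
    have : (0 : ℝ) ≤ (j + 1 : ℕ) := Nat.cast_nonneg _
    linarith
  have hLp : 0 < L := by
    rcases hL0.lt_or_eq with h | h
    · exact h
    · rw [← h, mul_zero] at hj2
      have : (0 : ℝ) < (j + 1 : ℕ) := by positivity
      linarith
  have h4 : (L + K) * (τ₁ * v₁) ≤ (L + K) * v := by
    have : (L + K) * τ₁ ≤ (j + 1 : ℕ) - K := by nlinarith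
    have := mul_le_mul_of_nonneg_right this hv1
    linarith
  exact le_of_mul_le_mul_left h4 (by linarith)

lemma mem_filter_nuOmega {j m : ℕ} {x : ℝ} :
    m ∈ (Finset.Icc 1 ⌊x⌋₊).filter (fun m => m.primeFactorsList.length = j) ↔
      m ≠ 0 ∧ (m : ℝ) ≤ x ∧ cardFactors m = j := by
  rw [Finset.mem_filter, Finset.mem_Icc, ← ArithmeticFunction.cardFactors_apply]
  constructor
  · rintro ⟨⟨h1, h2⟩, h3⟩
    exact ⟨by omega, (Nat.le_floor_iff' (by omega)).1 h2, h3⟩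
  · rintro ⟨h1, h2, h3⟩
    exact ⟨⟨by omega, (Nat.le_floor_iff' h1).2 h2⟩, h3⟩

lemma nuOmega_eq_cntSum (j : ℕ) (x : ℝ) : (nuOmega j x : ℝ) = cntSum 1 (deltaWeight j) x := by
  simp only [cntSum, deltaWeight]
  rw [← Finset.sum_filter, Finset.sum_const, nsmul_eq_mul, mul_one, nuOmega]
  congr 2
  ext m
  rw [mem_filter_nuOmega, Finset.mem_filter, mem_normLE (Or.inl rfl)]
  simp [scaledNorm, and_assoc]

lemma nuOmega_pos {j : ℕ} {x : ℝ} (h : (2 : ℝ) ^ j ≤ x) : 0 < nuOmega j x := by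
  refine Finset.card_pos.2 ⟨2 ^ j, mem_filter_nuOmega.2 ⟨by positivity, by exact_mod_cast h, ?_⟩⟩
  exact cardFactors_apply_prime_pow Nat.prime_two

lemma tendsto_log_natCast : Tendsto (fun n : ℕ => Real.log (n : ℝ)) atTop atTop :=
  Real.tendsto_log_atTop.comp tendsto_natCast_atTop_atTop

lemma tendsto_log_log_natCast : Tendsto (fun n : ℕ => Real.log (Real.log (n : ℝ))) atTop atTop :=
  Real.tendsto_log_atTop.comp tendsto_log_natCast

section

variable {τ : ℝ} {g : ℕ → ℕ}

lemma eventually_le_mul_log_log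
    (hg : Tendsto (fun n : ℕ => (g n : ℝ) / Real.log (Real.log (n : ℝ))) atTop (𝓝 τ))
    {σ : ℝ} (hσ : τ < σ) (r : ℝ) :
    ∀ᶠ n : ℕ in atTop, (g n : ℝ) + r ≤ σ * Real.log (Real.log (n : ℝ)) := by
  filter_upwards [hg.eventually_lt_const (show τ < (τ + σ) / 2 by linarith),
    tendsto_log_log_natCast.eventually_ge_atTop (r / ((σ - τ) / 2)),
    tendsto_log_log_natCast.eventually_gt_atTop 0] with n h1 h2 h3
  rw [div_lt_iff₀ h3] at h1
  rw [div_le_iff₀ (by linarith)] at h2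
  linarith

lemma eventually_mul_log_log_le
    (hg : Tendsto (fun n : ℕ => (g n : ℝ) / Real.log (Real.log (n : ℝ))) atTop (𝓝 τ))
    {σ : ℝ} (hσ : σ < τ) (r : ℝ) :
    ∀ᶠ n : ℕ in atTop, σ * Real.log (Real.log (n : ℝ)) + r ≤ g n := by
  filter_upwards [hg.eventually_const_lt (show (τ + σ) / 2 < τ by linarith),
    tendsto_log_log_natCast.eventually_ge_atTop (r / ((τ - σ) / 2)),
    tendsto_log_log_natCast.eventually_gt_atTop 0] with n h1 h2 h3
  rw [lt_div_iff₀ h3] at h1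
  rw [div_le_iff₀ (by linarith)] at h2
  linarith

lemma eventually_le_mul_log
    (hg : Tendsto (fun n : ℕ => (g n : ℝ) / Real.log (Real.log (n : ℝ))) atTop (𝓝 τ))
    {δ : ℝ} (hδ : 0 < δ) : ∀ᶠ n : ℕ in atTop, (g n : ℝ) ≤ δ * Real.log (n : ℝ) := by
  have h1 := (Real.isLittleO_log_id_atTop.comp_tendsto tendsto_log_natCast).tendsto_div_nhds_zero
  have h2 := (hg.mul h1).eventually_lt_const (show τ * 0 < δ by simpa using hδ)
  filter_upwards [h2, tendsto_log_log_natCast.eventually_gt_atTop 0,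
    tendsto_log_natCast.eventually_gt_atTop 0] with n h3 h4 h5
  simp only [Function.comp_apply, id] at h3
  rw [div_mul_div_cancel₀ h4.ne', div_lt_iff₀ h5] at h3
  exact h3.le

lemma eventually_two_pow_le
    (hg : Tendsto (fun n : ℕ => (g n : ℝ) / Real.log (Real.log (n : ℝ))) atTop (𝓝 τ))
    {δ : ℝ} (hδ : 0 < δ) : ∀ᶠ n : ℕ in atTop, (2 : ℝ) ^ g n ≤ (n : ℝ) ^ δ := by
  filter_upwards [eventually_le_mul_log hg hδ, eventually_gt_atTop 0] with n h hn
  have hn0 : (0 : ℝ) < n := by exact_mod_cast hn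
  rw [← Real.log_le_log_iff (by positivity) (by positivity), Real.log_pow, Real.log_rpow hn0]
  have := Real.log_two_lt_d9
  have h0 : (0 : ℝ) ≤ g n := Nat.cast_nonneg _
  nlinarith

lemma eventually_nuOmega_pos
    (hg : Tendsto (fun n : ℕ => (g n : ℝ) / Real.log (Real.log (n : ℝ))) atTop (𝓝 τ)) :
    ∀ᶠ n : ℕ in atTop, (0 : ℝ) < nuOmega (g n) n := by
  filter_upwards [eventually_two_pow_le hg one_pos] with n h
  rw [Real.rpow_one] at h
  exact_mod_cast nuOmega_pos h

lemma log_div_bounds {n P a b : ℝ} (hn : 0 < n) (hP1 : n ^ a ≤ P) (hP2 : P ≤ n ^ b) :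
    0 < P ∧ (1 - b) * Real.log n ≤ Real.log (n / P) ∧ Real.log (n / P) ≤ (1 - a) * Real.log n := by
  have hP : 0 < P := (Real.rpow_pos_of_pos hn a).trans_le hP1
  have h1 := Real.log_le_log (Real.rpow_pos_of_pos hn a) hP1
  have h2 := Real.log_le_log hP hP2
  rw [Real.log_rpow hn] at h1 h2
  rw [Real.log_div hn.ne' hP.ne']
  exact ⟨hP, by linarith, by linarith⟩

set_option maxHeartbeats 1000000 in
lemma eventually_le_nuOmega_div_of_lt_two (hτ : 0 < τ) (hτ2 : τ < 2)
    (hg : Tendsto (fun n : ℕ => (g n : ℝ) / Real.log (Real.log (n : ℝ))) atTop (𝓝 τ))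
    (k : ℕ) {a b t : ℝ} (ha : 0 ≤ a) (hab : a ≤ b) (hb : b < 1) (ht : 0 < t) (htτ : t < τ)
    (htb : t < 1 - b) :
    ∀ᶠ n : ℕ in atTop, ∀ P : ℝ, (n : ℝ) ^ a ≤ P → P ≤ (n : ℝ) ^ b →
      (1 - t) / (1 + t) * (1 - b - t) ^ (τ + t) * (τ - t) ^ k / ((1 - a) * P) ≤
        (nuOmega (g n - k) (n / P) : ℝ) / (nuOmega (g n) n : ℝ) := by
  have hc : (1 : ℕ) = 1 ∨ (1 : ℕ) = 2 := Or.inl rfl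
  set s := min t (2 - τ) with hs
  have hs0 : 0 < s := lt_min ht (by linarith)
  have hst : s ≤ t := min_le_left _ _
  have hs2 : s ≤ 2 - τ := min_le_right _ _
  have hκ : 0 < τ + s / 3 := by linarith
  have hκB : τ + s / 3 < τ + 2 * s / 3 := by linarith
  have hB2 : τ + 2 * s / 3 < 2 := by linarith
  have hBP := belowPrimes_one (hκ.trans hκB) hB2
  obtain ⟨D, U, hD, hU, hSV⟩ := exists_div_rpow_mul_harmSum_le hc hBP (κ' := τ + t)
    (by push_cast; linarith)
  obtain ⟨xA, hxA3, hxA⟩ := exists_harmSum_deltaWeight_le hκ hκB hB2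
  obtain ⟨x₁, -, hx₁⟩ := exists_mul_harmSum_deltaWeight_le hκ hκB hB2
    (show τ - t < τ - t / 2 by linarith)
  obtain ⟨x₂, -, hx₂⟩ := exists_mul_harmSum_deltaWeight_le hκ hκB hB2
    (show τ / 2 < τ - τ / 4 by linarith)
  obtain ⟨x₃, -, hx₃⟩ := cntSum_mul_log_le_of_shiftRatioLE hc hBP (A := 2 / τ) (by positivity) ht
  obtain ⟨K, hK1, hK⟩ := le_log_mul_cntSum hc ht
  have hc₀ : 0 < (1 - b) / 2 := by linarith
  have hlogn := tendsto_log_natCast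
  filter_upwards [tendsto_natCast_atTop_atTop.eventually_ge_atTop xA,
    tendsto_natCast_atTop_atTop.eventually_ge_atTop x₁,
    tendsto_natCast_atTop_atTop.eventually_ge_atTop x₂,
    tendsto_natCast_atTop_atTop.eventually_ge_atTop x₃,
    hlogn.eventually_ge_atTop (U / ((1 - b) / 2)),
    hlogn.eventually_ge_atTop (Real.log xA / ((1 - b) / 2)),
    hlogn.eventually_ge_atTop ((Real.log K + D) / ((1 - b) / 2)),
    hlogn.eventually_ge_atTop ((Real.log K + D) / t),
    eventually_le_mul_log_log hg (show τ < τ + s / 3 by linarith)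
      (-((τ + s / 3) * Real.log ((1 - b) / 2))),
    eventually_mul_log_log_le hg (show τ - t / 2 < τ by linarith) k,
    eventually_mul_log_log_le hg (show τ - τ / 4 < τ by linarith) 0,
    eventually_mul_log_log_le hg (show (0 : ℝ) < τ by linarith) (k + 1),
    eventually_nuOmega_pos hg]
    with n hA h1 h2 h3 h4 h5 h6 h7 h8 h9 h10 h11 hpos P hP1 hP2
  have hn3 : (3 : ℝ) ≤ n := hxA3.trans hA
  have hn0 : (0 : ℝ) < n := by linarith
  obtain ⟨hP, hl1, hl2⟩ := log_div_bounds hn0 hP1 hP2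
  have hR : 0 < Real.log n := Real.log_pos (by linarith)
  rw [div_le_iff₀ hc₀] at h4 h5 h6
  rw [div_le_iff₀ ht] at h7
  obtain ⟨d, hd⟩ : ∃ d, g n = d + k + 1 := by
    refine ⟨g n - k - 1, ?_⟩
    have : k + 1 ≤ g n := by
      rw [zero_mul, zero_add] at h11
      exact_mod_cast h11
    omega
  set L := Real.log (Real.log (n : ℝ))
  set lo : ℝ := (1 - b) / 2 * Real.log n with hlo
  have hlo0 : 0 < lo := by positivity
  have hloglo : Real.log lo = Real.log ((1 - b) / 2) + L := Real.log_mul hc₀.ne' hR.ne'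
  have hgl : (g n : ℝ) ≤ (τ + s / 3) * Real.log lo := by
    rw [hloglo]; linarith
  have hchain : ∀ y, Real.exp lo ≤ y → ∀ j : ℕ, j ≤ g n →
      ShiftRatioLE 1 (τ + 2 * s / 3) (deltaWeight j) y := by
    intro y hy j hj
    have hy0 : 0 < y := (Real.exp_pos _).trans_le hy
    have hly : lo ≤ Real.log y := by
      rw [← Real.log_exp lo]; exact Real.log_le_log (Real.exp_pos _) hy
    refine shiftRatioLE_deltaWeight hc (by linarith) (hxA y ?_ j ?_)
    · rw [← Real.exp_log (show (0 : ℝ) < xA by linarith)]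
      exact (Real.exp_le_exp.2 (by linarith)).trans hy
    · refine le_trans (by exact_mod_cast hj) (hgl.trans ?_)
      exact mul_le_mul_of_nonneg_left (Real.log_le_log hlo0 hly) hκ.le
  have hlon : Real.exp lo ≤ n := by
    conv_rhs => rw [← Real.exp_log hn0]
    refine Real.exp_le_exp.2 ?_
    exact mul_le_of_le_one_left hR.le (by linarith)
  have hgn : (g n : ℝ) ≤ (τ + s / 3) * L := by
    refine hgl.trans (mul_le_mul_of_nonneg_left (Real.log_le_log hlo0 ?_) hκ.le)
    have := Real.log_le_log (Real.exp_pos lo) hlon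
    rwa [Real.log_exp] at this
  -- upper bound for the denominator
  have hup : (nuOmega (g n) n : ℝ) * Real.log n ≤
      (1 + t) * (n * harmSum 1 (deltaWeight (d + k)) n) := by
    rw [nuOmega_eq_cntSum]
    have e := shiftWeight_deltaWeight 1 (d + k)
    rw [← hd] at e
    have h13 := hx₃ _ (deltaWeight_nonneg (g n)) n h3 (hchain n hlon _ le_rfl)
    rw [e, Nat.cast_one] at h13
    refine h13 ?_
    have h14 := hx₂ n h2 (d + k) (by rw [← hd]; linarith) (by rw [← hd]; exact hgn)
    rw [← hd] at h14
    rw [div_mul_eq_mul_div, le_div_iff₀ hτ]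
    linarith
  have hiter : ∀ i ≤ k, (τ - t) ^ i * harmSum 1 (deltaWeight (d + i)) n ≤
      harmSum 1 (deltaWeight d) n := by
    intro i
    induction i with
    | zero => intro _; simp
    | succ i ih =>
      intro hi
      refine le_trans ?_ (ih (by omega))
      rw [pow_succ, mul_assoc]
      refine mul_le_mul_of_nonneg_left ?_ (pow_nonneg (by linarith) i)
      have hdR : (g n : ℝ) = d + k + 1 := by rw [hd]; push_cast; ring
      have hiR : (i : ℝ) + 1 ≤ k := by exact_mod_cast hi
      refine hx₁ n h1 (d + i) ?_ ?_
      · push_cast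
        have : (0 : ℝ) ≤ i := Nat.cast_nonneg i
        linarith
      · push_cast
        linarith
  have hlK : 0 ≤ Real.log K := Real.log_nonneg hK1
  have hnP : 0 < (n : ℝ) / P := by positivity
  have hlx' : Real.log (n / P / K) = Real.log (n / P) - Real.log K :=
    Real.log_div hnP.ne' (by linarith)
  have hx1 : 1 ≤ (n : ℝ) / P := by
    by_contra hneg
    have := Real.log_neg hnP (not_le.1 hneg)
    have : 0 < (1 - b) * Real.log n := mul_pos (by linarith) hR
    linarith
  have hlow := hK _ (deltaWeight_nonneg (d + 1)) (n / P) hx1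
  rw [shiftWeight_deltaWeight, Nat.cast_one, ← nuOmega_eq_cntSum] at hlow
  have hx'n : (n : ℝ) / P / K ≤ n := by
    have hP1' : 1 ≤ P := (Real.one_le_rpow (by linarith) ha).trans hP1
    exact (div_le_self hnP.le hK1).trans (div_le_self hn0.le hP1')
  have hsv := hSV _ (deltaWeight_nonneg d) lo n (by linarith) hn0
    (fun y hy _ => hchain y hy d (by omega)) (n / P / K) (by positivity)
    (by rw [hlx']; linarith) hx'n
  have hQ : (1 - b - t) ^ (τ + t) ≤ ((Real.log (n / P / K) - D) / Real.log n) ^ (τ + t) := by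
    refine Real.rpow_le_rpow (by linarith) ?_ (by linarith)
    rw [le_div_iff₀ hR, hlx']
    linarith
  have hgk : g n - k = d + 1 := by omega
  rw [hgk, div_le_div_iff₀ (mul_pos (by linarith) hP) hpos]
  have hV0 := harmSum_nonneg hc (deltaWeight_nonneg d) (n : ℝ)
  have hT : 0 ≤ (τ - t) ^ k := pow_nonneg (by linarith) k
  have hQ0 : 0 ≤ (1 - b - t) ^ (τ + t) := Real.rpow_nonneg (by linarith) _
  refine le_of_mul_le_mul_right ?_ hR
  calc (1 - t) / (1 + t) * (1 - b - t) ^ (τ + t) * (τ - t) ^ k * nuOmega (g n) n * Real.log n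
      = (1 - t) / (1 + t) * (1 - b - t) ^ (τ + t) * (τ - t) ^ k *
          (nuOmega (g n) n * Real.log n) := by ring
    _ ≤ (1 - t) / (1 + t) * (1 - b - t) ^ (τ + t) * (τ - t) ^ k *
          ((1 + t) * (n * harmSum 1 (deltaWeight (d + k)) n)) :=
        mul_le_mul_of_nonneg_left hup (mul_nonneg (mul_nonneg
          (div_nonneg (by linarith) (by linarith)) hQ0) hT)
    _ = (1 - t) * n * ((1 - b - t) ^ (τ + t) *
          ((τ - t) ^ k * harmSum 1 (deltaWeight (d + k)) n)) := by
        have : 1 + t ≠ 0 := by linarith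
        field_simp
    _ ≤ (1 - t) * n * harmSum 1 (deltaWeight d) (n / P / K) := by
        refine mul_le_mul_of_nonneg_left ?_ (mul_nonneg (by linarith) hn0.le)
        refine le_trans ?_ hsv
        refine (mul_le_mul_of_nonneg_left (hiter k le_rfl) hQ0).trans ?_
        exact mul_le_mul_of_nonneg_right hQ hV0
    _ = P * ((1 - t) * (n / P) * harmSum 1 (deltaWeight d) (n / P / K)) := by
        field_simp
    _ ≤ P * (Real.log (n / P) * nuOmega (d + 1) (n / P)) :=
        mul_le_mul_of_nonneg_left hlow hP.le
    _ ≤ P * ((1 - a) * Real.log n * nuOmega (d + 1) (n / P)) := by gcongr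
    _ = _ := by ring

end

/-- The indicator of `{i | i ≤ j}` as a weight. -/
def iicWeight (j : ℕ) : ℕ → ℝ := fun i => if i ≤ j then 1 else 0

lemma iicWeight_nonneg (j i : ℕ) : 0 ≤ iicWeight j i := by
  unfold iicWeight; split_ifs <;> norm_num

lemma iicWeight_le_one (j i : ℕ) : iicWeight j i ≤ 1 := by
  unfold iicWeight; split_ifs <;> norm_num

lemma antitone_iicWeight (j : ℕ) : Antitone (iicWeight j) := by
  intro i i' h
  unfold iicWeight
  split_ifs <;> first | (exfalso; omega) | norm_num

lemma shiftWeight_iicWeight (j : ℕ) : shiftWeight (iicWeight (j + 1)) 1 = iicWeight j := by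
  funext i
  simp [shiftWeight, iicWeight]

lemma shiftRatioLE_one_of_antitone {c : ℕ} (hc : c = 1 ∨ c = 2) {w : ℕ → ℝ} (hw : Antitone w)
    (x : ℝ) : ShiftRatioLE c 1 w x := fun a => by
  rw [one_mul]
  refine Finset.sum_le_sum fun m hm => div_le_div_of_nonneg_right (hw (by omega))
    (normLE_facts hc hm).1.le

lemma belowPrimes_two {B : ℝ} (hB : 0 < B) (hB2 : B < 3 / 2) : BelowPrimes 2 B := by
  refine ⟨hB, B / (3 / 2), by positivity, by linarith, fun p hp hcp => ?_⟩
  have := three_halves_le_prime_div (Or.inr rfl) hp hcp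
  nlinarith

lemma nuOmega_eq_cntSum_two (j : ℕ) (x : ℝ) :
    (nuOmega j x : ℝ) = cntSum 2 (iicWeight j) (x / 2 ^ j) := by
  have hc : (2 : ℕ) = 1 ∨ (2 : ℕ) = 2 := Or.inr rfl
  simp only [cntSum, iicWeight]
  rw [← Finset.sum_filter, Finset.sum_const, nsmul_eq_mul, mul_one, nuOmega]
  congr 1
  have hnorm : ∀ m : ℕ, cardFactors m ≤ j →
      (scaledNorm 2 m ≤ x / 2 ^ j ↔ ((2 ^ (j - cardFactors m) * m : ℕ) : ℝ) ≤ x) := by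
    intro m hm
    rw [scaledNorm, le_div_iff₀ (by positivity), Nat.cast_ofNat]
    have : (2 : ℝ) ^ j = 2 ^ (j - cardFactors m) * 2 ^ cardFactors m := by
      rw [← pow_add, Nat.sub_add_cancel hm]
    rw [this, show (m : ℝ) / 2 ^ cardFactors m * (2 ^ (j - cardFactors m) * 2 ^ cardFactors m) =
      2 ^ (j - cardFactors m) * m by field_simp]
    push_cast
    rfl
  refine (Finset.card_bij (fun m _ => 2 ^ (j - cardFactors m) * m) ?_ ?_ ?_).symm
  · intro m hm
    rw [Finset.mem_filter, mem_normLE hc] at hm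
    obtain ⟨⟨h1, h2, h3⟩, h4⟩ := hm
    rw [mem_filter_nuOmega]
    refine ⟨by positivity, (hnorm m h4).1 h3, ?_⟩
    rw [cardFactors_mul (by positivity) h1, cardFactors_apply_prime_pow Nat.prime_two]
    omega
  · intro m hm m' hm' h
    rw [Finset.mem_filter, mem_normLE hc] at hm hm'
    have key : ∀ s t u v : ℕ, Nat.Coprime 2 u → Nat.Coprime 2 v → 2 ^ s * u = 2 ^ t * v →
        u ∣ v := fun s t u v hu _ he =>
      (Nat.Coprime.pow_right t hu.symm).dvd_of_dvd_mul_left (he ▸ Dvd.intro_left _ rfl)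
    exact Nat.dvd_antisymm (key _ _ _ _ hm.1.2.1 hm'.1.2.1 h)
      (key _ _ _ _ hm'.1.2.1 hm.1.2.1 h.symm)
  · intro n hn
    rw [mem_filter_nuOmega] at hn
    obtain ⟨h1, h2, h3⟩ := hn
    obtain ⟨e, m, hm, rfl⟩ := Nat.exists_eq_two_pow_mul_odd h1
    have hm0 : m ≠ 0 := right_ne_zero_of_mul h1
    rw [cardFactors_mul (by positivity) hm0, cardFactors_apply_prime_pow Nat.prime_two] at h3
    have he : j - cardFactors m = e := by omega
    refine ⟨m, ?_, by rw [he]⟩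
    rw [Finset.mem_filter, mem_normLE hc]
    exact ⟨⟨hm0, Nat.coprime_two_left.2 hm, (hnorm m (by omega)).2 (by rwa [he])⟩, by omega⟩

lemma shiftRatioLE_pow (c : ℕ) (z x : ℝ) : ShiftRatioLE c z (fun i => z ^ i) x := fun a => by
  rw [harmSum, harmSum, Finset.mul_sum]
  refine le_of_eq (Finset.sum_congr rfl fun m _ => ?_)
  simp only [shiftWeight]
  ring

lemma sub_mul_pow_add_ge {z A : ℝ} (hz : 1 < z) (hA : 0 ≤ A) {j : ℕ} (hAj : A ≤ j) (i : ℕ) :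
    (1 - iicWeight j i) * ((j - A) * z ^ j) ≤ ((i : ℝ) - A) * z ^ i + A * z ^ A := by
  have hz0 : 0 < z := by linarith
  have hzA : 0 ≤ A * z ^ A := by positivity
  unfold iicWeight
  split_ifs with h
  · rw [sub_self, zero_mul]
    rcases le_total A i with hi | hi
    · have : 0 ≤ ((i : ℝ) - A) * z ^ i := mul_nonneg (by linarith) (by positivity)
      linarith
    · have h1 : z ^ i ≤ z ^ A := by
        rw [← Real.rpow_natCast]
        exact Real.rpow_le_rpow_of_exponent_le hz.le hi
      have h2 : (A - i) * z ^ i ≤ A * z ^ A :=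
        mul_le_mul (by have : (0 : ℝ) ≤ i := Nat.cast_nonneg i
                       linarith) h1 (by positivity) hA
      linarith
  · rw [sub_zero, one_mul]
    have hji : (j : ℝ) ≤ i := by exact_mod_cast (not_le.1 h).le
    have : ((j : ℝ) - A) * z ^ j ≤ (i - A) * z ^ i :=
      mul_le_mul (by linarith) (pow_le_pow_right₀ hz.le (not_le.1 h).le) (by positivity)
        (by linarith)
    linarith

lemma exists_harmSum_one_le_harmSum_iicWeight {δ ε : ℝ} (hδ : 0 < δ) (hε : 0 < ε) :
    ∃ X₀, 3 ≤ X₀ ∧ ∀ x, X₀ ≤ x → ∀ j : ℕ, (2 + δ) * Real.log (Real.log x) ≤ j →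
      (1 - ε) * harmSum 2 (fun _ => 1) x ≤ harmSum 2 (iicWeight j) x := by
  have hc : (2 : ℕ) = 1 ∨ (2 : ℕ) = 2 := Or.inr rfl
  set z : ℝ := 1 + min δ 1 / 4 with hz
  have hm0 : 0 < min δ 1 := lt_min hδ one_pos
  have hm1 : min δ 1 ≤ 1 := min_le_right _ _
  have hmδ : min δ 1 ≤ δ := min_le_left _ _
  have hz1 : 1 < z := by linarith
  have hz0 : 0 < z := by linarith
  have hz2 : z < 3 / 2 := by linarith
  obtain ⟨K, hK0, hK⟩ := sum_cardFactors_le hc (belowPrimes_two hz0 hz2)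
  have hLL : Tendsto (fun x : ℝ => Real.log (Real.log x)) atTop atTop :=
    Real.tendsto_log_atTop.comp Real.tendsto_log_atTop
  have hdecay : Tendsto (fun x : ℝ => 16 / δ * Real.exp (-(δ / 4 * Real.log z *
      Real.log (Real.log x)))) atTop (𝓝 (16 / δ * 0)) := by
    refine (Real.tendsto_exp_neg_atTop_nhds_zero.comp ?_).const_mul _
    exact hLL.const_mul_atTop (mul_pos (by positivity) (Real.log_pos hz1))
  obtain ⟨x₀, hx₀⟩ := (((hLL.eventually_gt_atTop 0).and
    (hLL.eventually_ge_atTop ((K * z + K) / (min δ 1 / 4)))).and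
    (hdecay.eventually_lt_const (by rw [mul_zero]; exact hε))).exists_forall_of_atTop
  refine ⟨max 3 x₀, le_max_left _ _, fun x hx j hj => ?_⟩
  obtain ⟨⟨hL0, hL1⟩, hL2⟩ := hx₀ x ((le_max_right _ _).trans hx)
  have hx3 : 3 ≤ x := (le_max_left _ _).trans hx
  have h1 := hK (fun i => z ^ i) (fun i => by positivity) x hx3 (shiftRatioLE_pow 2 z x)
  have h2 := shiftRatioLE_pow 2 z x 0
  rw [shiftWeight_zero, zero_add] at h2
  rw [div_le_iff₀ (by positivity)] at hL1
  set L := Real.log (Real.log x)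
  set V := harmSum 2 (fun i => z ^ i) x with hV
  set A : ℝ := (2 * L + K) * z + K with hA
  have hA0 : 0 ≤ A := by positivity
  have h3 : ∑ m ∈ normLE 2 x, z ^ cardFactors m / scaledNorm 2 m * cardFactors m ≤ A * V := by
    have := mul_le_mul_of_nonneg_left h2 (show 0 ≤ 2 * L + K by positivity)
    push_cast at h1
    rw [hA]
    linarith
  have hzL : z * L = L + min δ 1 / 4 * L := by rw [hz]; ring
  have hmL : min δ 1 * L ≤ δ * L := by gcongr
  have hmL1 : min δ 1 * L ≤ 1 * L := by gcongr
  have hjA : δ / 4 * L ≤ j - A := by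
    rw [hA]
    linarith
  have hA4 : A ≤ 4 * L := by
    rw [hA]
    linarith
  have hδL : 0 < δ / 4 * L := by positivity
  have h4 : ((j : ℝ) - A) * z ^ j * (harmSum 2 (fun _ => 1) x - harmSum 2 (iicWeight j) x) ≤
      A * z ^ A * harmSum 2 (fun _ => 1) x := by
    have e1 : ((j : ℝ) - A) * z ^ j * (harmSum 2 (fun _ => 1) x - harmSum 2 (iicWeight j) x) =
        ∑ m ∈ normLE 2 x, (1 - iicWeight j (cardFactors m)) * ((j - A) * z ^ j) /
          scaledNorm 2 m := by
      rw [harmSum, harmSum, ← Finset.sum_sub_distrib, Finset.mul_sum]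
      refine Finset.sum_congr rfl fun m _ => ?_
      ring
    have e2 : ∑ m ∈ normLE 2 x, (((cardFactors m : ℝ) - A) * z ^ cardFactors m + A * z ^ A) /
        scaledNorm 2 m = ∑ m ∈ normLE 2 x, z ^ cardFactors m / scaledNorm 2 m * cardFactors m -
          A * V + A * z ^ A * harmSum 2 (fun _ => 1) x := by
      rw [hV, harmSum, harmSum, Finset.mul_sum, Finset.mul_sum, ← Finset.sum_sub_distrib,
        ← Finset.sum_add_distrib]
      refine Finset.sum_congr rfl fun m _ => ?_
      ring
    rw [e1]
    refine le_trans (Finset.sum_le_sum fun m hm => div_le_div_of_nonneg_right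
      (sub_mul_pow_add_ge hz1 hA0 (by linarith) _) (normLE_facts hc hm).1.le) ?_
    rw [e2]
    linarith
  have hV1 : 0 ≤ harmSum 2 (fun _ => 1) x := harmSum_nonneg hc (fun _ => zero_le_one) x
  have h5 : A * z ^ A ≤ ε * ((j - A) * z ^ j) := by
    have e1 : (z : ℝ) ^ A ≤ Real.exp (-(δ / 4 * Real.log z * L)) * z ^ j := by
      rw [← Real.rpow_natCast z j, Real.rpow_def_of_pos hz0, Real.rpow_def_of_pos hz0,
        ← Real.exp_add, Real.exp_le_exp]
      have := mul_le_mul_of_nonneg_left hjA (Real.log_nonneg hz1.le)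
      linarith
    have e2 : A ≤ 16 / δ * (j - A) := by
      have : 16 / δ * (δ / 4 * L) = 4 * L := by field_simp; ring
      have h6 := mul_le_mul_of_nonneg_left hjA (show 0 ≤ 16 / δ by positivity)
      linarith
    have hjA0 : 0 ≤ (j : ℝ) - A := by linarith
    calc A * z ^ A ≤ 16 / δ * (j - A) * (Real.exp (-(δ / 4 * Real.log z * L)) * z ^ j) :=
          mul_le_mul e2 e1 (by positivity) (by positivity)
      _ = 16 / δ * Real.exp (-(δ / 4 * Real.log z * L)) * ((j - A) * z ^ j) := by ring
      _ ≤ _ := mul_le_mul_of_nonneg_right hL2.le (by positivity)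
  have h6 : ((j : ℝ) - A) * z ^ j * (harmSum 2 (fun _ => 1) x - harmSum 2 (iicWeight j) x) ≤
      ((j : ℝ) - A) * z ^ j * (ε * harmSum 2 (fun _ => 1) x) := by
    refine h4.trans ((mul_le_mul_of_nonneg_right h5 hV1).trans (le_of_eq ?_))
    ring
  have h7 := le_of_mul_le_mul_left h6 (mul_pos (by linarith) (by positivity))
  linarith

section

variable {τ : ℝ} {g : ℕ → ℕ}

set_option maxHeartbeats 1000000 in
lemma eventually_le_nuOmega_div_of_two_lt (hτ : 2 < τ)
    (hg : Tendsto (fun n : ℕ => (g n : ℝ) / Real.log (Real.log (n : ℝ))) atTop (𝓝 τ))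
    (k : ℕ) {a b t : ℝ} (ha : 0 < a) (hab : a ≤ b) (ht : 0 < t) (htb : t < 1 - b) :
    ∀ᶠ n : ℕ in atTop, ∀ P : ℝ, (n : ℝ) ^ a ≤ P → P ≤ (n : ℝ) ^ b →
      (2 - t) * (1 - t) / ((2 + t) * (1 + t)) * (1 - b - t) ^ (1 + t) * 2 ^ k / P ≤
        (nuOmega (g n - k) (n / P) : ℝ) / (nuOmega (g n) n : ℝ) := by
  have hc : (2 : ℕ) = 1 ∨ (2 : ℕ) = 2 := Or.inr rfl
  have hBP : BelowPrimes 2 1 := belowPrimes_two one_pos (by norm_num)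
  have ht1 : t < 1 := by linarith
  have hu0 : 0 < 1 - b - t := by linarith
  have hu1 : 1 - b - t < 1 := by linarith
  obtain ⟨D, U, hD, hU, hSV⟩ := exists_div_rpow_mul_harmSum_le hc hBP (κ' := 2 + t)
    (by push_cast; linarith)
  obtain ⟨X₀, hX₀3, hX₀⟩ := exists_harmSum_one_le_harmSum_iicWeight
    (show 0 < (τ - 2) / 2 by linarith) ht
  obtain ⟨x₃, hx₃2, hx₃⟩ := cntSum_mul_log_le_of_shiftRatioLE hc hBP (A := 1) zero_le_one ht
  obtain ⟨K, hK1, hK⟩ := le_log_mul_cntSum hc ht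
  have hlK : 0 ≤ Real.log K := Real.log_nonneg hK1
  have hη : 0 < t * (1 - b - t) / 4 := by positivity
  have hη' : t * (1 - b - t) / 4 < (1 - b - t) / 4 := by nlinarith
  have hlogn := tendsto_log_natCast
  filter_upwards [eventually_gt_atTop 1,
    hlogn.eventually_ge_atTop ((Real.log K + D) / (t * (1 - b - t) / 4)),
    hlogn.eventually_ge_atTop (U / (t * (1 - b - t) / 4)),
    hlogn.eventually_ge_atTop (Real.log X₀ / (1 / 4)),
    hlogn.eventually_ge_atTop (Real.log x₃ / (1 / 4)),
    hlogn.eventually_ge_atTop (k * Real.log 2 / a),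
    eventually_le_mul_log hg hη,
    eventually_mul_log_log_le hg (show 2 + (τ - 2) / 2 < τ by linarith) (k + 1),
    eventually_mul_log_log_le hg (show (0 : ℝ) < τ by linarith) (k + 1),
    eventually_nuOmega_pos hg]
    with n hn1 h1 h2 h3 h4 h5 h6 h7 h8 hpos P hP1 hP2
  have hn0 : (0 : ℝ) < n := by exact_mod_cast (by omega : 0 < n)
  obtain ⟨hP, hl1, -⟩ := log_div_bounds hn0 hP1 hP2
  have hR : 0 < Real.log n := Real.log_pos (by exact_mod_cast hn1)
  rw [div_le_iff₀ hη] at h1 h2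
  rw [div_le_iff₀ (by norm_num)] at h3 h4
  rw [div_le_iff₀ ha] at h5
  obtain ⟨d, hd⟩ : ∃ d, g n = d + k + 1 := by
    refine ⟨g n - k - 1, ?_⟩
    have : k + 1 ≤ g n := by
      rw [zero_mul, zero_add] at h8
      exact_mod_cast h8
    omega
  have hdR : (g n : ℝ) = d + k + 1 := by rw [hd]; push_cast; ring
  set R := Real.log (n : ℝ) with hRdef
  set X : ℝ := n / 2 ^ g n with hX
  set X' : ℝ := n / P / 2 ^ (d + 1) with hX'
  have hXX' : X * 2 ^ k = P * X' := by
    rw [hX, hX', hd]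
    field_simp
    ring
  have hX0 : 0 < X := by positivity
  have hX'0 : 0 < X' := by positivity
  have hl2 := Real.log_two_lt_d9
  have hl20 : 0 < Real.log 2 := Real.log_pos one_lt_two
  have hg2 : (g n : ℝ) * Real.log 2 ≤ t * (1 - b - t) / 4 * R := by
    refine le_trans ?_ h6
    exact mul_le_of_le_one_right (Nat.cast_nonneg _) (by linarith)
  have hlX : Real.log X = R - g n * Real.log 2 := by
    rw [hX, Real.log_div hn0.ne' (by positivity), Real.log_pow]
  have hlX' : Real.log X' = Real.log (n / P) - (d + 1) * Real.log 2 := by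
    rw [hX', Real.log_div (by positivity) (by positivity), Real.log_pow]
    push_cast
    rfl
  have hηR : t * (1 - b - t) / 4 * R ≤ (1 - b - t) / 4 * R := by gcongr
  have huR : (1 - b - t) * R ≤ 1 * R := by gcongr
  have hlXR : Real.log X ≤ R := by
    rw [hlX]
    have : 0 ≤ (g n : ℝ) * Real.log 2 := by positivity
    linarith
  have hlX4 : 1 / 4 * R ≤ Real.log X := by
    rw [hlX]; linarith
  have hX4 : ∀ y : ℝ, 0 < y → Real.log y ≤ R * (1 / 4) → y ≤ X := fun y hy h =>
    (Real.log_le_log_iff hy hX0).1 (by linarith)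
  have hlX0 : 0 < Real.log X := by linarith
  have hdg : ((d : ℝ) + 1) * Real.log 2 ≤ g n * Real.log 2 := by
    refine mul_le_mul_of_nonneg_right ?_ hl20.le
    rw [hdR]
    have : (0 : ℝ) ≤ k := Nat.cast_nonneg k
    linarith
  have htR : 0 < t * R := by positivity
  -- the range `x = X' / K` in terms of `X`
  have hlx : Real.log (X' / K) = Real.log X' - Real.log K :=
    Real.log_div hX'0.ne' (by linarith)
  have hlow1 : (1 - b - t) * R ≤ Real.log (X' / K) - D := by
    rw [hlx, hlX']
    have : t * (1 - b - t) / 4 * R ≤ t * 1 / 4 * R := by gcongr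
    linarith
  have hq : 1 - b - t ≤ (Real.log (X' / K) - D) / Real.log X := by
    rw [le_div_iff₀ hlX0]
    exact (mul_le_mul_of_nonneg_left hlXR hu0.le).trans hlow1
  set q := (Real.log (X' / K) - D) / Real.log X with hqdef
  have hq0 : 0 < q := hu0.trans_le hq
  have hlX'q : Real.log X' ≤ (1 + t) * (q * Real.log X) := by
    rw [hqdef, div_mul_cancel₀ _ hlX0.ne']
    have : t * ((1 - b - t) * R) ≤ t * (Real.log (X' / K) - D) := by gcongr
    rw [hlx] at this ⊢
    linarith
  have hX'1 : 1 ≤ X' := by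
    by_contra hneg
    have h := Real.log_neg hX'0 (not_le.1 hneg)
    rw [hlx] at hlow1
    have := mul_pos hu0 hR
    linarith
  have hxX : X' / K ≤ X := by
    refine (div_le_self hX'0.le hK1).trans ?_
    have h2P : (2 : ℝ) ^ k ≤ P := by
      refine le_trans ?_ hP1
      rw [← Real.log_le_log_iff (by positivity) (by positivity), Real.log_pow, Real.log_rpow hn0]
      linarith
    refine le_of_mul_le_mul_left ?_ hP
    rw [← hXX', mul_comm]
    exact mul_le_mul_of_nonneg_right h2P hX0.le
  -- upper bound for the denominator
  have hup : (nuOmega (g n) n : ℝ) * Real.log X ≤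
      (2 + t) * (X * harmSum 2 (fun _ => 1) X) := by
    have h := hx₃ (fun _ => 1) (fun _ => zero_le_one) X (hX4 _ (by linarith) h4)
      (shiftRatioLE_one_of_antitone hc antitone_const X) (by rw [one_mul]; exact le_rfl)
    rw [nuOmega_eq_cntSum_two]
    refine le_trans (mul_le_mul_of_nonneg_right ?_ hlX0.le) h
    exact Finset.sum_le_sum fun m _ => iicWeight_le_one _ _
  have hlow := hK _ (iicWeight_nonneg (d + 1)) X' hX'1
  rw [shiftWeight_iicWeight, ← nuOmega_eq_cntSum_two, Nat.cast_ofNat] at hlow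
  have hsv := hSV _ (iicWeight_nonneg d) U X le_rfl hX0
    (fun y _ _ => shiftRatioLE_one_of_antitone hc (antitone_iicWeight d) y) (X' / K)
    (by positivity) (by linarith) hxX
  have htail : (1 - t) * harmSum 2 (fun _ => 1) X ≤ harmSum 2 (iicWeight d) X := by
    refine hX₀ X (hX4 _ (by linarith) h3) d ?_
    have : (2 + (τ - 2) / 2) * Real.log (Real.log X) ≤
        (2 + (τ - 2) / 2) * Real.log R :=
      mul_le_mul_of_nonneg_left (Real.log_le_log hlX0 hlXR) (by linarith)
    linarith
  have hgk : g n - k = d + 1 := by omega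
  have hqt : (1 - b - t) ^ (1 + t) * q ≤ q ^ (2 + t) := by
    rw [show 2 + t = 1 + t + 1 by ring, Real.rpow_add_one hq0.ne']
    exact mul_le_mul_of_nonneg_right (Real.rpow_le_rpow hu0.le hq (by linarith)) hq0.le
  rw [hgk, div_le_div_iff₀ hP hpos]
  set N1 := ((nuOmega (g n) n : ℕ) : ℝ)
  set N2 := ((nuOmega (d + 1) (n / P) : ℕ) : ℝ)
  set V1 := harmSum 2 (fun _ => 1) X
  set W := (1 - b - t) ^ (1 + t)
  have hW : 0 ≤ W := Real.rpow_nonneg hu0.le _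
  have hV1 : 0 ≤ V1 := harmSum_nonneg hc (fun _ => zero_le_one) X
  have hN2 : 0 ≤ N2 := Nat.cast_nonneg _
  refine le_of_mul_le_mul_right ?_ (mul_pos (show 0 < (1 + t) * q by positivity) hlX0)
  calc (2 - t) * (1 - t) / ((2 + t) * (1 + t)) * W * 2 ^ k * N1 * ((1 + t) * q * Real.log X)
      = (2 - t) * (1 - t) / (2 + t) * (W * q) * 2 ^ k * (N1 * Real.log X) := by
        field_simp
    _ ≤ (2 - t) * (1 - t) / (2 + t) * (W * q) * 2 ^ k * ((2 + t) * (X * V1)) := by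
        refine mul_le_mul_of_nonneg_left hup ?_
        have h1 : 0 ≤ 1 - t := by linarith
        have h2 : 0 ≤ 2 - t := by linarith
        positivity
    _ = (2 - t) * (X * 2 ^ k) * ((W * q) * ((1 - t) * V1)) := by
        field_simp
    _ ≤ (2 - t) * (X * 2 ^ k) * harmSum 2 (iicWeight d) (X' / K) := by
        refine mul_le_mul_of_nonneg_left ?_ (mul_nonneg (by linarith) (by positivity))
        refine le_trans ?_ hsv
        exact mul_le_mul hqt htail (mul_nonneg (by linarith) hV1) (by positivity)
    _ = P * ((2 - t) * X' * harmSum 2 (iicWeight d) (X' / K)) := by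
        rw [hXX']; ring
    _ ≤ P * (Real.log X' * N2) := mul_le_mul_of_nonneg_left hlow hP.le
    _ ≤ P * ((1 + t) * (q * Real.log X) * N2) := by gcongr
    _ = _ := by ring

end

lemma rpow_sum_le_prod {k : ℕ} {a b : Fin k → ℝ} {n : ℕ} (hn : 0 < n) {p : Fin k → ℕ}
    (hp : ∀ i, (p i).Prime ∧ (n : ℝ) ^ (a i) ≤ (p i : ℝ) ∧ (p i : ℝ) ≤ (n : ℝ) ^ (b i)) :
    (n : ℝ) ^ (∑ i, a i) ≤ ∏ i, (p i : ℝ) ∧ ∏ i, (p i : ℝ) ≤ (n : ℝ) ^ (∑ i, b i) := by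
  have hn0 : (0 : ℝ) < n := by exact_mod_cast hn
  rw [Real.rpow_sum_of_pos hn0, Real.rpow_sum_of_pos hn0]
  exact ⟨Finset.prod_le_prod (fun i _ => by positivity) fun i _ => (hp i).2.1,
    Finset.prod_le_prod (fun i _ => by positivity) fun i _ => (hp i).2.2⟩

lemma exists_pos_lt_le {F : ℝ → ℝ} (hF : ContinuousAt F 0) {y δ : ℝ} (hy : y < F 0)
    (hδ : 0 < δ) : ∃ t, 0 < t ∧ t < δ ∧ y ≤ F t := by
  have h := (hF.tendsto.mono_left nhdsWithin_le_nhds).eventually_const_lt (u := y) hy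
    |>.and (Ioo_mem_nhdsGT hδ)
  obtain ⟨t, h1, h2⟩ := h.exists
  exact ⟨t, h2.1, h2.2, h1.le⟩

/-- Uniform lower bounds, derived from the Selberg–Delange formulas, for the ratios
`ν_{g(n)−k}(n/(p₁⋯p_k)) / ν_{g(n)}(n)` when `g(n)/log log n → τ`, for primes
`p_i ∈ [n^{a_i}, n^{b_i}]` with the `[a_i, b_i]` pairwise disjoint subintervals of (0,1]
and `b = ∑ b_i < 1`: case (i) is `τ < 2`, case (ii) is `τ > 2`. -/
theorem stmt17 (τ : ℝ) (hτ : 0 < τ) (hτ2 : τ ≠ 2) (g : ℕ → ℕ)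
    (hglim : Tendsto (fun n : ℕ => (g n : ℝ) / Real.log (Real.log (n : ℝ)))
      atTop (𝓝 τ))
    (k : ℕ) (hk : 1 ≤ k) (a b : Fin k → ℝ)
    (ha : ∀ i, 0 < a i) (hab : ∀ i, a i ≤ b i) (hb1 : ∀ i, b i ≤ 1)
    (hdisj : ∀ i j, i ≠ j → Disjoint (Icc (a i) (b i)) (Icc (a j) (b j)))
    (hsum : ∑ i, b i < 1) :
    (τ < 2 → ∀ ε : ℝ, 0 < ε → ∃ n₀ : ℕ, ∀ n : ℕ, n₀ ≤ n →
      ∀ p : Fin k → ℕ, (∀ i, (p i).Prime ∧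
          (n : ℝ) ^ (a i) ≤ (p i : ℝ) ∧ (p i : ℝ) ≤ (n : ℝ) ^ (b i)) →
        (1 - ε) * τ ^ k * (1 - ∑ i, b i) ^ τ /
            ((1 - ∑ i, a i) * ∏ i, (p i : ℝ)) ≤
          (nuOmega (g n - k) ((n : ℝ) / ∏ i, (p i : ℝ)) : ℝ) / (nuOmega (g n) (n : ℝ) : ℝ))
    ∧
    (2 < τ → ∀ ε : ℝ, 0 < ε → ∃ n₀ : ℕ, ∀ n : ℕ, n₀ ≤ n →
      ∀ p : Fin k → ℕ, (∀ i, (p i).Prime ∧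
          (n : ℝ) ^ (a i) ≤ (p i : ℝ) ∧ (p i : ℝ) ≤ (n : ℝ) ^ (b i)) →
        (1 - ε) * 2 ^ k * (1 - ∑ i, b i) / (∏ i, (p i : ℝ)) ≤
          (nuOmega (g n - k) ((n : ℝ) / ∏ i, (p i : ℝ)) : ℝ) /
            (nuOmega (g n) (n : ℝ) : ℝ)) := by
  have : NeZero k := ⟨by omega⟩
  have hA : 0 < ∑ i, a i := Finset.sum_pos (fun i _ => ha i) Finset.univ_nonempty
  have hAB : ∑ i, a i ≤ ∑ i, b i := Finset.sum_le_sum fun i _ => hab i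
  set A := ∑ i, a i
  set B := ∑ i, b i
  have hB0 : 0 < 1 - B := by linarith
  refine ⟨fun hlt ε hε => ?_, fun hgt ε hε => ?_⟩
  · obtain ⟨t, ht0, ht1, ht⟩ := exists_pos_lt_le
      (F := fun t => (1 - t) / (1 + t) * (1 - B - t) ^ (τ + t) * (τ - t) ^ k)
      (y := (1 - ε) * τ ^ k * (1 - B) ^ τ) (δ := min τ (1 - B))
      (by
        refine ((ContinuousAt.div (by fun_prop) (by fun_prop) (by norm_num)).mul
          (ContinuousAt.rpow (by fun_prop) (by fun_prop) (Or.inl ?_))).mul (by fun_prop)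
        simpa using hB0.ne')
      (by
        have : 0 < τ ^ k * (1 - B) ^ τ := mul_pos (pow_pos hτ k) (Real.rpow_pos_of_pos hB0 τ)
        simp only [sub_zero, add_zero, div_one, one_mul]
        nlinarith)
      (lt_min hτ hB0)
    rw [lt_min_iff] at ht1
    obtain ⟨n₀, hn₀⟩ := ((eventually_le_nuOmega_div_of_lt_two hτ hlt hglim k hA.le hAB hsum ht0
      ht1.1 ht1.2).and (eventually_gt_atTop 0)).exists_forall_of_atTop
    refine ⟨n₀, fun n hn p hp => ?_⟩
    obtain ⟨h1, h2⟩ := hn₀ n hn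
    obtain ⟨h3, h4⟩ := rpow_sum_le_prod h2 hp
    refine (div_le_div_of_nonneg_right ht ?_).trans (h1 _ h3 h4)
    exact mul_nonneg (by linarith) (by positivity)
  · obtain ⟨t, ht0, ht1, ht⟩ := exists_pos_lt_le
      (F := fun t => (2 - t) * (1 - t) / ((2 + t) * (1 + t)) * (1 - B - t) ^ (1 + t) * 2 ^ k)
      (y := (1 - ε) * 2 ^ k * (1 - B)) (δ := 1 - B)
      (by
        refine ((ContinuousAt.div (by fun_prop) (by fun_prop) (by norm_num)).mul
          (ContinuousAt.rpow (by fun_prop) (by fun_prop) (Or.inl ?_))).mul (by fun_prop)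
        simpa using hB0.ne')
      (by
        have : 0 < 2 ^ k * (1 - B) := by positivity
        norm_num
        nlinarith)
      hB0
    obtain ⟨n₀, hn₀⟩ := ((eventually_le_nuOmega_div_of_two_lt hgt hglim k hA hAB ht0
      ht1).and (eventually_gt_atTop 0)).exists_forall_of_atTop
    refine ⟨n₀, fun n hn p hp => ?_⟩
    obtain ⟨h1, h2⟩ := hn₀ n hn
    obtain ⟨h3, h4⟩ := rpow_sum_le_prod h2 hp
    exact (div_le_div_of_nonneg_right ht (by positivity)).trans (h1 _ h3 h4)
end

section
/- Let k ≥ 1, let p₁, …, p_k be distinct primes, let g ≥ k be an integer, and let n be a positive integer (or real ≥ 1). Then #{m : m ≤ n, ω(m) = g, and p_i ∣ m for each i = 1,…,k} ≥ #{m : m ≤ n/(p₁⋯p_k), ω(m) = g − k} − ∑_{i=1}^{k} n/(p₁⋯p_k·p_i), where m ranges over positive integers. -/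
open Filter Set Topology

open scoped Classical

theorem Nat.card_primeFactors_mul_prod_primes {ι : Type*} [Fintype ι] {p : ι → ℕ}
    (hp : ∀ i, (p i).Prime) (hinj : Function.Injective p) {m : ℕ} (h : ∀ i, ¬ p i ∣ m) :
    ((∏ i, p i) * m).primeFactors.card = Fintype.card ι + m.primeFactors.card := by
  have hcop : Nat.Coprime (∏ i, p i) m :=
    Nat.Coprime.prod_left fun i _ => (Nat.Prime.coprime_iff_not_dvd (hp i)).2 (h i)
  have hprod : ∏ i, p i = ∏ q ∈ Finset.univ.image p, q :=
    (Finset.prod_image (f := fun q => q) hinj.injOn).symm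
  have hfac : (∏ i, p i).primeFactors = Finset.univ.image p := by
    rw [hprod]
    refine Nat.primeFactors_prod fun q hq => ?_
    obtain ⟨i, -, rfl⟩ := Finset.mem_image.1 hq
    exact hp i
  rw [hcop.primeFactors_mul, Finset.card_union_of_disjoint hcop.disjoint_primeFactors, hfac,
    Finset.card_image_of_injective _ hinj, Finset.card_univ]

/-- Counting inequality used for the `ω`-conditioned Billingsley theorem: for distinct
primes `p₁, …, p_k` and `g ≥ k`, the number of `m ≤ n` with `ω(m) = g` divisible by every
`p_i` is at least the number of `m ≤ n/(p₁⋯p_k)` with `ω(m) = g − k`, minus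
`∑ i, n/(p₁⋯p_k·p_i)`. -/
theorem stmt19 (k : ℕ) (hk : 1 ≤ k) (p : Fin k → ℕ) (hp : ∀ i, (p i).Prime)
    (hinj : Function.Injective p) (g : ℕ) (hg : k ≤ g) (n : ℕ) (hn : 1 ≤ n) :
    ((((Finset.Icc 1 n).filter
        (fun m => m.primeFactors.card = g ∧ ∀ i, p i ∣ m)).card : ℝ)) ≥
      ((((Finset.Icc 1 n).filter
          (fun m : ℕ => (m : ℝ) ≤ (n : ℝ) / (∏ i, (p i : ℝ)) ∧
            m.primeFactors.card = g - k)).card : ℝ)) -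
        ∑ i, (n : ℝ) / ((∏ j, (p j : ℝ)) * (p i : ℝ)) := by
  set P : ℕ := ∏ i, p i with hP
  have hPpos : 0 < P := Finset.prod_pos fun i _ => (hp i).pos
  have hPcast : (∏ i, (p i : ℝ)) = (P : ℝ) := by rw [hP]; push_cast; rfl
  have hle (m : ℕ) : (m : ℝ) ≤ (n : ℝ) / (P : ℝ) ↔ P * m ≤ n := by
    rw [le_div_iff₀ (by exact_mod_cast hPpos), mul_comm]
    norm_cast
  simp only [hPcast, hle]
  set T := (Finset.Icc 1 n).filter (fun m => m.primeFactors.card = g ∧ ∀ i, p i ∣ m)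
  set S := (Finset.Icc 1 n).filter (fun m : ℕ => P * m ≤ n ∧ m.primeFactors.card = g - k)
  let B : Fin k → Finset ℕ := fun i => (Finset.Ioc 0 (n / P)).filter (fun m => p i ∣ m)
  have hgood : (S.filter (fun m => ∀ i, ¬ p i ∣ m)).card ≤ T.card := by
    refine Finset.card_le_card_of_injOn (fun m => P * m) ?_
      fun a _ b _ hab => Nat.eq_of_mul_eq_mul_left hPpos hab
    intro m hm
    simp only [S, T, Finset.coe_filter, Finset.mem_filter, Finset.mem_Icc,
      Set.mem_ofPred_eq] at hm ⊢
    obtain ⟨⟨⟨hm1, -⟩, hmn, hcard⟩, hnd⟩ := hm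
    refine ⟨⟨Nat.mul_pos hPpos hm1, hmn⟩, ?_, fun i =>
      (Finset.dvd_prod_of_mem p (Finset.mem_univ i)).mul_right m⟩
    rw [hP, Nat.card_primeFactors_mul_prod_primes hp hinj hnd, hcard, Fintype.card_fin]
    omega
  have hsub : S ⊆ S.filter (fun m => ∀ i, ¬ p i ∣ m) ∪ Finset.univ.biUnion B := by
    intro m hm
    by_cases h : ∀ i, ¬ p i ∣ m
    · exact Finset.mem_union_left _ (Finset.mem_filter.2 ⟨hm, h⟩)
    · push Not at h
      obtain ⟨i, hi⟩ := h
      simp only [S, Finset.mem_filter, Finset.mem_Icc] at hm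
      refine Finset.mem_union_right _ (Finset.mem_biUnion.2 ⟨i, Finset.mem_univ i, ?_⟩)
      refine Finset.mem_filter.2 ⟨Finset.mem_Ioc.2 ⟨hm.1.1, ?_⟩, hi⟩
      rw [Nat.le_div_iff_mul_le hPpos, mul_comm]
      exact hm.2.1
  have hcount : S.card ≤ T.card + ∑ i, (B i).card :=
    (Finset.card_le_card hsub).trans <| (Finset.card_union_le _ _).trans <|
      add_le_add hgood Finset.card_biUnion_le
  have hB (i : Fin k) : ((B i).card : ℝ) ≤ (n : ℝ) / ((P : ℝ) * (p i : ℝ)) := by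
    have hcard : (B i).card = n / (P * p i) := by
      rw [← Nat.div_div_eq_div_mul, ← Nat.Ioc_filter_dvd_card_eq_div]
    rw [hcard]
    exact_mod_cast Nat.cast_div_le (α := ℝ) (m := n) (n := P * p i)
  have hcount' : (S.card : ℝ) ≤ T.card + ∑ i, ((B i).card : ℝ) := by exact_mod_cast hcount
  have hsum := Finset.sum_le_sum fun i (_ : i ∈ Finset.univ) => hB i
  linarith
end
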